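/- arXiv:2406.00129 — 4 statements merged into one kernel-verified Lean document; each statement's English description precedes it below -/
import Mathlib

section
/- Let n ≥ 1 and m ≥ 1, and write the prime factorization m = p_1^{e_1} p_2^{e_2} ⋯ p_t^{e_t} with p_1 < p_2 < ⋯ < p_t prime and e_i ≥ 1. Set s(m) = Σ_{i=1}^{t} (p_i − 1) p_i^{e_i − 1}. Then GL(n,ℤ) contains an element of multiplicative order exactly m if and only if: s(m) − 1 ≤ n in the case m ≡ 2 (mod 4), and s(m) ≤ n otherwise. -/
open Polynomial

theorem Nat.Coprime.sum_primeFactors_ordProj {M : Type*} [AddCommMonoid M] (f : ℕ → M) {a b : ℕ}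
    (hab : a.Coprime b) :
    ∑ p ∈ (a * b).primeFactors, f (p ^ (a * b).factorization p) =
      ∑ p ∈ a.primeFactors, f (p ^ a.factorization p) +
        ∑ p ∈ b.primeFactors, f (p ^ b.factorization p) := by
  rw [hab.primeFactors_mul, Finset.sum_union hab.disjoint_primeFactors]
  congr 1 <;> refine Finset.sum_congr rfl fun p hp => ?_
  · rw [Nat.factorization_eq_of_coprime_left hab (by simpa using hp)]
  · rw [Nat.factorization_eq_of_coprime_right hab (by simpa using hp)]

/-- Totient, modified to vanish at `2` (and at `1`): the minimal dimension contributed by a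
prime power factor of the order of an integer matrix. -/
def totientOfTwoLt (q : ℕ) : ℕ := if q ≤ 2 then 0 else q.totient

theorem totientOfTwoLt_le (q : ℕ) : totientOfTwoLt q ≤ q.totient := by
  unfold totientOfTwoLt; split_ifs <;> simp

theorem sum_totientOfTwoLt_le_totient {d : ℕ} (hd : d ≠ 0) :
    ∑ p ∈ d.primeFactors, totientOfTwoLt (p ^ d.factorization p) ≤ d.totient := by
  induction d using Nat.recOnPosPrimePosCoprime with
  | prime_pow p k hp hk =>
    rw [Nat.primeFactors_prime_pow hk.ne' hp]
    simpa [hp.factorization_pow] using totientOfTwoLt_le _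
  | zero => exact absurd rfl hd
  | one => simp
  | coprime a b ha hb hab iha ihb =>
    have h2 : ∑ p ∈ Nat.primeFactors 2, totientOfTwoLt (p ^ Nat.factorization 2 p) = 0 := by
      simp [Nat.prime_two.primeFactors, Nat.prime_two.factorization, totientOfTwoLt]
    have iha := iha (by omega)
    have ihb := ihb (by omega)
    rw [hab.sum_primeFactors_ordProj, Nat.totient_mul hab]
    rcases Nat.lt_or_ge 2 a with ha2 | ha2
    · rcases Nat.lt_or_ge 2 b with hb2 | hb2
      · have h1 : 1 < a.totient := by
          have := (Nat.totient_even ha2); have := Nat.totient_pos.2 (show 0 < a by omega)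
          grind
        have h3 : 1 < b.totient := by
          have := (Nat.totient_even hb2); have := Nat.totient_pos.2 (show 0 < b by omega)
          grind
        nlinarith
      · obtain rfl : b = 2 := by omega
        rw [h2]; simpa using iha
    · obtain rfl : a = 2 := by omega
      rw [h2]; simpa using ihb

theorem sum_totientOfTwoLt_eq {m : ℕ} (h : m % 4 ≠ 2) :
    ∑ p ∈ m.primeFactors, totientOfTwoLt (p ^ m.factorization p) =
      ∑ p ∈ m.primeFactors, (p ^ m.factorization p).totient := by
  refine Finset.sum_congr rfl fun p hp => if_neg fun hle => h ?_
  have hpp := Nat.prime_of_mem_primeFactors hp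
  have hm : m ≠ 0 := (Nat.mem_primeFactors.1 hp).2.2
  have hk : 0 < m.factorization p :=
    hpp.factorization_pos_of_dvd hm (Nat.dvd_of_mem_primeFactors hp)
  have hle' : p ≤ 2 := (Nat.le_self_pow hk.ne' p).trans hle
  obtain rfl : p = 2 := le_antisymm hle' hpp.two_le
  have h1 : m.factorization 2 ≤ 1 := (Nat.pow_le_pow_iff_right one_lt_two).1 (by simpa using hle)
  have h4 : ¬ 4 ∣ m := fun h4 => by
    have := (Nat.prime_two.pow_dvd_iff_le_factorization (k := 2) hm).1 (by simpa using h4)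
    omega
  have h2 := Nat.dvd_of_mem_primeFactors hp
  omega

/-- If divisors of `m` indexed by `D` jointly attain the full power of each prime, the sum of
their totients bounds the contribution of `m`. -/
theorem sum_totientOfTwoLt_le_sum_totient {m : ℕ} (D : Finset ℕ) (hm : m ≠ 0)
    (hD : ∀ d ∈ D, d ∣ m)
    (h : ∀ p ∈ m.primeFactors, ∃ d ∈ D, d.factorization p = m.factorization p) :
    ∑ p ∈ m.primeFactors, totientOfTwoLt (p ^ m.factorization p) ≤ ∑ d ∈ D, d.totient := by
  calc _ ≤ ∑ p ∈ m.primeFactors, ∑ d ∈ D, totientOfTwoLt (p ^ d.factorization p) := by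
        refine Finset.sum_le_sum fun p hp => ?_
        obtain ⟨d, hd, e⟩ := h p hp
        rw [← e]
        exact Finset.single_le_sum (f := fun d => totientOfTwoLt (p ^ d.factorization p))
          (fun _ _ => Nat.zero_le _) hd
    _ = ∑ d ∈ D, ∑ p ∈ m.primeFactors, totientOfTwoLt (p ^ d.factorization p) :=
        Finset.sum_comm
    _ ≤ _ := by
        refine Finset.sum_le_sum fun d hd => ?_
        refine le_trans (le_of_eq ?_)
          (sum_totientOfTwoLt_le_totient (ne_zero_of_dvd_ne_zero hm (hD d hd)))
        refine (Finset.sum_subset (Nat.primeFactors_mono (hD d hd) hm) fun p _ hp => ?_).symm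
        rw [Finsupp.notMem_support_iff.1 (by simpa using hp)]
        simp [totientOfTwoLt]

/-- A rational divisor of `X ^ m - 1` is, up to a unit, a product of distinct cyclotomic
polynomials. -/
theorem exists_prod_cyclotomic_eq_of_dvd {m : ℕ} (hm : 0 < m) {μ : ℚ[X]} (hμ : μ ∣ X ^ m - 1) :
    ∃ D ⊆ m.divisors, Associated μ (∏ d ∈ D, cyclotomic d ℚ) := by
  classical
  refine ⟨m.divisors.filter fun d => cyclotomic d ℚ ∣ μ, Finset.filter_subset _ _,
    associated_of_dvd_dvd ?_ ?_⟩
  · rw [← prod_cyclotomic_eq_X_pow_sub_one hm,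
      ← Finset.prod_filter_mul_prod_filter_not _ (fun d => cyclotomic d ℚ ∣ μ)] at hμ
    refine IsCoprime.dvd_of_dvd_mul_right (IsCoprime.prod_right fun d hd => ?_) hμ
    rw [Finset.mem_filter, Nat.mem_divisors] at hd
    exact (((cyclotomic.irreducible_rat
      (Nat.pos_of_dvd_of_pos hd.1.1 hm)).coprime_iff_not_dvd).2 hd.2).symm
  · exact Finset.prod_dvd_of_coprime
      (fun a _ b _ hab => cyclotomic.isCoprime_rat hab)
      (fun d hd => (Finset.mem_filter.1 hd).2)

theorem Nat.factorization_eq_of_dvd_of_not_dvd_div {d m p : ℕ} (hm : m ≠ 0) (hp : p.Prime)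
    (hpm : p ∣ m) (hd : d ∣ m) (h : ¬ d ∣ m / p) : d.factorization p = m.factorization p := by
  obtain ⟨c, rfl⟩ := hd
  have hd0 : d ≠ 0 := left_ne_zero_of_mul hm
  have hc : ¬ p ∣ c := by
    rintro ⟨e, rfl⟩
    refine h ⟨e, Nat.div_eq_of_eq_mul_left hp.pos (by ring)⟩
  rw [Nat.factorization_mul hd0 (right_ne_zero_of_mul hm), Finsupp.add_apply,
    Nat.factorization_eq_zero_of_not_dvd hc, add_zero]

theorem sum_totientOfTwoLt_le_of_orderOf {n : ℕ} (A : Matrix (Fin n) (Fin n) ℚ)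
    (hA : 0 < orderOf A) :
    ∑ p ∈ (orderOf A).primeFactors, totientOfTwoLt (p ^ (orderOf A).factorization p) ≤ n := by
  set m := orderOf A with hmdef
  have hdvd : ∀ k, minpoly ℚ A ∣ X ^ k - 1 ↔ m ∣ k := fun k => by
    rw [minpoly.dvd_iff, orderOf_dvd_iff_pow_eq_one]
    simp [sub_eq_zero]
  obtain ⟨D, hDm, hD⟩ := exists_prod_cyclotomic_eq_of_dvd hA ((hdvd m).2 dvd_rfl)
  have hDd : ∀ d ∈ D, d ∣ m := fun d hd => Nat.dvd_of_mem_divisors (hDm hd)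
  refine (sum_totientOfTwoLt_le_sum_totient D hA.ne' hDd fun p hp => ?_).trans ?_
  · have hpp := Nat.prime_of_mem_primeFactors hp
    have hpm := Nat.dvd_of_mem_primeFactors hp
    have hpos : 0 < m / p := Nat.div_pos (Nat.le_of_dvd hA hpm) hpp.pos
    by_contra! hne
    have hall : ∀ d ∈ D, d ∣ m / p := fun d hd => by
      by_contra hnd
      exact hne d hd (Nat.factorization_eq_of_dvd_of_not_dvd_div hA.ne' hpp hpm (hDd d hd) hnd)
    have : m ∣ m / p := by
      rw [← hdvd, hD.dvd_iff_dvd_left, ← prod_cyclotomic_eq_X_pow_sub_one hpos]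
      exact Finset.prod_dvd_prod_of_subset _ _ _ fun d hd =>
        Nat.mem_divisors.2 ⟨hall d hd, hpos.ne'⟩
    exact absurd (Nat.le_of_dvd hpos this) (Nat.div_lt_self hA hpp.one_lt).not_ge
  · have hle := natDegree_le_of_dvd (hD.symm.dvd.trans A.minpoly_dvd_charpoly)
      A.charpoly_monic.ne_zero
    rwa [A.charpoly_natDegree_eq_dim, Fintype.card_fin,
      natDegree_prod _ _ fun d _ => cyclotomic_ne_zero d ℚ,
      Finset.sum_congr rfl fun d _ => natDegree_cyclotomic d ℚ] at hle

theorem cyclotomic_dvd_X_pow_sub_one_iff {q : ℕ} (hq : 0 < q) (k : ℕ) :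
    cyclotomic q ℤ ∣ X ^ k - 1 ↔ q ∣ k := by
  refine ⟨fun ⟨c, hc⟩ => ?_, fun h => ?_⟩
  · have hζ := Complex.isPrimitiveRoot_exp q hq.ne'
    refine hζ.dvd_of_pow_eq_one k ?_
    have h0 : aeval (Complex.exp (2 * Real.pi * Complex.I / q)) (cyclotomic q ℤ) = 0 := by
      rw [cyclotomic_eq_minpoly hζ hq, minpoly.aeval]
    have := congrArg (aeval (Complex.exp (2 * Real.pi * Complex.I / q))) hc
    rw [map_mul, h0, zero_mul] at this
    simpa [sub_eq_zero] using this
  · refine (cyclotomic.dvd_X_pow_sub_one q ℤ).trans ?_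
    obtain ⟨c, rfl⟩ := h
    rw [pow_mul]
    simpa using sub_dvd_pow_sub_pow (X ^ q : ℤ[X]) 1 c

theorem Nat.dvd_iff_forall_ordProj_dvd {m : ℕ} (hm : m ≠ 0) (k : ℕ) :
    m ∣ k ↔ ∀ p ∈ m.primeFactors, p ^ m.factorization p ∣ k := by
  refine ⟨fun h p _ => (Nat.ordProj_dvd m p).trans h, fun h => ?_⟩
  rw [Nat.dvd_iff_prime_pow_dvd_dvd]
  intro p e hp he
  rcases Nat.eq_zero_or_pos e with rfl | hpos
  · simp
  · exact (pow_dvd_pow p ((hp.pow_dvd_iff_le_factorization hm).1 he)).trans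
      (h p (Nat.mem_primeFactors.2 ⟨hp, (dvd_pow_self p hpos.ne').trans he, hm⟩))

/-- The product of the `p ^ v_p(m)`-th cyclotomic polynomials divides `X ^ k - 1` exactly when
`m` divides `k`. -/
theorem prod_cyclotomic_dvd_X_pow_sub_one_iff {m : ℕ} (hm : m ≠ 0) (k : ℕ) :
    ∏ p ∈ m.primeFactors, cyclotomic (p ^ m.factorization p) ℤ ∣ X ^ k - 1 ↔ m ∣ k := by
  rw [Nat.dvd_iff_forall_ordProj_dvd hm]
  refine ⟨fun h p hp => (cyclotomic_dvd_X_pow_sub_one_iff (Nat.ordProj_pos m p) k).1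
    ((Finset.dvd_prod_of_mem (fun p => cyclotomic (p ^ m.factorization p) ℤ) hp).trans h),
    fun h => ?_⟩
  rcases Nat.eq_zero_or_pos k with rfl | hk
  · simp
  have hinj : Set.InjOn (fun p => p ^ m.factorization p) (m.primeFactors : Set ℕ) := by
    intro p hp q hq hpq
    have hp' := Nat.mem_primeFactors.1 (Finset.mem_coe.1 hp)
    have hq' := Nat.mem_primeFactors.1 (Finset.mem_coe.1 hq)
    have hdvd : p ∣ q ^ m.factorization q := by
      have : p ^ m.factorization p = q ^ m.factorization q := hpq
      rw [← this]
      exact dvd_pow_self p (hp'.1.factorization_pos_of_dvd hm hp'.2.1).ne'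
    exact (Nat.prime_dvd_prime_iff_eq hp'.1 hq'.1).1 (hp'.1.dvd_of_dvd_pow hdvd)
  rw [← Finset.prod_image (f := fun q => cyclotomic q ℤ) hinj,
    ← prod_cyclotomic_eq_X_pow_sub_one hk]
  refine Finset.prod_dvd_prod_of_subset _ _ _ fun q hq => ?_
  obtain ⟨p, hp, rfl⟩ := Finset.mem_image.1 hq
  exact Nat.mem_divisors.2 ⟨h p hp, hk.ne'⟩

theorem exists_matrix_int_orderOf_eq_of_dvd_iff {P : ℤ[X]} (hP : P.Monic) {n m : ℕ}
    (hn : P.natDegree ≤ n) (h : ∀ k, P ∣ X ^ k - 1 ↔ m ∣ k) :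
    ∃ A : Matrix (Fin n) (Fin n) ℤ, orderOf A = m := by
  have := hP.free_adjoinRoot
  have := hP.finite_adjoinRoot
  have hr : Module.finrank ℤ ((Fin (n - P.natDegree) → ℤ) × AdjoinRoot P) = n := by
    rw [Module.finrank_prod, Module.finrank_fin_fun, (AdjoinRoot.powerBasis' hP).finrank,
      AdjoinRoot.powerBasis'_dim]
    omega
  let b := Module.finBasisOfFinrankEq ℤ _ hr
  refine ⟨Algebra.leftMulMatrix b (1, AdjoinRoot.root P), ?_⟩
  have key : ∀ k, Algebra.leftMulMatrix b (1, AdjoinRoot.root P) ^ k = 1 ↔ m ∣ k := fun k => by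
    rw [← map_pow, map_eq_one_iff _ (Algebra.leftMulMatrix_injective b), ← h,
      ← AdjoinRoot.mk_eq_zero]
    simp [Prod.ext_iff, sub_eq_zero]
  exact Nat.dvd_antisymm (orderOf_dvd_of_pow_eq_one ((key m).2 dvd_rfl))
    ((key _).1 (pow_orderOf_eq_one _))

theorem exists_GL_int_orderOf_eq {n m : ℕ} (hm : m ≠ 0)
    (h : ∑ p ∈ m.primeFactors, (p ^ m.factorization p).totient ≤ n) :
    ∃ θ : Matrix.GeneralLinearGroup (Fin n) ℤ, orderOf θ = m := by
  obtain ⟨A, hA⟩ := exists_matrix_int_orderOf_eq_of_dvd_iff (n := n)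
    (monic_prod_of_monic _ _ fun p _ => cyclotomic.monic (p ^ m.factorization p) ℤ)
    (by rwa [natDegree_prod _ _ fun d _ => cyclotomic_ne_zero _ ℤ,
      Finset.sum_congr rfl fun d _ => natDegree_cyclotomic _ ℤ])
    (prod_cyclotomic_dvd_X_pow_sub_one_iff hm)
  refine ⟨Units.ofPowEqOne A m (hA ▸ pow_orderOf_eq_one A) hm, ?_⟩
  rw [← orderOf_units, Units.val_ofPowEqOne, hA]

/-- For `n ≥ 1` and `m ≥ 1`, write `s(m) = Σ_{p ∣ m prime} φ(p ^ v_p(m))`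
(the sum of `(p-1)p^{e-1}` over the prime factorization `m = ∏ p^e`). Then `GL(n, ℤ)`
contains an element of multiplicative order exactly `m` if and only if `s(m) - 1 ≤ n`
when `m ≡ 2 (mod 4)` and `s(m) ≤ n` otherwise. -/
theorem exists_GL_int_orderOf_eq_iff (n m : ℕ) (hn : 1 ≤ n) (hm : 1 ≤ m) :
    (∃ θ : Matrix.GeneralLinearGroup (Fin n) ℤ, orderOf θ = m) ↔
      (if m % 4 = 2
        then (∑ p ∈ m.primeFactors, (p ^ (m.factorization p)).totient) - 1 ≤ n
        else (∑ p ∈ m.primeFactors, (p ^ (m.factorization p)).totient) ≤ n) := by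
  have lower : (∃ θ : Matrix.GeneralLinearGroup (Fin n) ℤ, orderOf θ = m) →
      ∑ p ∈ m.primeFactors, totientOfTwoLt (p ^ m.factorization p) ≤ n := by
    rintro ⟨θ, rfl⟩
    have hinj : Function.Injective
        ((Int.castRingHom ℚ).mapMatrix : Matrix (Fin n) (Fin n) ℤ →+* Matrix (Fin n) (Fin n) ℚ) :=
      Matrix.map_injective Int.cast_injective
    have ho := orderOf_injective (Int.castRingHom ℚ).mapMatrix.toMonoidHom hinj
      (θ : Matrix (Fin n) (Fin n) ℤ)
    rw [orderOf_units] at ho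
    have := sum_totientOfTwoLt_le_of_orderOf _ (ho ▸ hm)
    rwa [ho] at this
  split_ifs with h4
  · obtain ⟨k, rfl⟩ : 2 ∣ m := by omega
    have hcop : Nat.Coprime 2 k := by
      rw [Nat.coprime_two_left, Nat.odd_iff]; omega
    rw [hcop.sum_primeFactors_ordProj] at lower ⊢
    rw [sum_totientOfTwoLt_eq (m := k) (by omega)] at lower
    simp only [Nat.prime_two.primeFactors, Nat.prime_two.factorization, Finset.sum_singleton,
      Finsupp.single_eq_same, pow_one, Nat.totient_two, add_tsub_cancel_left] at lower ⊢
    refine ⟨fun h => (Nat.le_add_left _ _).trans (lower h), fun h => ?_⟩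
    obtain ⟨θ, hθ⟩ := exists_GL_int_orderOf_eq (by omega) h
    have h2 : orderOf (-1 : Matrix.GeneralLinearGroup (Fin n) ℤ) = 2 := by
      refine orderOf_eq_prime (by simp) fun h1 => ?_
      have hval : (-1 : Matrix (Fin n) (Fin n) ℤ) = 1 := by
        simpa using congrArg (fun u : Matrix.GeneralLinearGroup (Fin n) ℤ => u.val) h1
      have := congrFun (congrFun hval ⟨0, hn⟩) ⟨0, hn⟩
      simp at this
    refine ⟨-1 * θ, ?_⟩
    rw [(Commute.neg_one_left θ).orderOf_mul_eq_mul_orderOf_of_coprime (by rwa [h2, hθ]), h2, hθ]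
  · rw [← sum_totientOfTwoLt_eq h4]
    refine ⟨lower, fun h => exists_GL_int_orderOf_eq (by omega) ?_⟩
    rwa [← sum_totientOfTwoLt_eq h4]
end

section
/- Let θ be a real n×n invertible matrix with θ^N = 1 for some N ≥ 1. Then there exists a real invertible matrix S such that SθS⁻¹ has all integer entries if and only if the characteristic polynomial of θ equals (the real image of) a product ∏_{d ∣ N} Φ_d(X)^{m_d} of cyclotomic polynomials with natural-number exponents m_d; equivalently, if and only if for every d, any two primitive d-th roots of unity occur with equal multiplicity among the complex eigenvalues of θ. -/
open Polynomial

/-- Two diagonalizable endomorphisms whose eigenspaces have equal dimensions are conjugate. -/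
theorem Module.End.exists_linearEquiv_of_finrank_eigenspace_eq {K V W : Type*} [Field K]
    [AddCommGroup V] [Module K V] [FiniteDimensional K V]
    [AddCommGroup W] [Module K W] [FiniteDimensional K W]
    {f : Module.End K V} {g : Module.End K W}
    (hf : ⨆ μ, f.eigenspace μ = ⊤) (hg : ⨆ μ, g.eigenspace μ = ⊤)
    (h : ∀ μ, Module.finrank K (f.eigenspace μ) = Module.finrank K (g.eigenspace μ)) :
    ∃ e : V ≃ₗ[K] W, ∀ v, e (f v) = g (e v) := by
  classical
  have hfi := DirectSum.isInternal_submodule_of_iSupIndep_of_iSup_eq_top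
    f.eigenspaces_iSupIndep hf
  have hgi := DirectSum.isInternal_submodule_of_iSupIndep_of_iSup_eq_top
    g.eigenspaces_iSupIndep hg
  let φ := LinearEquiv.ofBijective (DirectSum.coeLinearMap f.eigenspace) hfi
  let ψ := LinearEquiv.ofBijective (DirectSum.coeLinearMap g.eigenspace) hgi
  let σ : ∀ μ, f.eigenspace μ ≃ₗ[K] g.eigenspace μ := fun μ ↦ LinearEquiv.ofFinrankEq _ _ (h μ)
  let e : V ≃ₗ[K] W := φ.symm ≪≫ₗ DFinsupp.mapRange.linearEquiv σ ≪≫ₗ ψ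
  have key (μ : K) (x : f.eigenspace μ) : e x = σ μ x := by
    have hx : φ.symm x = DirectSum.lof K K (fun μ ↦ f.eigenspace μ) μ x := by
      rw [LinearEquiv.symm_apply_eq]
      exact (DirectSum.coeLinearMap_lof f.eigenspace μ x).symm
    simp only [e, LinearEquiv.trans_apply, hx]
    rw [DirectSum.lof, DFinsupp.mapRange.linearEquiv_apply, DFinsupp.lsingle_apply,
      DFinsupp.mapRange_single]
    exact DirectSum.coeLinearMap_lof g.eigenspace μ (σ μ x)
  refine ⟨e, fun v ↦ ?_⟩
  have hv : v ∈ ⨆ μ, f.eigenspace μ := hf ▸ Submodule.mem_top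
  induction hv using Submodule.iSup_induction' with
  | mem μ x hx =>
    rw [Module.End.mem_eigenspace_iff.mp hx, map_smul, key μ ⟨x, hx⟩,
      Module.End.mem_eigenspace_iff.mp (σ μ ⟨x, hx⟩).2]
  | zero => simp
  | add x y _ _ hx hy => simp [hx, hy]

/-- Over an algebraically closed field, two matrices annihilated by a squarefree polynomial and
having the same characteristic polynomial are conjugate. -/
theorem Matrix.exists_mul_eq_mul_of_charpoly_eq {K ι : Type*} [Field K] [IsAlgClosed K]
    [Fintype ι] [DecidableEq ι] {A B : Matrix ι ι K} {p : K[X]} (hp : Squarefree p)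
    (hA : aeval A p = 0) (hB : aeval B p = 0) (h : A.charpoly = B.charpoly) :
    ∃ S : Matrix ι ι K, S.det ≠ 0 ∧ S * A = B * S := by
  have hss {C : Matrix ι ι K} (hC : aeval C p = 0) : Module.End.IsSemisimple (Matrix.toLin' C) :=
    Module.End.isSemisimple_of_squarefree_aeval_eq_zero hp <| by
      have := aeval_algHom_apply (Matrix.toLinAlgEquiv' (R := K) (n := ι)).toAlgHom C p
      rw [hC, map_zero] at this
      exact this
  have hfr {C : Matrix ι ι K} (hC : aeval C p = 0) (μ : K) :
      Module.finrank K (Module.End.eigenspace (Matrix.toLin' C) μ) =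
        C.charpoly.rootMultiplicity μ := by
    rw [← (hss hC).isFinitelySemisimple.maxGenEigenspace_eq_eigenspace,
      LinearMap.finrank_maxGenEigenspace_eq, Matrix.charpoly_toLin']
  obtain ⟨e, he⟩ := Module.End.exists_linearEquiv_of_finrank_eigenspace_eq
    (hss hA).iSup_eigenspace_eq_top (hss hB).iSup_eigenspace_eq_top
    fun μ ↦ by rw [hfr hA, hfr hB, h]
  refine ⟨LinearMap.toMatrix' e.toLinearMap, ?_, ?_⟩
  · rw [LinearMap.det_toMatrix']
    exact e.isUnit_det'.ne_zero
  · apply Matrix.toLin'.injective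
    ext1 i
    ext1
    simp [Matrix.toLin'_mul, -Matrix.toLin'_apply, he]

/-- Real matrices that are conjugate over `ℂ` are conjugate over `ℝ`. -/
theorem Matrix.exists_real_mul_eq_mul_of_complex {ι : Type*} [Fintype ι] [DecidableEq ι]
    {A B : Matrix ι ι ℝ} {S : Matrix ι ι ℂ} (hS : S.det ≠ 0)
    (h : S * A.map Complex.ofRealHom = B.map Complex.ofRealHom * S) :
    ∃ T : Matrix ι ι ℝ, T.det ≠ 0 ∧ T * A = B * T := by
  have hre : S.map Complex.re * A = B * S.map Complex.re := by
    ext i j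
    simpa [Matrix.mul_apply] using congrArg Complex.re (congrFun₂ h i j)
  have him : S.map Complex.im * A = B * S.map Complex.im := by
    ext i j
    simpa [Matrix.mul_apply] using congrArg Complex.im (congrFun₂ h i j)
  let Q : Matrix ι ι ℝ[X] := (S.map Complex.re).map C + (X : ℝ[X]) • (S.map Complex.im).map C
  have hQ : Q.det ≠ 0 := by
    intro h0
    apply hS
    have h1 := congrArg (eval₂RingHom Complex.ofRealHom Complex.I) h0
    rw [map_zero, RingHom.map_det] at h1
    rw [← h1]
    congr 1
    ext i j
    simp [Q, Complex.re_add_im]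
  obtain ⟨t, ht⟩ : ∃ t : ℝ, Q.det.eval t ≠ 0 := by
    by_contra! h0
    exact hQ (Polynomial.funext fun t ↦ by simpa using h0 t)
  refine ⟨S.map Complex.re + t • S.map Complex.im, ?_, ?_⟩
  · convert ht
    rw [← coe_evalRingHom, RingHom.map_det]
    congr 1
    ext i j
    simp [Q, mul_comm t]
  · rw [add_mul, mul_add, Matrix.smul_mul, Matrix.mul_smul, hre, him]

/-- Every monic polynomial is the characteristic polynomial of a matrix over the same ring. -/
theorem Polynomial.Monic.exists_matrix_charpoly_eq {R : Type*} [CommRing R] [Nontrivial R]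
    {f : R[X]} (hf : f.Monic) :
    ∃ k, ∃ M : Matrix (Fin k) (Fin k) R, M.charpoly = f := by
  let b := AdjoinRoot.powerBasis' hf
  let M := Algebra.leftMulMatrix b.basis (AdjoinRoot.root f)
  have h0 : aeval (AdjoinRoot.root f) M.charpoly = 0 := by
    apply (injective_iff_map_eq_zero (Algebra.leftMulMatrix b.basis)).mp
      (Algebra.leftMulMatrix_injective b.basis)
    rw [← Polynomial.aeval_algHom_apply]
    exact M.aeval_self_charpoly
  rw [AdjoinRoot.aeval_eq, AdjoinRoot.mk_eq_zero] at h0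
  exact ⟨_, M, Polynomial.eq_of_monic_of_dvd_of_natDegree_le hf M.charpoly_monic h0
    (by simp [M.charpoly_natDegree_eq_dim, b])⟩

/-- A product of cyclotomic polynomials `Φ_d` with `d ∣ N` is the characteristic polynomial of an
integer matrix of order dividing `N`. -/
theorem exists_int_matrix_pow_eq_one_charpoly_eq_prod_cyclotomic {N n : ℕ} (m : ℕ → ℕ)
    (hn : (∏ d ∈ N.divisors, cyclotomic d ℤ ^ m d).natDegree = n) :
    ∃ M : Matrix (Fin n) (Fin n) ℤ, M ^ N = 1 ∧
      M.charpoly = ∏ d ∈ N.divisors, cyclotomic d ℤ ^ m d := by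
  let P (q : ℤ[X]) : Prop :=
    ∃ k, ∃ M : Matrix (Fin k) (Fin k) ℤ, M ^ N = 1 ∧ M.charpoly = q
  have one : P 1 := ⟨0, 1, Subsingleton.elim _ _, by simp [Matrix.charpoly]⟩
  have mul {p q : ℤ[X]} : P p → P q → P (p * q) := by
    rintro ⟨k, A, hA, rfl⟩ ⟨l, B, hB, rfl⟩
    refine ⟨k + l, Matrix.reindexAlgEquiv ℤ ℤ finSumFinEquiv (Matrix.fromBlocks A 0 0 B), ?_, ?_⟩
    · rw [← map_pow, Matrix.fromBlocks_diagonal_pow, hA, hB, Matrix.fromBlocks_one, map_one]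
    · rw [Matrix.coe_reindexAlgEquiv, Matrix.charpoly_reindex,
        Matrix.charpoly_fromBlocks_zero₁₂]
  have cyc {d : ℕ} (hd : d ∈ N.divisors) : P (cyclotomic d ℤ) := by
    obtain ⟨k, M, hM⟩ := (cyclotomic.monic d ℤ).exists_matrix_charpoly_eq
    refine ⟨k, M, ?_, hM⟩
    have hdvd : M.charpoly ∣ X ^ N - 1 := by
      rw [hM, ← prod_cyclotomic_eq_X_pow_sub_one
        (Nat.pos_of_ne_zero (Nat.ne_zero_of_mem_divisors hd))]
      exact Finset.dvd_prod_of_mem _ hd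
    simpa [sub_eq_zero] using aeval_eq_zero_of_dvd_aeval_eq_zero hdvd M.aeval_self_charpoly
  have pow {q : ℤ[X]} (hq : P q) (k : ℕ) : P (q ^ k) := by
    induction k with
    | zero => simpa using one
    | succ k ih => simpa [pow_succ] using mul ih hq
  obtain ⟨k, M, hM, hc⟩ : P (∏ d ∈ N.divisors, cyclotomic d ℤ ^ m d) :=
    Finset.prod_induction _ P (fun _ _ ↦ mul) one fun d hd ↦ pow (cyc hd) (m d)
  obtain rfl : k = n := by
    rw [← hn, ← hc, M.charpoly_natDegree_eq_dim, Fintype.card_fin]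
  exact ⟨M, hM, hc⟩

/-- A monic integer polynomial all of whose complex roots are `N`-th roots of unity is a product
of cyclotomic polynomials `Φ_d` with `d ∣ N`. -/
theorem Polynomial.Monic.eq_prod_cyclotomic_of_roots {N : ℕ} (hN : N ≠ 0) {q : ℤ[X]}
    (hq : q.Monic) (h : ∀ z : ℂ, aeval z q = 0 → z ^ N = 1) :
    ∃ m : ℕ → ℕ, q = ∏ d ∈ N.divisors, cyclotomic d ℤ ^ m d := by
  induction hk : q.natDegree using Nat.strong_induction_on generalizing q with
  | _ k ih =>
  rcases eq_or_ne q.natDegree 0 with h0 | h0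
  · exact ⟨0, by simpa using hq.natDegree_eq_zero.mp h0⟩
  · obtain ⟨z, hz⟩ := IsAlgClosed.exists_aeval_eq_zero ℂ q
      (mt natDegree_eq_of_degree_eq_some h0)
    have hzN := h z hz
    have hd : orderOf z ∈ N.divisors := Nat.mem_divisors.mpr ⟨orderOf_dvd_of_pow_eq_one hzN, hN⟩
    have hpos := Nat.pos_of_mem_divisors hd
    have hprim := IsPrimitiveRoot.orderOf z
    have hdvd : cyclotomic (orderOf z) ℤ ∣ q := by
      rw [cyclotomic_eq_minpoly hprim hpos]
      exact minpoly.isIntegrallyClosed_dvd (hprim.isIntegral hpos) hz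
    obtain ⟨r, rfl⟩ := hdvd
    have hr : r.Monic := (cyclotomic.monic _ ℤ).of_mul_monic_left hq
    have hlt : r.natDegree < k := by
      rw [← hk, (cyclotomic.monic _ ℤ).natDegree_mul hr, natDegree_cyclotomic]
      have := Nat.totient_pos.mpr hpos
      lia
    obtain ⟨m, hm⟩ := ih _ hlt hr (fun w hw ↦ h w (by rw [map_mul, hw, mul_zero])) rfl
    refine ⟨m + Pi.single (orderOf z) 1, ?_⟩
    simp only [Pi.add_apply, pow_add, Finset.prod_mul_distrib, ← hm]
    rw [mul_comm, Finset.prod_eq_single_of_mem _ hd (by simp +contextual)]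
    simp

/-- Let `θ` be a real invertible `n × n` matrix with `θ ^ N = 1` for some
`N ≥ 1`. Then `θ` is conjugate (over `ℝ`) to an integer matrix if and only if its
characteristic polynomial is a product `∏_{d ∣ N} Φ_d(X) ^ m_d` of cyclotomic polynomials. -/
theorem conjugate_to_integer_matrix_iff_charpoly_prod_cyclotomic
    (n N : ℕ) (hN : 1 ≤ N) (θ : Matrix (Fin n) (Fin n) ℝ)
    (hθ : IsUnit θ.det) (hpow : θ ^ N = 1) :
    (∃ S : Matrix (Fin n) (Fin n) ℝ, IsUnit S.det ∧
        ∃ M : Matrix (Fin n) (Fin n) ℤ, S * θ * S⁻¹ = M.map (Int.cast : ℤ → ℝ)) ↔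
      ∃ m : ℕ → ℕ, θ.charpoly = ∏ d ∈ N.divisors, Polynomial.cyclotomic d ℝ ^ m d := by
  have hmap (M : Matrix (Fin n) (Fin n) ℤ) :
      (M.map (Int.cast : ℤ → ℝ)).charpoly = M.charpoly.map (Int.castRingHom ℝ) :=
    M.charpoly_map (Int.castRingHom ℝ)
  have hprod (m : ℕ → ℕ) : (∏ d ∈ N.divisors, cyclotomic d ℤ ^ m d).map (Int.castRingHom ℝ) =
      ∏ d ∈ N.divisors, cyclotomic d ℝ ^ m d := by
    simp [Polynomial.map_prod]
  constructor
  · rintro ⟨S, hS, M, hM⟩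
    have hchar : θ.charpoly = M.charpoly.map (Int.castRingHom ℝ) := by
      rw [← hmap, ← hM, Matrix.charpoly_mul_comm, ← mul_assoc,
        Matrix.nonsing_inv_mul _ hS, one_mul]
    obtain ⟨m, hm⟩ := M.charpoly_monic.eq_prod_cyclotomic_of_roots (Nat.one_le_iff_ne_zero.mp hN)
      fun z hz ↦ by
        have hroot : (θ.map Complex.ofRealHom).charpoly.IsRoot z := by
          rw [Matrix.charpoly_map, hchar, Polynomial.map_map, IsRoot.def, eval_map]
          rwa [aeval_def, RingHom.ext_int (algebraMap ℤ ℂ)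
            (Complex.ofRealHom.comp (Int.castRingHom ℝ))] at hz
        have hmem := spectrum.pow_mem_pow _ N (Matrix.mem_spectrum_of_isRoot_charpoly hroot)
        have hone : (θ.map Complex.ofRealHom) ^ N = 1 := by
          rw [← Matrix.map_pow, hpow]
          simp
        rw [hone, spectrum.mem_iff] at hmem
        by_contra hne
        refine hmem ?_
        rw [← map_one (algebraMap ℂ (Matrix (Fin n) (Fin n) ℂ)), ← map_sub]
        exact (IsUnit.mk0 _ (sub_ne_zero.mpr hne)).map _
    exact ⟨m, by rw [hchar, hm, hprod]⟩
  · rintro ⟨m, hm⟩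
    rw [← hprod] at hm
    obtain ⟨M, hMpow, hM⟩ := exists_int_matrix_pow_eq_one_charpoly_eq_prod_cyclotomic
      (N := N) (n := n) m <| by
        rw [← natDegree_map_eq_of_injective (RingHom.injective_int (Int.castRingHom ℝ)), ← hm,
          θ.charpoly_natDegree_eq_dim, Fintype.card_fin]
    let B : Matrix (Fin n) (Fin n) ℝ := M.map (Int.castRingHom ℝ)
    have hB : B ^ N = 1 := by
      rw [← Matrix.map_pow, hMpow]
      simp
    have hann {A : Matrix (Fin n) (Fin n) ℝ} (hA : A ^ N = 1) :
        aeval (A.map Complex.ofRealHom) (X ^ N - 1 : ℂ[X]) = 0 := by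
      rw [map_sub, map_pow, aeval_X, map_one, ← Matrix.map_pow, hA]
      simp
    have hsq : Squarefree (X ^ N - 1 : ℂ[X]) :=
      (X_pow_sub_one_separable_iff.mpr
        (by exact_mod_cast Nat.one_le_iff_ne_zero.mp hN)).squarefree
    obtain ⟨S, hS, hSB⟩ := Matrix.exists_mul_eq_mul_of_charpoly_eq hsq (hann hpow) (hann hB) <| by
      rw [Matrix.charpoly_map, Matrix.charpoly_map, hm, ← hM]
      exact congrArg _ (hmap M).symm
    obtain ⟨T, hT, hTB⟩ := Matrix.exists_real_mul_eq_mul_of_complex hS hSB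
    refine ⟨T, hT.isUnit, M, ?_⟩
    rw [hTB, mul_assoc, Matrix.mul_nonsing_inv _ hT.isUnit, mul_one]
    rfl
end

section
/- Let G be an n×n integer matrix that is symmetric, has every diagonal entry even, and satisfies |det G| = 1 (an even unimodular Gram matrix). If the real symmetric matrix G has r negative eigenvalues and s positive eigenvalues (counted with multiplicity, so r + s = n), then r ≡ s (mod 8). -/
section ThetaAsymptotics

open Complex Filter Topology Real HurwitzZeta

lemma tendsto_cosKernel_atTop (a : UnitAddCircle) : Tendsto (cosKernel a) atTop (𝓝 1) := by
  obtain ⟨p, hp, h⟩ := isBigO_atTop_cosKernel_sub a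
  have h0 : Tendsto (fun x : ℝ ↦ Real.exp (-p * x)) atTop (𝓝 0) :=
    Real.tendsto_exp_atBot.comp (tendsto_id.const_mul_atTop_of_neg (neg_lt_zero.mpr hp))
  simpa using (h.trans_tendsto h0).add_const 1

/-- Rescaled Gaussian sums over an arithmetic progression of difference `N` converge to `1 / N`. -/
lemma tendsto_sqrt_mul_evenKernel (a : UnitAddCircle) (N : ℕ) [NeZero N] :
    Tendsto (fun u : ℝ ↦ √u * evenKernel a (N ^ 2 * u)) (𝓝[>] 0) (𝓝 (1 / N)) := by
  have hN : (0 : ℝ) < N := by exact_mod_cast NeZero.pos N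
  have hlim : Tendsto (fun u : ℝ ↦ 1 / (N ^ 2 * u)) (𝓝[>] 0) atTop := by
    have := tendsto_inv_nhdsGT_zero (𝕜 := ℝ) |>.const_mul_atTop (r := ((N : ℝ) ^ 2)⁻¹)
      (by positivity)
    refine this.congr fun u ↦ ?_
    rw [one_div, mul_inv]
  have := ((tendsto_cosKernel_atTop a).comp hlim).const_mul (1 / (N : ℝ))
  rw [mul_one] at this
  refine this.congr' ?_
  filter_upwards [self_mem_nhdsWithin] with u (hu : 0 < u)
  have hs : 0 < √u := Real.sqrt_pos.mpr hu
  rw [evenKernel_functional_equation, ← Real.sqrt_eq_rpow, Real.sqrt_mul (by positivity),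
    Real.sqrt_sq hN.le, Function.comp_apply]
  field_simp

/-- A Gaussian-weighted sum of an `N`-periodic function, rescaled, converges to its average. -/
lemma tendsto_sqrt_mul_tsum_periodic (N : ℕ) [NeZero N] (F : ℤ → ℂ)
    (hF : ∀ m r : ℤ, F (m * N + r) = F r)
    (hsum : ∀ u : ℝ, 0 < u → Summable fun n : ℤ ↦ F n * cexp (-π * n ^ 2 * u)) :
    Tendsto (fun u : ℝ ↦ (√u : ℂ) * ∑' n : ℤ, F n * cexp (-π * n ^ 2 * u)) (𝓝[>] 0)
      (𝓝 ((∑ r : Fin N, F (r : ℕ)) / N)) := by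
  have hN : (0 : ℝ) < N := by exact_mod_cast NeZero.pos N
  have key : ∀ u : ℝ, 0 < u → ∑' n : ℤ, F n * cexp (-π * n ^ 2 * u) =
      ∑ r : Fin N, F (r : ℕ) *
        (evenKernel (((r : ℕ) / N : ℝ) : UnitAddCircle) (N ^ 2 * u) : ℝ) := by
    intro u hu
    have h1 := (hsum u hu).hasSum
    rw [← ((Equiv.prodComm _ _).trans (Int.divModEquiv N).symm).hasSum_iff] at h1
    refine (h1.prod_fiberwise (g := fun r : Fin N ↦ F (r : ℕ) *
      (evenKernel (((r : ℕ) / N : ℝ) : UnitAddCircle) (N ^ 2 * u) : ℝ)) fun r ↦ ?_).unique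
      (hasSum_fintype _)
    have h2 := hasSum_int_evenKernel ((r : ℕ) / N : ℝ) (t := N ^ 2 * u) (by positivity)
    rw [← hasSum_ofReal] at h2
    refine (h2.mul_left (F (r : ℕ))).congr_fun fun m ↦ ?_
    simp only [Function.comp_apply, Equiv.trans_apply, Equiv.prodComm_apply, Prod.swap_prod_mk,
      Int.divModEquiv_symm_apply, hF]
    push_cast
    congr 2
    have : (N : ℂ) ≠ 0 := by exact_mod_cast NeZero.ne N
    field_simp
  have hlim : Tendsto (fun u : ℝ ↦ ∑ r : Fin N, F (r : ℕ) *
      ((√u * evenKernel (((r : ℕ) / N : ℝ) : UnitAddCircle) (N ^ 2 * u) : ℝ) : ℂ)) (𝓝[>] 0)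
      (𝓝 (∑ r : Fin N, F (r : ℕ) * ((1 / N : ℝ) : ℂ))) :=
    tendsto_finsetSum _ fun r _ ↦ ((continuous_ofReal.tendsto _).comp
      (tendsto_sqrt_mul_evenKernel _ N)).const_mul _
  rw [← Finset.sum_mul] at hlim
  convert! hlim.congr' ?_ using 2
  · push_cast; ring
  · filter_upwards [self_mem_nhdsWithin] with u hu
    rw [key u hu, Finset.mul_sum]
    refine Finset.sum_congr rfl fun r _ ↦ ?_
    push_cast; ring

lemma tendsto_jacobiTheta_one {ι : Type*} {l : Filter ι} {f : ι → ℂ}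
    (h : Tendsto (fun i ↦ (f i).im) l atTop) : Tendsto (fun i ↦ jacobiTheta (f i)) l (𝓝 1) := by
  have h0 : Tendsto (fun x : ℝ ↦ Real.exp (-π * x)) atTop (𝓝 0) :=
    Real.tendsto_exp_atBot.comp (tendsto_id.const_mul_atTop_of_neg (neg_lt_zero.mpr pi_pos))
  have h1 := isBigO_at_im_infty_jacobiTheta_sub_one.trans_tendsto
    (h0.comp (tendsto_comap (f := im)))
  simpa using (h1.comp (tendsto_comap_iff.mpr h)).add_const 1

lemma jacobiTheta_functional_equation (τ : ℂ) :
    jacobiTheta τ = 1 / (-I * τ) ^ (1 / 2 : ℂ) * jacobiTheta (-1 / τ) := by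
  simp [jacobiTheta_eq_jacobiTheta₂, jacobiTheta₂_functional_equation 0 τ]

lemma jacobiTheta_sub_even (τ : ℂ) (a : ℕ) : jacobiTheta (τ - 2 * a) = jacobiTheta τ := by
  have h : Function.Periodic jacobiTheta 2 := fun τ ↦ by rw [add_comm, jacobiTheta_two_add]
  simpa [mul_comm] using h.sub_nat_mul_eq a (x := τ)

lemma ofReal_mul_cpow_half {u : ℝ} (hu : 0 < u) (z : ℂ) :
    ((u : ℂ) * z) ^ (1 / 2 : ℂ) = (u : ℂ) ^ (1 / 2 : ℂ) * z ^ (1 / 2 : ℂ) := by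
  rcases eq_or_ne z 0 with rfl | hz
  · simp
  have hu' : (u : ℂ) ≠ 0 := by exact_mod_cast hu.ne'
  rw [cpow_def_of_ne_zero (mul_ne_zero hu' hz), cpow_def_of_ne_zero hu', cpow_def_of_ne_zero hz,
    ← Complex.exp_add, log_ofReal_mul hu hz, ← ofReal_log hu.le, add_mul]

/-- Behaviour of the theta function near the cusp `1 / (2 * a)`. -/
lemma tendsto_sqrt_mul_jacobiTheta (a : ℕ) [NeZero a] :
    Tendsto (fun u : ℝ ↦ (√u : ℂ) * jacobiTheta (1 / (2 * a) + I * u)) (𝓝[>] 0)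
      (𝓝 (cexp (π * I / 4) / √(2 * a))) := by
  have ha : (0 : ℝ) < a := by exact_mod_cast NeZero.pos a
  have ha' : (a : ℂ) ≠ 0 := by exact_mod_cast NeZero.ne a
  have hden (u : ℝ) : 1 + 2 * a * I * u ≠ (0 : ℂ) := fun h ↦ by
    simpa using congrArg re h
  have hden' (u : ℝ) : 1 / (2 * a) + I * u ≠ (0 : ℂ) := fun h ↦ hden u <| by
    field_simp at h; linear_combination h
  have key : ∀ u : ℝ, 0 < u → (√u : ℂ) * jacobiTheta (1 / (2 * a) + I * u) =
      1 / (u - I / (2 * a)) ^ (1 / 2 : ℂ) *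
      (1 / ((2 * a) ^ 2 / (1 + 2 * a * I * u)) ^ (1 / 2 : ℂ) *
        jacobiTheta (I * ((1 / ((2 * a) ^ 2 * u) : ℝ) : ℂ) - 1 / (2 * a))) := by
    intro u hu
    have hu' : (u : ℂ) ≠ 0 := by exact_mod_cast hu.ne'
    have hs : (u : ℂ) ^ (1 / 2 : ℂ) = √u := by
      rw [Real.sqrt_eq_rpow, ofReal_cpow hu.le]; norm_num
    have hs0 : (√u : ℂ) ≠ 0 := by exact_mod_cast (Real.sqrt_pos.mpr hu).ne'
    have e0 : 1 / (2 * a) + I * u = (1 + 2 * a * I * u) / (2 * a) := by field_simp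
    have e1 : -1 / (1 / (2 * a) + I * u) =
        I * (u * ((2 * a) ^ 2 / (1 + 2 * a * I * u))) - 2 * (a : ℂ) := by
      have hw := hden u
      rw [e0]
      generalize hw' : 1 + 2 * a * I * u = w at hw
      field_simp
      linear_combination -hw'
    have e2 : -I * (I * (u * ((2 * a) ^ 2 / (1 + 2 * a * I * u)))) =
        (u : ℂ) * ((2 * a) ^ 2 / (1 + 2 * a * I * u)) := by
      linear_combination (-(u : ℂ) * ((2 * a) ^ 2 / (1 + 2 * a * I * u))) * I_sq
    have e3 : -1 / (I * (u * ((2 * a) ^ 2 / (1 + 2 * a * I * u)))) =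
        I * ((1 / ((2 * a) ^ 2 * u) : ℝ) : ℂ) - 1 / (2 * a) := by
      have hw := hden u
      generalize hw' : 1 + 2 * a * I * u = w at hw
      push_cast
      field_simp
      rw [← hw']
      linear_combination (-1 : ℂ) * I_sq
    have e4 : -I * (1 / (2 * a) + I * u) = u - I / (2 * a) := by
      linear_combination (-(u : ℂ)) * I_sq
    rw [jacobiTheta_functional_equation, e1, jacobiTheta_sub_even,
      jacobiTheta_functional_equation (I * _), e2, e3, e4, ofReal_mul_cpow_half hu, hs]
    field_simp
  have l1 : Tendsto (fun u : ℝ ↦ 1 / ((u : ℂ) - I / (2 * a)) ^ (1 / 2 : ℂ)) (𝓝[>] 0)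
      (𝓝 (√(2 * a) * cexp (π * I / 4))) := by
    have hv : (-I / (2 * a) : ℂ) = ((1 / (2 * a) : ℝ) : ℂ) * -I := by push_cast; ring
    have hval : 1 / (-I / (2 * a) : ℂ) ^ (1 / 2 : ℂ) = √(2 * a) * cexp (π * I / 4) := by
      rw [hv, ofReal_mul_cpow_half (by positivity), cpow_def_of_ne_zero (neg_ne_zero.mpr I_ne_zero),
        log_neg_I, one_div, mul_inv, ← Complex.exp_neg, ← ofReal_ofNat, ← ofReal_one, ← ofReal_div,
        ← ofReal_cpow (by positivity), ← Real.sqrt_eq_rpow, Real.sqrt_div (by positivity),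
        Real.sqrt_one]
      push_cast
      rw [one_div, inv_inv]
      congr 2
      ring
    have hslit : (-I / (2 * a) : ℂ) ∈ slitPlane := by
      rw [hv, mem_slitPlane_iff]
      right
      rw [im_ofReal_mul]
      simp [ha.ne']
    rw [← hval]
    have hc : Tendsto (fun u : ℝ ↦ (u : ℂ) - I / (2 * a)) (𝓝[>] 0) (𝓝 (-I / (2 * a))) := by
      refine Tendsto.mono_left ?_ nhdsWithin_le_nhds
      have : Continuous fun u : ℝ ↦ (u : ℂ) - I / (2 * a) := by fun_prop
      convert! this.tendsto 0 using 2
      push_cast; ring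
    refine Tendsto.div tendsto_const_nhds ((continuousAt_cpow_const hslit).tendsto.comp hc) ?_
    rw [Ne, cpow_eq_zero_iff, not_and_or]
    exact .inl (slitPlane_ne_zero hslit)
  have l2 : Tendsto (fun u : ℝ ↦ 1 / (((2 * a) ^ 2 / (1 + 2 * a * I * u) : ℂ)) ^ (1 / 2 : ℂ))
      (𝓝[>] 0) (𝓝 (1 / (2 * a))) := by
    have hval : ((2 * a : ℂ) ^ 2) ^ (1 / 2 : ℂ) = 2 * a := by
      rw [one_div]
      exact sq_cpow_two_inv (by simpa using ha)
    have hslit : ((2 * a : ℂ) ^ 2) ∈ slitPlane := by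
      rw [show (2 * a : ℂ) ^ 2 = (((2 * a) ^ 2 : ℝ) : ℂ) by push_cast; rfl, ofReal_mem_slitPlane]
      positivity
    have hc : Tendsto (fun u : ℝ ↦ ((2 * a) ^ 2 / (1 + 2 * a * I * u) : ℂ)) (𝓝[>] 0)
        (𝓝 ((2 * a) ^ 2)) := by
      refine Tendsto.mono_left ?_ nhdsWithin_le_nhds
      have : Continuous fun u : ℝ ↦ ((2 * a) ^ 2 / (1 + 2 * a * I * u) : ℂ) :=
        Continuous.div (by fun_prop) (by fun_prop) hden
      convert! this.tendsto 0 using 2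
      simp
    have := (continuousAt_cpow_const (b := 1 / 2) hslit).tendsto.comp hc
    rw [hval] at this
    exact Tendsto.div tendsto_const_nhds this (mul_ne_zero two_ne_zero ha')
  have l3 : Tendsto (fun u : ℝ ↦ jacobiTheta (I * ((1 / ((2 * a) ^ 2 * u) : ℝ) : ℂ) - 1 / (2 * a)))
      (𝓝[>] 0) (𝓝 1) := by
    refine tendsto_jacobiTheta_one ?_
    have := tendsto_inv_nhdsGT_zero (𝕜 := ℝ) |>.const_mul_atTop (r := ((2 * a : ℝ) ^ 2)⁻¹)
      (by positivity)
    refine this.congr fun u ↦ ?_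
    have h0 : (1 / (2 * a) : ℂ) = ((1 / (2 * a) : ℝ) : ℂ) := by push_cast; rfl
    rw [h0, sub_im, ofReal_im, I_mul_im, ofReal_re, sub_zero, one_div, mul_inv]
  have := l1.mul (l2.mul l3)
  have hr : (√(2 * a) : ℂ) * √(2 * a) = 2 * a := by
    rw [← ofReal_mul, Real.mul_self_sqrt (by positivity)]; push_cast; rfl
  have hr0 : (√(2 * a) : ℂ) ≠ 0 := by
    rw [ofReal_ne_zero]; positivity
  convert! this.congr' ?_ using 2
  · field_simp
    linear_combination -hr
  · filter_upwards [self_mem_nhdsWithin] with u hu using (key u hu).symm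

/-- The quadratic Gauss sum `∑ exp (π i r² / (2 a))` over a full set of periods. -/
theorem quadratic_gauss_sum (a N : ℕ) [NeZero a] [NeZero N] (h : 2 * a ∣ N) :
    ∑ r : Fin N, cexp (π * I * (r : ℕ) ^ 2 / (2 * a)) = N / √(2 * a) * cexp (π * I / 4) := by
  have ha : (a : ℂ) ≠ 0 := by exact_mod_cast NeZero.ne a
  have hN : (N : ℂ) ≠ 0 := by exact_mod_cast NeZero.ne N
  have hterm (u : ℝ) (n : ℤ) : cexp (π * I * n ^ 2 / (2 * a)) * cexp (-π * n ^ 2 * u) =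
      cexp (π * I * n ^ 2 * (1 / (2 * a) + I * u)) := by
    rw [← Complex.exp_add]
    congr 1
    linear_combination (-(π * n ^ 2 * u : ℂ)) * I_sq
  have him (u : ℝ) : (1 / (2 * a) + I * u : ℂ).im = u := by
    rw [show (1 / (2 * a) : ℂ) = ((1 / (2 * a) : ℝ) : ℂ) by push_cast; rfl, add_im, ofReal_im,
      I_mul_im, ofReal_re, zero_add]
  have h1 := tendsto_sqrt_mul_tsum_periodic N (fun n : ℤ ↦ cexp (π * I * n ^ 2 / (2 * a)))
    (fun m r ↦ by
      obtain ⟨k, rfl⟩ := h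
      rw [Complex.exp_eq_exp_iff_exists_int]
      refine ⟨m * k * r + m ^ 2 * k ^ 2 * a, ?_⟩
      push_cast
      field_simp
      ring)
    (fun u hu ↦ by
      simp_rw [hterm]
      simpa [jacobiTheta₂_term] using
        (hasSum_jacobiTheta₂_term 0 (τ := 1 / (2 * a) + I * u) (by rwa [him])).summable)
  simp_rw [hterm] at h1
  have h2 := tendsto_nhds_unique h1 (tendsto_sqrt_mul_jacobiTheta a)
  rw [div_eq_iff hN] at h2
  push_cast at h2
  rw [h2]
  ring

end ThetaAsymptotics

section EvenForms

open Matrix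

variable {ι : Type*} [Fintype ι]

lemma even_dotProduct_mulVec_of_even_diag {G : Matrix ι ι ℤ} (hsym : Gᵀ = G)
    (heven : ∀ i, Even (G i i)) (x : ι → ℤ) : Even (x ⬝ᵥ G *ᵥ x) := by
  classical
  rw [even_iff_two_dvd, ← Nat.cast_ofNat, ← ZMod.intCast_zmod_eq_zero_iff_dvd]
  simp only [dotProduct, mulVec, Finset.mul_sum]
  rw [← Finset.sum_product']
  push_cast
  refine Finset.sum_involution (fun p _ ↦ p.swap) (fun p _ ↦ ?_) (fun p _ hp hswap ↦ hp ?_)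
    (by simp) (by simp)
  · have hG : G p.2 p.1 = G p.1 p.2 := by rw [← transpose_apply G, hsym]
    rw [Prod.fst_swap, Prod.snd_swap, hG, show ∀ a b c : ZMod 2, a * (b * c) + c * (b * a) =
      2 * (a * b * c) by intros; ring, show (2 : ZMod 2) = 0 from rfl, zero_mul]
  · have h : p.2 = p.1 := congrArg Prod.fst hswap
    rw [h, (ZMod.intCast_zmod_eq_zero_iff_dvd _ 2).mpr (heven p.1).two_dvd, zero_mul, mul_zero]

lemma exists_diagonalization [DecidableEq ι] {G : Matrix ι ι ℤ} (hsym : Gᵀ = G) :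
    ∃ (P : Matrix ι ι ℤ) (δ : ι → ℤ), P.det ≠ 0 ∧ Pᵀ * G * P = diagonal δ := by
  set B : LinearMap.BilinForm ℚ (ι → ℚ) := Matrix.toBilin' (G.map (Int.cast : ℤ → ℚ)) with hB
  have hBapp (x y : ι → ℚ) : B x y = x ⬝ᵥ G.map (Int.cast : ℤ → ℚ) *ᵥ y := by
    rw [hB, Matrix.toBilin'_apply']
  have hBsymm : LinearMap.IsSymm B := by
    refine ⟨fun x y ↦ ?_⟩
    rw [RingHom.id_apply, hBapp, hBapp, dotProduct_mulVec, dotProduct_comm, ← mulVec_transpose,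
      ← transpose_map, hsym]
  let : Invertible (2 : ℚ) := invertibleOfNonzero two_ne_zero
  obtain ⟨v₀, hv₀⟩ := LinearMap.BilinForm.exists_orthogonal_basis hBsymm
  let e : Fin (Module.finrank ℚ (ι → ℚ)) ≃ ι :=
    (finCongr (Module.finrank_fintype_fun_eq_card ℚ)).trans (Fintype.equivFin ι).symm
  let v := v₀.reindex e
  have hv (i j : ι) (hij : i ≠ j) : B (v i) (v j) = 0 := by
    simp only [v, Module.Basis.reindex_apply]
    exact hv₀ (e.symm.injective.ne hij)
  obtain ⟨b, hb⟩ := IsLocalization.exist_integer_multiples_of_finite (nonZeroDivisors ℤ)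
    (fun p : ι × ι ↦ v p.2 p.1)
  choose q hq using hb
  let P : Matrix ι ι ℤ := of fun i j ↦ q (i, j)
  have hP (j : ι) : (fun i ↦ (P i j : ℚ)) = (b : ℤ) • v j := by
    funext i
    exact hq (i, j)
  have hb0 : ((b : ℤ) : ℚ) ≠ 0 := Int.cast_ne_zero.mpr (nonZeroDivisors.coe_ne_zero b)
  refine ⟨P, fun i ↦ (Pᵀ * G * P) i i, fun hdet ↦ ?_, ?_⟩
  · have h1 : ((Pi.basisFun ℚ ι).toMatrix v).det ≠ 0 :=
      ((Pi.basisFun ℚ ι).isUnit_det v).ne_zero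
    have h2 : P.map (Int.cast : ℤ → ℚ) = ((b : ℤ) : ℚ) • (Pi.basisFun ℚ ι).toMatrix v := by
      ext i j
      have := congrFun (hP j) i
      simpa [Module.Basis.toMatrix_apply] using this
    have h3 : (P.map (Int.cast : ℤ → ℚ)).det = 0 := by
      rw [← Int.cast_det, hdet, Int.cast_zero]
    rw [h2, det_smul] at h3
    exact mul_ne_zero (pow_ne_zero _ hb0) h1 h3
  · ext i j
    rcases eq_or_ne i j with rfl | hij
    · simp
    rw [diagonal_apply_ne _ hij]
    have : ((Pᵀ * G * P) i j : ℚ) = B ((b : ℤ) • v i) ((b : ℤ) • v j) := by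
      rw [← hP, ← hP, hBapp, dotProduct_mulVec]
      simp [Matrix.mul_apply, dotProduct, vecMul, Matrix.transpose_apply]
    rw [map_zsmul, map_zsmul, LinearMap.smul_apply, hv i j hij, smul_zero, smul_zero] at this
    exact_mod_cast this

end EvenForms

section Inertia

open Matrix QuadraticMap

variable {ι : Type*} [Fintype ι] [DecidableEq ι]

/-- A congruence of a real matrix with a diagonal one is an equivalence of quadratic forms. -/
lemma equivalent_weightedSumSquares_of_congruent {G A : Matrix ι ι ℝ} {w : ι → ℝ}
    (hA : A.det ≠ 0) (h : Aᵀ * G * A = diagonal w) :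
    (G.toQuadraticForm').Equivalent (weightedSumSquares ℝ w) := by
  let := A.invertibleOfIsUnitDet hA.isUnit
  refine Equivalent.symm ⟨⟨A.toLinearEquiv' this, fun x ↦ ?_⟩⟩
  have hx : A.toLinearEquiv' this x = A *ᵥ x := by
    rw [← LinearEquiv.coe_coe, toLinearEquiv'_apply, toLin'_apply]
  have hG : G.toQuadraticForm' (A *ᵥ x) = (A *ᵥ x) ⬝ᵥ G *ᵥ (A *ᵥ x) := by
    simp [toQuadraticForm', LinearMap.BilinMap.toQuadraticMap_apply, toLinearMap₂'_apply']
  change G.toQuadraticForm' (A.toLinearEquiv' this x) = _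
  rw [hx, hG, ← vecMul_transpose A x, ← dotProduct_mulVec, vecMul_transpose, mulVec_mulVec,
    mulVec_mulVec, h, weightedSumSquares_apply]
  simp only [dotProduct, mulVec_diagonal, smul_eq_mul]
  exact Finset.sum_congr rfl fun i _ ↦ by ring

lemma ncard_eigenvalues_eq_ncard_weights {G A : Matrix ι ι ℝ} (hG : G.IsHermitian) {w : ι → ℝ}
    (hA : A.det ≠ 0) (h : Aᵀ * G * A = diagonal w) :
    {i | 0 < hG.eigenvalues i}.ncard = {i | 0 < w i}.ncard ∧
    {i | hG.eigenvalues i < 0}.ncard = {i | w i < 0}.ncard := by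
  have h1 := equivalent_weightedSumSquares_of_congruent hA h
  have h2 : (G.toQuadraticForm').Equivalent (weightedSumSquares ℝ hG.eigenvalues) := by
    refine equivalent_weightedSumSquares_of_congruent (A := hG.eigenvectorUnitary) ?_ ?_
    · exact (UnitaryGroup.det_isUnit hG.eigenvectorUnitary).ne_zero
    · simpa [star_eq_conjTranspose, conjTranspose_eq_transpose_of_trivial] using
        hG.conjStarAlgAut_star_eigenvectorUnitary
  rw [← QuadraticForm.sigPos_of_equiv_weightedSumSquares h1,
    ← QuadraticForm.sigPos_of_equiv_weightedSumSquares h2,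
    ← QuadraticForm.sigNeg_of_equiv_weightedSumSquares h1,
    ← QuadraticForm.sigNeg_of_equiv_weightedSumSquares h2]
  exact ⟨rfl, rfl⟩

end Inertia

section GaussSums

open Complex Real

lemma sum_zmod_eq_sum_fin {N : ℕ} [NeZero N] (f : ZMod N → ℂ) :
    ∑ y, f y = ∑ r : Fin N, f ((r : ℕ) : ZMod N) := by
  refine (Fintype.sum_equiv (ZMod.finEquiv N).toEquiv _ _ fun r ↦ ?_).symm
  obtain ⟨k, rfl⟩ := Nat.exists_eq_succ_of_ne_zero (NeZero.ne N)
  exact congrArg f (Fin.cast_val_eq_self r)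

/-- The phase of a one-dimensional quadratic Gauss sum is `exp (π i sign δ / 4)`. -/
lemma exists_pos_sum_stdAddChar_sq {N : ℕ} [NeZero N] {c δ : ℤ} (hδ : Even δ)
    (hN : (N : ℤ) = 2 * (c * δ)) :
    ∃ ρ : ℝ, 0 < ρ ∧ ∑ y : ZMod N, ZMod.stdAddChar ((c : ZMod N) * y ^ 2) =
      ρ * cexp (π * I * (δ.sign : ℤ) / 4) := by
  have hN0 : (N : ℤ) ≠ 0 := by exact_mod_cast NeZero.ne N
  have hδ0 : δ ≠ 0 := by rintro rfl; simp at hN; omega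
  have hc0 : c ≠ 0 := by rintro rfl; simp at hN; omega
  have hNpos : (0 : ℝ) < N := by exact_mod_cast NeZero.pos N
  have hsum : ∑ y : ZMod N, ZMod.stdAddChar ((c : ZMod N) * y ^ 2) =
      ∑ r : Fin N, cexp (π * I * (r : ℕ) ^ 2 / δ) := by
    rw [sum_zmod_eq_sum_fin]
    refine Finset.sum_congr rfl fun r _ ↦ ?_
    have := ZMod.stdAddChar_coe (N := N) (c * (r : ℕ) ^ 2)
    push_cast at this
    rw [this, show (N : ℂ) = 2 * (c * δ) by exact_mod_cast congrArg (Int.cast : ℤ → ℂ) hN]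
    have : (c : ℂ) ≠ 0 := by exact_mod_cast hc0
    have : (δ : ℂ) ≠ 0 := by exact_mod_cast hδ0
    congr 1
    field_simp
  obtain ⟨b, hb⟩ := hδ
  obtain ⟨a, ha⟩ := Int.eq_nat_or_neg b
  have ha0 : a ≠ 0 := by rintro rfl; omega
  have : NeZero a := ⟨ha0⟩
  have hapos : (0 : ℝ) < a := by exact_mod_cast NeZero.pos a
  have hdvd : 2 * a ∣ N := by
    zify
    rcases ha with rfl | rfl
    · exact ⟨2 * c, by rw [hN, hb]; ring⟩
    · exact ⟨-(2 * c), by rw [hN, hb]; ring⟩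
  have hgauss := quadratic_gauss_sum a N hdvd
  refine ⟨N / √(2 * a), by positivity, ?_⟩
  rw [hsum]
  rcases ha with rfl | rfl
  · rw [Int.sign_eq_one_of_pos (by omega)]
    convert hgauss using 2
    · subst hb; push_cast; congr 2; ring
    · push_cast; rfl
    · simp
  · rw [Int.sign_eq_neg_one_of_neg (by omega)]
    have := congrArg (starRingEnd ℂ) hgauss
    rw [map_sum, map_mul] at this
    simp_rw [← Complex.exp_conj] at this
    convert this using 2
    · subst hb; congr 1; simp [conj_ofNat]; ring
    · simp
    · congr 1; simp [conj_ofNat]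

end GaussSums

section ProductGaussSum

open Complex Real Matrix

lemma addChar_map_sum {A M ι : Type*} [AddCommMonoid A] [CommMonoid M] (ψ : AddChar A M)
    (s : Finset ι) (f : ι → A) : ψ (∑ i ∈ s, f i) = ∏ i ∈ s, ψ (f i) := by
  classical
  induction s using Finset.induction_on with
  | empty => simp
  | insert a s ha ih => rw [Finset.sum_insert ha, Finset.prod_insert ha, AddChar.map_add_eq_mul, ih]

/-- The Gauss sum of the discriminant form of the sublattice spanned by the columns of `P`. -/
lemma exists_nonneg_sum_stdAddChar {ι : Type*} [Fintype ι] [DecidableEq ι]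
    {G P : Matrix ι ι ℤ} {δ c : ι → ℤ} {K : ℕ} [NeZero (2 * K)]
    (heven : ∀ x : ι → ℤ, Even (x ⬝ᵥ G *ᵥ x)) (hdet : IsUnit G.det)
    (hP : Pᵀ * G * P = diagonal δ) (hP0 : P.det ≠ 0) (hc : ∀ i, c i * δ i = K) :
    ∃ t : ℝ, 0 ≤ t ∧
      ∑ y : ι → ZMod (2 * K), ZMod.stdAddChar (∑ i, (c i : ZMod (2 * K)) * y i ^ 2) = (t : ℂ) := by
  classical
  set ψ : AddChar (ZMod (2 * K)) ℂ := ZMod.stdAddChar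
  set φ : ℤ →+* ZMod (2 * K) := Int.castRingHom _
  set W : Matrix ι ι ℤ := diagonal c * Pᵀ * G with hW
  have hK : (K : ℤ) ≠ 0 := by
    have := NeZero.ne (2 * K)
    omega
  have hWP : W * P = (K : ℤ) • (1 : Matrix ι ι ℤ) := by
    rw [hW, Matrix.mul_assoc (diagonal c), Matrix.mul_assoc (diagonal c), hP, diagonal_mul_diagonal,
      smul_one_eq_diagonal]
    simp_rw [hc]
  have hPW : P * W = (K : ℤ) • (1 : Matrix ι ι ℤ) := by
    have h1 : P * W * P * P.adjugate = (K : ℤ) • P * P.adjugate := by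
      rw [Matrix.mul_assoc P, hWP, Matrix.mul_smul, Matrix.mul_one]
    rw [Matrix.mul_assoc (P * W), Matrix.smul_mul, mul_adjugate, Matrix.mul_smul, Matrix.mul_one,
      smul_comm] at h1
    exact smul_right_injective _ hP0 h1
  set q : (ι → ZMod (2 * K)) → ZMod (2 * K) := fun y ↦ ∑ i, (c i : ZMod (2 * K)) * y i ^ 2 with hq
  have hlift (x : ι → ZMod (2 * K)) : ∃ X : ι → ℤ, x = fun i ↦ (X i : ZMod (2 * K)) :=
    ⟨fun i ↦ (ZMod.intCast_surjective (x i)).choose,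
      funext fun i ↦ (ZMod.intCast_surjective (x i)).choose_spec.symm⟩
  have hqint (Y : ι → ℤ) : q (fun i ↦ (Y i : ZMod (2 * K))) =
      ((Y ⬝ᵥ diagonal c *ᵥ Y : ℤ) : ZMod (2 * K)) := by
    simp only [hq, dotProduct, mulVec_diagonal]
    push_cast
    exact Finset.sum_congr rfl fun i _ ↦ by ring
  have hzero (x : ι → ℤ) : (((K : ℤ) * (x ⬝ᵥ G *ᵥ x) : ℤ) : ZMod (2 * K)) = 0 := by
    rw [ZMod.intCast_zmod_eq_zero_iff_dvd]
    obtain ⟨b, hb⟩ := (heven x).two_dvd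
    exact ⟨b, by rw [hb]; push_cast; ring⟩
  have hshift (y x : ι → ZMod (2 * K)) : q (y + (Pᵀ * G).map φ *ᵥ x) =
      q y + ∑ j, x j * (2 * (y ᵥ* W.map φ) j) := by
    obtain ⟨Y, rfl⟩ := hlift y
    obtain ⟨X, rfl⟩ := hlift x
    have h1 : (fun i ↦ (Y i : ZMod (2 * K))) + (Pᵀ * G).map φ *ᵥ (fun i ↦ (X i : ZMod (2 * K))) =
        fun i ↦ (((Y + (Pᵀ * G) *ᵥ X) i : ℤ) : ZMod (2 * K)) := by
      funext i
      have := RingHom.map_mulVec φ (Pᵀ * G) X i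
      rw [Pi.add_apply, Pi.add_apply, Int.cast_add]
      exact congrArg _ this.symm
    have h2 : ∑ j, (X j : ZMod (2 * K)) *
        (2 * ((fun i ↦ (Y i : ZMod (2 * K))) ᵥ* W.map φ) j) =
        ((2 * (Y ⬝ᵥ W *ᵥ X) : ℤ) : ZMod (2 * K)) := by
      rw [dotProduct_mulVec]
      simp only [dotProduct]
      push_cast
      rw [Finset.mul_sum]
      refine Finset.sum_congr rfl fun j _ ↦ ?_
      have := RingHom.map_vecMul φ W Y j
      rw [show (((Y ᵥ* W) j : ℤ) : ZMod (2 * K)) = _ from this]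
      change _ = 2 * (((fun i ↦ (Y i : ZMod (2 * K))) ᵥ* W.map φ) j * _)
      ring
    have hCW : diagonal c *ᵥ (Pᵀ * G) *ᵥ X = W *ᵥ X := by
      rw [mulVec_mulVec, ← Matrix.mul_assoc]
    have h3 : (Y + (Pᵀ * G) *ᵥ X) ⬝ᵥ diagonal c *ᵥ (Y + (Pᵀ * G) *ᵥ X) =
        Y ⬝ᵥ diagonal c *ᵥ Y + 2 * (Y ⬝ᵥ W *ᵥ X) + K * (X ⬝ᵥ G *ᵥ X) := by
      have h4 : (Pᵀ * G) *ᵥ X ⬝ᵥ diagonal c *ᵥ Y = Y ⬝ᵥ W *ᵥ X := by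
        rw [dotProduct_comm, ← hCW, dotProduct_mulVec Y, ← mulVec_transpose, diagonal_transpose]
      have h5 : (Pᵀ * G) *ᵥ X ⬝ᵥ W *ᵥ X = K * (X ⬝ᵥ G *ᵥ X) := by
        rw [← mulVec_mulVec, mulVec_transpose, ← dotProduct_mulVec, mulVec_mulVec, hPW,
          smul_mulVec, one_mulVec, dotProduct_smul, dotProduct_comm, smul_eq_mul]
      rw [mulVec_add, hCW, dotProduct_add, add_dotProduct, add_dotProduct, h4, h5]
      ring
    rw [h1, h2, hqint, hqint, h3, Int.cast_add, hzero, add_zero, Int.cast_add]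
  have hvanish (y : ι → ZMod (2 * K)) (hy : ∀ j, 2 * (y ᵥ* W.map φ) j = 0) : q y = 0 := by
    obtain ⟨Y, rfl⟩ := hlift y
    have hdvd (j : ι) : (K : ℤ) ∣ (Y ᵥ* W) j := by
      have h1 : ((2 * (Y ᵥ* W) j : ℤ) : ZMod (2 * K)) = 0 := by
        rw [← hy j]
        have := RingHom.map_vecMul φ W Y j
        push_cast
        exact congrArg _ this
      rw [ZMod.intCast_zmod_eq_zero_iff_dvd] at h1
      push_cast at h1
      exact (mul_dvd_mul_iff_left two_ne_zero).mp h1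
    choose Z hZ using hdvd
    have hZ' : Y ᵥ* W = (K : ℤ) • Z := funext fun j ↦ by rw [hZ, Pi.smul_apply, smul_eq_mul]
    have hY : Y = Z ᵥ* P := by
      have h1 : (K : ℤ) • Y = (K : ℤ) • (Z ᵥ* P) := by
        rw [← smul_vecMul, ← hZ', vecMul_vecMul, hWP, vecMul_smul, vecMul_one]
      exact smul_right_injective _ hK h1
    have hX : Z = G *ᵥ (G⁻¹ *ᵥ Z) := by
      rw [mulVec_mulVec, Matrix.mul_nonsing_inv _ hdet, one_mulVec]
    set X := G⁻¹ *ᵥ Z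
    have hCY : diagonal c *ᵥ Y = W *ᵥ X := by
      rw [hY, hX, ← mulVec_transpose, mulVec_mulVec, mulVec_mulVec, hW]
    rw [hqint, hCY, dotProduct_mulVec, hZ', smul_dotProduct, dotProduct_comm, hX, smul_eq_mul,
      hzero]
  have hsum (x : ι → ZMod (2 * K)) : ∑ y, ψ (q y) =
      ∑ y, ψ (q y) * ∏ j, ψ (x j * (2 * (y ᵥ* W.map φ) j)) := by
    rw [← Equiv.sum_comp (Equiv.addRight ((Pᵀ * G).map φ *ᵥ x))]
    refine Finset.sum_congr rfl fun y _ ↦ ?_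
    rw [Equiv.coe_addRight, hshift, AddChar.map_add_eq_mul,
      addChar_map_sum ψ _ fun j ↦ x j * (2 * (y ᵥ* W.map φ) j)]
  have hcard : (Fintype.card (ι → ZMod (2 * K)) : ℂ) * ∑ y, ψ (q y) =
      ∑ y : ι → ZMod (2 * K), ∏ j : ι, if 2 * (y ᵥ* W.map φ) j = 0 then
        (Fintype.card (ZMod (2 * K)) : ℂ) else 0 := by
    rw [← nsmul_eq_mul, ← Finset.card_univ, ← Finset.sum_const,
      Finset.sum_congr rfl fun x _ ↦ hsum x, Finset.sum_comm]
    refine Finset.sum_congr rfl fun y _ ↦ ?_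
    rw [← Finset.mul_sum, ← Fintype.piFinset_univ, ← Finset.prod_univ_sum (fun _ ↦ Finset.univ)
      (fun j z ↦ ψ (z * (2 * (y ᵥ* W.map φ) j)))]
    simp_rw [ψ, AddChar.sum_mulShift _ (ZMod.isPrimitive_stdAddChar (2 * K))]
    by_cases hy : ∀ j, 2 * (y ᵥ* W.map φ) j = 0
    · simp [hvanish y hy, hy]
    · push Not at hy
      obtain ⟨j, hj⟩ := hy
      rw [Finset.prod_eq_zero (Finset.mem_univ j) (by simp [hj]), mul_zero,
        Finset.prod_eq_zero (Finset.mem_univ j) (by simp [hj])]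
  refine ⟨(∑ y : ι → ZMod (2 * K), ∏ j : ι, if 2 * (y ᵥ* W.map φ) j = 0 then
    (Fintype.card (ZMod (2 * K)) : ℝ) else 0) / Fintype.card (ι → ZMod (2 * K)), ?_, ?_⟩
  · refine div_nonneg (Finset.sum_nonneg fun y _ ↦ Finset.prod_nonneg fun j _ ↦ ?_) (by positivity)
    split_ifs <;> positivity
  · rw [ofReal_div, eq_div_iff (by exact_mod_cast Fintype.card_ne_zero), mul_comm, ofReal_natCast,
      hcard]
    push_cast [apply_ite]
    rfl

lemma eight_dvd_of_exp_eq_nonneg {σ : ℤ} {ρ t : ℝ} (hρ : 0 < ρ) (ht : 0 ≤ t)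
    (h : ρ * cexp (π * I * σ / 4) = t) : (8 : ℤ) ∣ σ := by
  have hnorm := congrArg norm h
  rw [norm_mul, norm_real, norm_real, show (π * I * σ / 4 : ℂ) = ((π * σ / 4 : ℝ) : ℂ) * I by
    push_cast; ring, norm_exp_ofReal_mul_I, mul_one, Real.norm_of_nonneg hρ.le,
    Real.norm_of_nonneg ht] at hnorm
  rw [← hnorm, mul_eq_left₀ (by exact_mod_cast hρ.ne'), Complex.exp_eq_one_iff] at h
  obtain ⟨k, hk⟩ := h
  refine ⟨k, ?_⟩
  have : (π : ℂ) ≠ 0 := by exact_mod_cast pi_ne_zero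
  have h2 : (σ : ℂ) = 8 * k := by
    have := I_ne_zero
    field_simp at hk
    linear_combination hk
  exact_mod_cast h2

end ProductGaussSum

section Signature

open Complex Real Matrix

variable {ι : Type*} [Fintype ι]

/-- The signature of a diagonalization of an even unimodular form is divisible by eight. -/
lemma eight_dvd_sum_sign [DecidableEq ι] {G P : Matrix ι ι ℤ} {δ : ι → ℤ}
    (hsym : Gᵀ = G) (heven : ∀ i, Even (G i i)) (hdet : IsUnit G.det) (hP0 : P.det ≠ 0)
    (hP : Pᵀ * G * P = diagonal δ) : (8 : ℤ) ∣ ∑ i, (δ i).sign := by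
  have hG := even_dotProduct_mulVec_of_even_diag hsym heven
  have hδ (i : ι) : Even (δ i) := by
    have h1 : (Pᵀ * G * P) i i = P.col i ⬝ᵥ G *ᵥ P.col i := by
      rw [Matrix.mul_assoc]
      rfl
    rw [← diagonal_apply_eq δ i, ← hP, h1]
    exact hG _
  have hδ0 (i : ι) : δ i ≠ 0 := by
    have h1 : ∏ i, δ i ≠ 0 := by
      rw [← det_diagonal, ← hP, det_mul, det_mul, det_transpose]
      exact mul_ne_zero (mul_ne_zero hP0 hdet.ne_zero) hP0
    exact Finset.prod_ne_zero_iff.mp h1 i (Finset.mem_univ i)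
  set K : ℕ := ∏ i, (δ i).natAbs with hK
  have : NeZero (2 * K) :=
    ⟨mul_ne_zero two_ne_zero (Finset.prod_ne_zero_iff.mpr fun i _ ↦ Int.natAbs_ne_zero.mpr (hδ0 i))⟩
  have hdvd (i : ι) : ∃ c, c * δ i = K := by
    obtain ⟨c, hc⟩ := Int.natAbs_dvd.mp
      (Int.natCast_dvd_natCast.mpr (Finset.dvd_prod_of_mem (fun i ↦ (δ i).natAbs)
        (Finset.mem_univ i)))
    exact ⟨c, by rw [hK, hc, mul_comm]⟩
  choose c hc using hdvd
  obtain ⟨t, ht, hsum⟩ := exists_nonneg_sum_stdAddChar hG hdet hP hP0 hc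
  choose ρ hρ hρsum using fun i ↦ exists_pos_sum_stdAddChar_sq (N := 2 * K) (c := c i) (hδ i)
    (by rw [hc i]; push_cast; rfl)
  refine eight_dvd_of_exp_eq_nonneg (Finset.prod_pos fun i _ ↦ hρ i : 0 < ∏ i, ρ i) ht ?_
  rw [← hsum]
  simp_rw [addChar_map_sum]
  rw [← Fintype.piFinset_univ, ← Finset.prod_univ_sum (fun _ ↦ Finset.univ)
    fun i z ↦ ZMod.stdAddChar ((c i : ZMod (2 * K)) * z ^ 2)]
  simp_rw [hρsum]
  rw [Finset.prod_mul_distrib, ← Complex.exp_sum, ← Finset.sum_div, ← Finset.mul_sum]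
  push_cast
  rfl

lemma sum_sign_eq_card_sub_card (δ : ι → ℤ) :
    ∑ i, (δ i).sign = ({i | 0 < δ i}.ncard : ℤ) - {i | δ i < 0}.ncard := by
  classical
  rw [Set.ncard_eq_toFinset_card', Set.ncard_eq_toFinset_card']
  simp only [Set.toFinset_ofPred, Finset.card_filter, Nat.cast_sum, ← Finset.sum_sub_distrib]
  refine Finset.sum_congr rfl fun i _ ↦ ?_
  rcases lt_trichotomy (δ i) 0 with h | h | h
  · simp [Int.sign_eq_neg_one_of_neg h, h, h.not_gt]
  · simp [h]
  · simp [Int.sign_eq_one_of_pos h, h, h.not_gt]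

end Signature

/-- If `G` is an even unimodular integer Gram matrix (symmetric, even
diagonal, `|det G| = 1`) with `r` negative and `s` positive eigenvalues (as a real
symmetric matrix, counted with multiplicity), then `r ≡ s (mod 8)`. -/
theorem even_unimodular_signature_mod_eight
    (n : ℕ) (G : Matrix (Fin n) (Fin n) ℤ)
    (hsym : G.transpose = G) (heven : ∀ i, Even (G i i)) (hdet : |G.det| = 1)
    (hH : (G.map (Int.cast : ℤ → ℝ)).IsHermitian) (r s : ℕ)
    (hr : r = (Finset.univ.filter fun i => hH.eigenvalues i < 0).card)
    (hs : s = (Finset.univ.filter fun i => 0 < hH.eigenvalues i).card) :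
    r % 8 = s % 8 := by
  obtain ⟨P, δ, hP0, hP⟩ := exists_diagonalization hsym
  have h8 := eight_dvd_sum_sign hsym heven (Int.isUnit_iff_abs_eq.mpr hdet) hP0 hP
  rw [sum_sign_eq_card_sub_card] at h8
  have hA : (P.map (Int.cast : ℤ → ℝ)).det ≠ 0 := by
    rw [← Int.cast_det]
    exact Int.cast_ne_zero.mpr hP0
  have hdiag : (P.map (Int.cast : ℤ → ℝ)).transpose * G.map (Int.cast : ℤ → ℝ) *
      P.map (Int.cast : ℤ → ℝ) = Matrix.diagonal fun i ↦ (δ i : ℝ) := by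
    have h := congrArg (fun M ↦ M.map (Int.castRingHom ℝ)) hP
    simp only [Matrix.map_mul, Matrix.diagonal_map (map_zero _)] at h
    exact h
  obtain ⟨hpos, hneg⟩ := ncard_eigenvalues_eq_ncard_weights hH hA hdiag
  simp only [Int.cast_pos, Int.cast_lt_zero] at hpos hneg
  rw [← hpos, ← hneg, Set.ncard_eq_toFinset_card', Set.ncard_eq_toFinset_card',
    Set.toFinset_ofPred, Set.toFinset_ofPred, ← hr, ← hs] at h8
  omega
end

section
/- Let G₁ and G₂ be n×n integer matrices, each symmetric with every diagonal entry even and |det Gᵢ| = 1 (even unimodular Gram matrices), and suppose both have the same signature (r, s) with r ≥ 1 and s ≥ 1 (indefinite). Then G₁ and G₂ are integrally congruent: there exists P ∈ GL(n,ℤ) with Pᵀ G₁ P = G₂. -/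
/-- Two square matrices are congruent if `Pᵀ * A * P = B` for an invertible `P`; the index types
may differ. -/
def Matrix.IsCongr {R ι κ : Type*} [CommRing R] [Fintype ι] [Fintype κ] [DecidableEq ι]
    [DecidableEq κ] (A : Matrix ι ι R) (B : Matrix κ κ R) : Prop :=
  ∃ (P : Matrix ι κ R) (Q : Matrix κ ι R), P * Q = 1 ∧ Q * P = 1 ∧ P.transpose * A * P = B

namespace Matrix.IsCongr

variable {R S ι κ μ ν : Type*} [CommRing R] [CommRing S] [Fintype ι] [Fintype κ] [Fintype μ]
  [Fintype ν] [DecidableEq ι] [DecidableEq κ] [DecidableEq μ] [DecidableEq ν]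

theorem refl (A : Matrix ι ι R) : A.IsCongr A := ⟨1, 1, by simp, by simp, by simp⟩

theorem symm {A : Matrix ι ι R} {B : Matrix κ κ R} (h : A.IsCongr B) : B.IsCongr A := by
  obtain ⟨P, Q, hPQ, hQP, rfl⟩ := h
  refine ⟨Q, P, hQP, hPQ, ?_⟩
  have h' : Q.transpose * P.transpose = 1 := by rw [← transpose_mul, hPQ, transpose_one]
  calc Q.transpose * (P.transpose * A * P) * Q
      = (Q.transpose * P.transpose) * A * (P * Q) := by simp only [Matrix.mul_assoc]
    _ = A := by rw [h', hPQ, Matrix.one_mul, Matrix.mul_one]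

theorem trans {A : Matrix ι ι R} {B : Matrix κ κ R} {C : Matrix μ μ R}
    (h : A.IsCongr B) (h' : B.IsCongr C) : A.IsCongr C := by
  obtain ⟨P, Q, hPQ, hQP, rfl⟩ := h
  obtain ⟨P', Q', hPQ', hQP', rfl⟩ := h'
  refine ⟨P * P', Q' * Q, ?_, ?_, ?_⟩
  · rw [Matrix.mul_assoc, ← Matrix.mul_assoc P', hPQ', Matrix.one_mul, hPQ]
  · rw [Matrix.mul_assoc, ← Matrix.mul_assoc Q, hQP, Matrix.one_mul, hQP']
  · simp only [transpose_mul, Matrix.mul_assoc]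

theorem fromBlocks {A : Matrix ι ι R} {B : Matrix κ κ R} {C : Matrix μ μ R} {D : Matrix ν ν R}
    (h : A.IsCongr B) (h' : C.IsCongr D) :
    (Matrix.fromBlocks A 0 0 C).IsCongr (Matrix.fromBlocks B 0 0 D) := by
  obtain ⟨P, Q, hPQ, hQP, rfl⟩ := h
  obtain ⟨P', Q', hPQ', hQP', rfl⟩ := h'
  refine ⟨Matrix.fromBlocks P 0 0 P', Matrix.fromBlocks Q 0 0 Q', ?_, ?_, ?_⟩ <;>
  simp [fromBlocks_multiply, fromBlocks_transpose, hPQ, hQP, hPQ', hQP']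

theorem map {A : Matrix ι ι R} {B : Matrix κ κ R} (h : A.IsCongr B) (f : R →+* S) :
    (A.map f).IsCongr (B.map f) := by
  obtain ⟨P, Q, hPQ, hQP, rfl⟩ := h
  refine ⟨P.map f, Q.map f, ?_, ?_, ?_⟩
  · rw [← Matrix.map_mul, hPQ, Matrix.map_one _ (map_zero f) (map_one f)]
  · rw [← Matrix.map_mul, hQP, Matrix.map_one _ (map_zero f) (map_one f)]
  · rw [Matrix.map_mul, Matrix.map_mul, transpose_map]

theorem smul {A : Matrix ι ι R} {B : Matrix κ κ R} (h : A.IsCongr B) (c : R) :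
    (c • A).IsCongr (c • B) := by
  obtain ⟨P, Q, hPQ, hQP, rfl⟩ := h
  exact ⟨P, Q, hPQ, hQP, by simp⟩

theorem of_isUnit_det {A B P : Matrix ι ι R} (hP : IsUnit P.det)
    (h : P.transpose * A * P = B) : A.IsCongr B :=
  ⟨P, P⁻¹, mul_nonsing_inv P hP, nonsing_inv_mul P hP, h⟩

theorem submatrix (A : Matrix ι ι R) (e : κ ≃ ι) : A.IsCongr (A.submatrix e e) := by
  refine ⟨(1 : Matrix ι ι R).submatrix id e, (1 : Matrix ι ι R).submatrix e id, ?_, ?_, ?_⟩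
  · rw [submatrix_mul_equiv]; simp
  · rw [← submatrix_mul _ _ _ _ _ Function.bijective_id]; simp
  · rw [transpose_submatrix, transpose_one,
      ← submatrix_id_id A, submatrix_mul _ _ _ _ _ Function.bijective_id |>.symm,
      submatrix_mul _ _ _ _ _ Function.bijective_id |>.symm]
    simp

end Matrix.IsCongr

theorem Fintype.exists_equiv_comp_eq {ι κ α : Type*} [Fintype ι] [Fintype κ]
    {a : ι → α} {b : κ → α} (h : Finset.univ.val.map a = Finset.univ.val.map b) :
    ∃ e : κ ≃ ι, a ∘ e = b := by
  classical
  have key : ∀ x, Nonempty ({i // b i = x} ≃ {i // a i = x}) := fun x => by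
    rw [← Fintype.card_eq, Fintype.card_subtype, Fintype.card_subtype]
    have := congrArg (Multiset.count x) h
    rw [Multiset.count_map, Multiset.count_map] at this
    simpa [Finset.card, eq_comm] using this.symm
  exact ⟨Equiv.ofFiberEquiv fun x => (key x).some,
    by ext i; exact Equiv.ofFiberEquiv_map (fun x => (key x).some) i⟩

theorem Matrix.IsCongr.diagonal {R ι κ : Type*} [CommRing R] [Fintype ι] [Fintype κ]
    [DecidableEq ι] [DecidableEq κ] {a : ι → R} {b : κ → R}
    (h : Finset.univ.val.map a = Finset.univ.val.map b) :
    (Matrix.diagonal a).IsCongr (Matrix.diagonal b) := by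
  obtain ⟨e, rfl⟩ := Fintype.exists_equiv_comp_eq h
  simpa [Matrix.submatrix_diagonal_equiv] using Matrix.IsCongr.submatrix (Matrix.diagonal a) e

/-- The diagonal matrix whose diagonal entries are the nonzero elements of `s`. -/
noncomputable def Multiset.diagMatrix (s : Multiset ℚ) :
    Matrix (Fin (s.filter (· ≠ 0)).toList.length) (Fin (s.filter (· ≠ 0)).toList.length) ℚ :=
  Matrix.diagonal (s.filter (· ≠ 0)).toList.get

theorem Multiset.map_toList_get {α : Type*} (s : Multiset α) :
    Finset.univ.val.map s.toList.get = s := by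
  conv_rhs => rw [← s.coe_toList, ← List.ofFn_get s.toList]
  simp [Fin.univ_val_map]

theorem Multiset.diagMatrix_isCongr {ι : Type*} [Fintype ι] [DecidableEq ι] {a : ι → ℚ}
    (h0 : ∀ i, a i ≠ 0) {s : Multiset ℚ} (h : Finset.univ.val.map a = s) :
    s.diagMatrix.IsCongr (Matrix.diagonal a) := by
  refine Matrix.IsCongr.diagonal ?_
  rw [Multiset.map_toList_get, ← h, Multiset.filter_eq_self]
  simpa using h0

/-- Isometry of the diagonal quadratic forms over `ℚ` given by two multisets. -/
def Multiset.DiagIsometric (s t : Multiset ℚ) : Prop := s.diagMatrix.IsCongr t.diagMatrix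

theorem Multiset.DiagIsometric.refl (s : Multiset ℚ) : s.DiagIsometric s := Matrix.IsCongr.refl _

theorem Multiset.DiagIsometric.symm {s t : Multiset ℚ} (h : s.DiagIsometric t) :
    t.DiagIsometric s := Matrix.IsCongr.symm h

theorem Multiset.DiagIsometric.trans {s t u : Multiset ℚ} (h : s.DiagIsometric t)
    (h' : t.DiagIsometric u) : s.DiagIsometric u := Matrix.IsCongr.trans h h'

theorem Multiset.diagMatrix_add (s t : Multiset ℚ) :
    (s + t).diagMatrix.IsCongr (Matrix.fromBlocks s.diagMatrix 0 0 t.diagMatrix) := by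
  rw [diagMatrix, diagMatrix, diagMatrix, Matrix.fromBlocks_diagonal]
  refine Matrix.IsCongr.diagonal ?_
  rw [Multiset.map_toList_get, Multiset.filter_add, ← Finset.univ_disjSum_univ,
    Finset.val_disjSum, Multiset.disjSum, Multiset.map_add, Multiset.map_map, Multiset.map_map]
  simp only [Function.comp_def, Sum.elim_inl, Sum.elim_inr]
  exact congrArg₂ _ (Multiset.map_toList_get _).symm (Multiset.map_toList_get _).symm

theorem Multiset.DiagIsometric.add {s t s' t' : Multiset ℚ} (h : s.DiagIsometric t)
    (h' : s'.DiagIsometric t') : (s + s').DiagIsometric (t + t') :=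
  ((diagMatrix_add s s').trans (h.fromBlocks h')).trans (diagMatrix_add t t').symm

theorem Multiset.DiagIsometric.map_mul {s t : Multiset ℚ} (h : s.DiagIsometric t) {c : ℚ}
    (hc : c ≠ 0) : (s.map (c * ·)).DiagIsometric (t.map (c * ·)) := by
  have key (u : Multiset ℚ) : (u.map (c * ·)).diagMatrix.IsCongr (c • u.diagMatrix) := by
    rw [diagMatrix, diagMatrix, ← Matrix.diagonal_smul]
    refine Matrix.IsCongr.diagonal ?_
    rw [Multiset.map_toList_get, Multiset.filter_map]
    change _ = Multiset.map ((c * ·) ∘ (filter (fun x => x ≠ 0) u).toList.get) Finset.univ.val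
    rw [← Multiset.map_map, Multiset.map_toList_get]
    congr 1
    refine Multiset.filter_congr fun x _ => ?_
    simp [hc]
  exact ((key s).trans (h.smul c)).trans (key t).symm

theorem Multiset.DiagIsometric.of_matrix {n : ℕ} {a b : Fin n → ℚ} (ha : ∀ i, a i ≠ 0)
    (hb : ∀ i, b i ≠ 0) (P : Matrix (Fin n) (Fin n) ℚ) (hP : P.det ≠ 0)
    (h : P.transpose * Matrix.diagonal a * P = Matrix.diagonal b) :
    (Multiset.ofList (List.ofFn a)).DiagIsometric (Multiset.ofList (List.ofFn b)) :=
  ((diagMatrix_isCongr ha (Fin.univ_val_map a)).trans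
    (.of_isUnit_det hP.isUnit h)).trans (diagMatrix_isCongr hb (Fin.univ_val_map b)).symm

namespace RatWitt

/-- The diagonal form of a hyperbolic plane over `ℚ`. -/
def hyp : Multiset ℚ := {1, -1}

/-- Diagonal quadratic forms over `ℚ` up to isometry and addition of hyperbolic planes. -/
noncomputable def con : AddCon (Multiset ℚ) where
  r s t := ∃ i j : ℕ, (s + i • hyp).DiagIsometric (t + j • hyp)
  iseqv :=
    { refl s := ⟨0, 0, .refl _⟩
      symm := fun ⟨i, j, h⟩ => ⟨j, i, h.symm⟩
      trans := by
        rintro s t u ⟨i, j, h⟩ ⟨k, l, h'⟩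
        refine ⟨i + k, l + j, ?_⟩
        have h₁ := h.add (.refl (k • hyp))
        have h₂ := h'.add (.refl (j • hyp))
        rw [add_right_comm t] at h₂
        simpa only [add_nsmul, add_assoc] using h₁.trans h₂ }
  add' := by
    rintro s t u v ⟨i, j, h⟩ ⟨k, l, h'⟩
    refine ⟨i + k, j + l, ?_⟩
    simpa only [add_nsmul, add_add_add_comm] using h.add h'

theorem diagIsometric_pair {a b c d : ℚ} (ha : a ≠ 0) (hb : b ≠ 0) (hc : c ≠ 0) (hd : d ≠ 0)
    (x y z w : ℚ) (hdet : x * w - y * z ≠ 0) (h₁ : a * x ^ 2 + b * z ^ 2 = c)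
    (h₂ : a * y ^ 2 + b * w ^ 2 = d) (h₃ : a * x * y + b * z * w = 0) :
    Multiset.DiagIsometric {a, b} {c, d} := by
  have := Multiset.DiagIsometric.of_matrix (a := ![a, b]) (b := ![c, d])
    (by simp [Fin.forall_fin_two, ha, hb]) (by simp [Fin.forall_fin_two, hc, hd]) !![x, y; z, w]
    (by simpa [Matrix.det_fin_two] using hdet) (by
      ext i j
      fin_cases i <;> fin_cases j <;>
        simp [Matrix.mul_apply, Fin.sum_univ_two, Matrix.diagonal, Matrix.transpose_apply]
      all_goals linarith)
  exact this

theorem diagIsometric_hyp {a : ℚ} (ha : a ≠ 0) : Multiset.DiagIsometric {a, -a} hyp := by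
  refine diagIsometric_pair ha (neg_ne_zero.2 ha) one_ne_zero (by norm_num) ((1 + 1 / a) / 2)
    ((1 - 1 / a) / 2) ((1 - 1 / a) / 2) ((1 + 1 / a) / 2) ?_ ?_ ?_ ?_
  · have : (1 + 1 / a) / 2 * ((1 + 1 / a) / 2) - (1 - 1 / a) / 2 * ((1 - 1 / a) / 2) = 1 / a := by
      field_simp; ring
    rw [this]; positivity
  all_goals field_simp; ring

/-- The quotient monoid underlying the Witt group of `ℚ`. -/
abbrev _root_.RatWitt : Type := con.Quotient

/-- The class of a multiset of diagonal coefficients. -/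
noncomputable def mk : Multiset ℚ →+ RatWitt := con.mk'

theorem mk_eq_mk {s t : Multiset ℚ} :
    mk s = mk t ↔ ∃ i j : ℕ, (s + i • hyp).DiagIsometric (t + j • hyp) := con.eq

theorem mk_surjective : Function.Surjective mk := AddCon.mk'_surjective

theorem mk_eq_of_diagIsometric {s t : Multiset ℚ} (h : s.DiagIsometric t) : mk s = mk t :=
  mk_eq_mk.2 ⟨0, 0, by simpa using h⟩

theorem mk_hyp : mk hyp = 0 := by
  rw [← map_zero mk]
  exact mk_eq_mk.2 ⟨0, 1, by simpa using .refl _⟩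

theorem mk_pair_neg {a : ℚ} (ha : a ≠ 0) : mk {a} + mk {-a} = 0 := by
  rw [← map_add, ← mk_hyp]
  exact mk_eq_of_diagIsometric (diagIsometric_hyp ha)

theorem diagIsometric_filter (s : Multiset ℚ) :
    (s.filter (· ≠ 0)).DiagIsometric s :=
  .diagonal (by rw [Multiset.map_toList_get, Multiset.map_toList_get, Multiset.filter_filter];
                simp)

theorem mk_zero_singleton : mk {0} = 0 := by
  rw [← mk_eq_of_diagIsometric (diagIsometric_filter {0})]
  simp [Multiset.filter_singleton]

theorem map_mul_hyp {c : ℚ} (hc : c ≠ 0) (i : ℕ) :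
    ((i • hyp).map (c * ·)).DiagIsometric (i • hyp) := by
  induction i with
  | zero => simpa using Multiset.DiagIsometric.refl _
  | succ i ih =>
    rw [succ_nsmul, Multiset.map_add]
    refine ih.add ?_
    simpa [hyp] using diagIsometric_hyp hc

/-- Scaling a form by a nonzero rational. -/
noncomputable def scale (c : ℚ) (hc : c ≠ 0) : RatWitt →+ RatWitt :=
  con.lift (mk.comp (Multiset.mapAddMonoidHom (c * ·))) (by
    rintro s t ⟨i, j, h⟩
    rw [AddCon.ker_rel]
    simp only [AddMonoidHom.comp_apply, Multiset.coe_mapAddMonoidHom]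
    refine mk_eq_mk.2 ⟨i, j, ?_⟩
    have h' := h.map_mul hc
    rw [Multiset.map_add, Multiset.map_add] at h'
    exact (((Multiset.DiagIsometric.refl _).add (map_mul_hyp hc i).symm).trans h').trans
      ((Multiset.DiagIsometric.refl _).add (map_mul_hyp hc j)))

theorem scale_mk {c : ℚ} (hc : c ≠ 0) (s : Multiset ℚ) :
    scale c hc (mk s) = mk (s.map (c * ·)) := rfl

theorem scale_neg_one_add (x : RatWitt) : scale (-1) (by norm_num) x + x = 0 := by
  obtain ⟨s, rfl⟩ := mk_surjective x
  rw [scale_mk]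
  induction s using Multiset.induction_on with
  | empty => simp
  | cons a s ih =>
    rw [← Multiset.singleton_add, Multiset.map_add, map_add, map_add, add_add_add_comm, ih,
      Multiset.map_singleton, add_zero]
    by_cases ha : a = 0
    · simp [ha, mk_zero_singleton]
    · rw [add_comm, neg_one_mul, mk_pair_neg ha]

noncomputable instance : AddCommGroup RatWitt :=
  { (inferInstance : AddCommMonoid RatWitt) with
    neg := scale (-1) (by norm_num)
    zsmul := @zsmulRec _ _ _ ⟨scale (-1) (by norm_num)⟩ (· • ·)
    zsmul_zero' := fun x => zero_nsmul x
    zsmul_succ' := fun n x => succ_nsmul x n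
    neg_add_cancel := scale_neg_one_add }

/-- The class of a one-dimensional form. -/
noncomputable def cls (a : ℚ) : RatWitt := mk {a}

theorem neg_cls (a : ℚ) : -cls a = cls (-a) := by
  by_cases ha : a = 0
  · simp [ha, cls, mk_zero_singleton]
  · exact (eq_neg_of_add_eq_zero_right (mk_pair_neg ha)).symm

theorem scale_cls {c : ℚ} (hc : c ≠ 0) (a : ℚ) : scale c hc (cls a) = cls (c * a) := rfl

theorem cls_mul_sq (a : ℚ) {c : ℚ} (hc : c ≠ 0) : cls (a * c ^ 2) = cls a := by
  by_cases ha : a = 0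
  · simp [ha]
  · have := Multiset.DiagIsometric.of_matrix (a := ![a]) (b := ![a * c ^ 2])
      (by simpa using ha) (by simp [ha, hc]) !![c] (by simpa using hc) (by
        ext i j; fin_cases i; fin_cases j; simp [Matrix.mul_apply]; ring)
    exact (mk_eq_of_diagIsometric (by simpa [List.ofFn_succ] using this)).symm

theorem cls_add_cls {a b : ℚ} (ha : a ≠ 0) (hb : b ≠ 0) (hab : a + b ≠ 0) :
    cls a + cls b = cls (a + b) + cls (a * b * (a + b)) := by
  rw [cls, cls, ← map_add, cls, cls, ← map_add]
  refine mk_eq_of_diagIsometric (diagIsometric_pair ha hb hab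
    (mul_ne_zero (mul_ne_zero ha hb) hab) 1 (-b) 1 a ?_ ?_ ?_ ?_)
  · rwa [one_mul, mul_one, sub_neg_eq_add]
  all_goals ring

theorem mk_eq_sum (s : Multiset ℚ) : mk s = (s.map cls).sum := by
  induction s using Multiset.induction_on with
  | empty => simp
  | cons a s ih => rw [← Multiset.singleton_add, map_add, ih]; simp [cls]

end RatWitt

/-- If a unimodular integral form is rationally isometric to a diagonal integral form whose
coefficients are not divisible by `p ^ 2`, then the residue form of the latter at `p` is
isotropic, unless it is zero-dimensional. -/
theorem exists_isotropic_residue {ι κ : Type*} [Fintype ι] [Fintype κ] [DecidableEq ι]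
    [DecidableEq κ] (p : ℕ) [Fact p.Prime] {G : Matrix κ κ ℤ} (hG : IsUnit G.det) {d u : ι → ℤ}
    (h : (G.map (Int.castRingHom ℚ)).IsCongr (Matrix.diagonal fun i => (d i : ℚ)))
    (S : Finset ι) (hne : S.Nonempty) (hS : ∀ i ∈ S, d i = p * u i)
    (hS' : ∀ i ∉ S, ¬ (p : ℤ) ∣ d i) :
    ∃ z : ι → ℤ, (∃ i ∈ S, ¬ (p : ℤ) ∣ z i) ∧ (p : ℤ) ∣ ∑ i ∈ S, u i * z i ^ 2 := by
  classical
  obtain ⟨P, Q, hPQ, hQP, hP⟩ := h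
  have hp0 : (p : ℤ) ≠ 0 := by exact_mod_cast (Fact.out : p.Prime).ne_zero
  have hcard : Fintype.card κ = Fintype.card ι := by
    have h1 := Matrix.square_of_invertible P Q hPQ hQP
    exact h1
  let M : Submodule ℤ ((κ → ℤ) × (ι → ℤ)) :=
    { carrier := {w | (fun i => (w.1 i : ℚ)) = P.mulVec fun i => (w.2 i : ℚ)}
      add_mem' := by
        rintro a b ha hb
        simp only [Set.mem_ofPred_eq] at ha hb ⊢
        have e1 : (fun i => (((a + b).1 i : ℤ) : ℚ)) =
          (fun i => (a.1 i : ℚ)) + fun i => (b.1 i : ℚ) := by ext; simp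
        have e2 : (fun i => (((a + b).2 i : ℤ) : ℚ)) =
          (fun i => (a.2 i : ℚ)) + fun i => (b.2 i : ℚ) := by ext; simp
        rw [e1, e2, Matrix.mulVec_add, ha, hb]
      zero_mem' := by
        have : (fun i : ι => (((0 : (κ → ℤ) × (ι → ℤ)).2 i : ℤ) : ℚ)) = 0 := by ext; simp
        simp only [Set.mem_ofPred_eq, this, Matrix.mulVec_zero]
        ext; simp
      smul_mem' := by
        rintro c a ha
        simp only [Set.mem_ofPred_eq] at ha ⊢
        have e1 : (fun i => (((c • a).1 i : ℤ) : ℚ)) = (c : ℚ) • fun i => (a.1 i : ℚ) := by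
          ext; simp
        have e2 : (fun i => (((c • a).2 i : ℤ) : ℚ)) = (c : ℚ) • fun i => (a.2 i : ℚ) := by
          ext; simp
        rw [e1, e2, Matrix.mulVec_smul, ha] }
  have hM : ∀ w, w ∈ M ↔ (fun i => (w.1 i : ℚ)) = P.mulVec fun i => (w.2 i : ℚ) := fun _ => Iff.rfl
  have hform : ∀ w ∈ M, ∀ w' ∈ M,
      w.1 ⬝ᵥ G.mulVec w'.1 = ∑ i, d i * w.2 i * w'.2 i := by
    intro w hw w' hw'
    rw [hM] at hw hw'
    have h1 : ((w.1 ⬝ᵥ G.mulVec w'.1 : ℤ) : ℚ) = (fun i => (w.1 i : ℚ)) ⬝ᵥ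
        (G.map (Int.castRingHom ℚ)).mulVec (fun i => (w'.1 i : ℚ)) := by
      simp [dotProduct, Matrix.mulVec]
    have h2 : (fun i => (w.1 i : ℚ)) ⬝ᵥ
        (G.map (Int.castRingHom ℚ)).mulVec (fun i => (w'.1 i : ℚ)) =
        (fun i => (w.2 i : ℚ)) ⬝ᵥ (Matrix.diagonal fun i => (d i : ℚ)).mulVec
          (fun i => (w'.2 i : ℚ)) := by
      rw [hw, hw', ← hP, ← Matrix.mulVec_mulVec, ← Matrix.mulVec_mulVec,
        Matrix.dotProduct_mulVec (fun i => (w.2 i : ℚ)) P.transpose, Matrix.vecMul_transpose]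
    have h3 : ((∑ i, d i * w.2 i * w'.2 i : ℤ) : ℚ) = (fun i => (w.2 i : ℚ)) ⬝ᵥ
        (Matrix.diagonal fun i => (d i : ℚ)).mulVec (fun i => (w'.2 i : ℚ)) := by
      simp only [dotProduct, Matrix.mulVec_diagonal]
      push_cast
      exact Finset.sum_congr rfl fun i _ => by ring
    exact_mod_cast (h1.trans h2).trans h3.symm
  have hrank : Fintype.card ι ≤ Module.finrank ℤ M := by
    obtain ⟨k, hk⟩ := IsLocalization.exist_integer_multiples_of_finite (nonZeroDivisors ℤ)
      (fun x : κ × ι => P x.1 x.2)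
    choose P' hP' using hk
    have hk0 : (k : ℤ) ≠ 0 := nonZeroDivisors.coe_ne_zero k
    have hP'' : ∀ i j, (P' (i, j) : ℚ) = (k : ℤ) * P i j := fun i j => by
      have := hP' (i, j)
      simpa [Algebra.smul_def] using this
    let f : (ι → ℤ) →ₗ[ℤ] M :=
      { toFun z := ⟨((Matrix.of fun i j => P' (i, j)).mulVec z, (k : ℤ) • z), by
          rw [hM]
          ext i
          simp only [Matrix.mulVec, dotProduct, Matrix.of_apply, Int.cast_sum, Int.cast_mul, hP'',
            Pi.smul_apply, smul_eq_mul]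
          exact Finset.sum_congr rfl fun j _ => by ring⟩
        map_add' x y := by ext <;> simp [Matrix.mulVec_add, mul_add]
        map_smul' c x := Subtype.ext (Prod.ext (Matrix.mulVec_smul _ c x) (smul_comm _ c x)) }
    have hf : Function.Injective f := by
      intro x y hxy
      have : (k : ℤ) • x = (k : ℤ) • y := congrArg (fun w : M => w.1.2) hxy
      exact smul_right_injective _ hk0 this
    simpa using LinearMap.finrank_le_finrank_of_injective hf
  let b := Module.finBasis ℤ M
  let W : Matrix (κ ⊕ {i // i ∉ S}) (Fin (Module.finrank ℤ M)) (ZMod p) :=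
    .of fun (i : κ ⊕ {i // i ∉ S}) j => Sum.elim (fun i : κ => (((b j).1.1 i : ℤ) : ZMod p))
      (fun i : {i // i ∉ S} => (((b j).1.2 i.1 : ℤ) : ZMod p)) i
  let E : Matrix (κ ⊕ {i // i ∉ S}) (κ ⊕ {i // i ∉ S}) (ZMod p) :=
    .fromBlocks (G.map (Int.castRingHom (ZMod p))) 0 0
      (.diagonal fun i => -((d i : ℤ) : ZMod p))
  have hE : IsUnit E.det := by
    rw [Matrix.det_fromBlocks_zero₂₁, Matrix.det_diagonal, ← RingHom.mapMatrix_apply,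
      ← RingHom.map_det]
    refine (hG.map _).mul (IsUnit.mk0 _ (Finset.prod_ne_zero_iff.2 fun i _ => ?_))
    rw [neg_ne_zero, Ne, ZMod.intCast_zmod_eq_zero_iff_dvd]
    exact hS' _ i.2
  have hd0 : ∀ i ∈ S, ((d i : ℤ) : ZMod p) = 0 := fun i hi => by
    rw [hS i hi, ZMod.intCast_zmod_eq_zero_iff_dvd]; exact dvd_mul_right _ _
  have hWEW : W.transpose * (E * W) = 0 := by
    ext j k
    have := congrArg (Int.cast : ℤ → ZMod p) (hform _ (b j).2 _ (b k).2)
    simp only [Matrix.mul_apply, Matrix.transpose_apply, Fintype.sum_sum_type, W, E,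
      Matrix.of_apply, Sum.elim_inl, Sum.elim_inr, Matrix.fromBlocks_apply₁₁,
      Matrix.fromBlocks_apply₁₂, Matrix.fromBlocks_apply₂₁, Matrix.fromBlocks_apply₂₂,
      Matrix.zero_apply, zero_mul, Finset.sum_const_zero, add_zero, zero_add, Matrix.map_apply,
      Matrix.diagonal_apply, ite_mul, Finset.sum_ite_eq, Finset.mem_univ, if_true]
    simp only [dotProduct, Matrix.mulVec, Int.cast_sum, Int.cast_mul] at this
    have h2 : ∑ i, ((d i : ℤ) : ZMod p) * ((b j).1.2 i : ℤ) * ((b k).1.2 i : ℤ) =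
        ∑ i : {i // i ∉ S}, ((d i : ℤ) : ZMod p) * ((b j).1.2 i : ℤ) * ((b k).1.2 i : ℤ) := by
      rw [← Finset.sum_subtype (Finset.univ.filter (· ∉ S)) (by simp)
        (fun i => ((d i : ℤ) : ZMod p) * ((b j).1.2 i : ℤ) * ((b k).1.2 i : ℤ))]
      refine (Finset.sum_subset (Finset.subset_univ _) fun i _ hi => ?_).symm
      rw [hd0 i (by simpa using hi)]; ring
    rw [h2] at this
    simp only [Int.coe_castRingHom]
    rw [this, ← Finset.sum_add_distrib]
    exact Finset.sum_eq_zero fun i _ => by ring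
  have hlt : W.rank < Module.finrank ℤ M := by
    have h1 := Matrix.rank_add_rank_le_card_of_mul_eq_zero hWEW
    rw [Matrix.rank_transpose, Matrix.rank_mul_eq_right_of_isUnit_det _ _ hE,
      Fintype.card_sum] at h1
    have h2 : Fintype.card {i // i ∉ S} + S.card = Fintype.card ι := by
      have := S.card_compl
      have h3 := S.card_le_univ
      rw [Fintype.card_subtype, Finset.filter_not]
      simp only [Finset.filter_mem_eq_inter, Finset.univ_inter]
      rw [← Finset.compl_eq_univ_sdiff]
      omega
    have := hne.card_pos
    omega
  obtain ⟨c, hc, hWc⟩ : ∃ c, W.mulVec c = 0 ∧ c ≠ 0 := by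
    by_contra! hcon
    have hinj : Function.Injective W.mulVecLin := by
      rw [injective_iff_map_eq_zero]
      exact fun c hc => hcon c hc
    have := LinearMap.finrank_range_of_inj hinj
    rw [Module.finrank_fin_fun] at this
    exact hlt.ne this
  let w : M := ∑ j, ((c j).val : ℤ) • b j
  have hw1 : ∀ i, w.1.1 i = ∑ j, ((c j).val : ℤ) * (b j).1.1 i := fun i => by
    simp only [w, Submodule.coe_sum, Submodule.coe_smul, Prod.fst_sum, Finset.sum_apply,
      Prod.smul_fst, Pi.smul_apply, smul_eq_mul]
  have hw2 : ∀ i, w.1.2 i = ∑ j, ((c j).val : ℤ) * (b j).1.2 i := fun i => by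
    simp only [w, Submodule.coe_sum, Submodule.coe_smul, Prod.snd_sum, Finset.sum_apply,
      Prod.smul_snd, Pi.smul_apply, smul_eq_mul]
  have hd1 : ∀ i, (p : ℤ) ∣ w.1.1 i := fun i => by
    rw [← ZMod.intCast_zmod_eq_zero_iff_dvd, hw1]
    have := congrFun hc (Sum.inl i)
    simpa [W, Matrix.mulVec, dotProduct, mul_comm] using this
  have hd2 : ∀ i ∉ S, (p : ℤ) ∣ w.1.2 i := fun i hi => by
    rw [← ZMod.intCast_zmod_eq_zero_iff_dvd, hw2]
    have := congrFun hc (Sum.inr ⟨i, hi⟩)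
    simpa [W, Matrix.mulVec, dotProduct, mul_comm] using this
  refine ⟨w.1.2, ?_, ?_⟩
  · by_contra! hcon
    have hd3 : ∀ i, (p : ℤ) ∣ w.1.2 i := fun i =>
      if hi : i ∈ S then hcon i hi else hd2 i hi
    choose y hy using hd1
    choose z hz using hd3
    have hyz : (y, z) ∈ M := by
      have := (hM _).1 w.2
      rw [hM]
      have e1 : (fun i => (w.1.1 i : ℚ)) = (p : ℚ) • fun i => (y i : ℚ) := by
        ext i; simp [hy]
      have e2 : (fun i => (w.1.2 i : ℚ)) = (p : ℚ) • fun i => (z i : ℚ) := by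
        ext i; simp [hz]
      rw [e1, e2, Matrix.mulVec_smul] at this
      exact smul_right_injective _ (by exact_mod_cast hp0) this
    have hwp : w = (p : ℤ) • (⟨(y, z), hyz⟩ : M) := by
      ext i
      · simp [hy]
      · simp [hz]
    apply hWc
    ext j
    have h1 : b.repr w j = ((c j).val : ℤ) := by
      simp only [w]
      rw [Module.Basis.repr_sum_self]
    rw [hwp] at h1
    have h2 : (p : ℤ) ∣ ((c j).val : ℤ) := by
      rw [← h1, map_smul, Finsupp.smul_apply, smul_eq_mul]; exact dvd_mul_right _ _
    rw [← ZMod.intCast_zmod_eq_zero_iff_dvd] at h2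
    simpa using h2
  · have h1 := hform _ w.2 _ w.2
    choose y hy using hd1
    have h2 : w.1.1 ⬝ᵥ G.mulVec w.1.1 = (p : ℤ) * (p * (y ⬝ᵥ G.mulVec y)) := by
      have : w.1.1 = (p : ℤ) • y := by ext i; simp [hy]
      rw [this, Matrix.mulVec_smul, smul_dotProduct, dotProduct_smul]
      simp
    rw [h2, ← Finset.sum_add_sum_compl S] at h1
    have h3 : (p : ℤ) * p ∣ ∑ i ∈ Sᶜ, d i * w.1.2 i * w.1.2 i := by
      refine Finset.dvd_sum fun i hi => ?_
      rw [mul_assoc]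
      exact Dvd.dvd.mul_left (mul_dvd_mul (hd2 i (by simpa using hi))
        (hd2 i (by simpa using hi))) _
    have h4 : ∑ i ∈ S, d i * w.1.2 i * w.1.2 i = p * ∑ i ∈ S, u i * w.1.2 i ^ 2 := by
      rw [Finset.mul_sum]
      exact Finset.sum_congr rfl fun i hi => by rw [hS i hi]; ring
    rw [h4] at h1
    obtain ⟨m, hm⟩ := h3
    refine ⟨y ⬝ᵥ G.mulVec y - m, mul_left_cancel₀ hp0 ?_⟩
    rw [hm] at h1
    linear_combination -h1

namespace RatWitt

/-- Nonzero integers all of whose prime divisors are less than `N`. -/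
def IsSm (N : ℕ) (n : ℤ) : Prop := n ≠ 0 ∧ ∀ q : ℕ, q.Prime → (q : ℤ) ∣ n → q < N

theorem IsSm.mul {N : ℕ} {m n : ℤ} (hm : IsSm N m) (hn : IsSm N n) : IsSm N (m * n) :=
  ⟨mul_ne_zero hm.1 hn.1, fun q hq h =>
    ((Nat.prime_iff_prime_int.1 hq).dvd_or_dvd h).elim (hm.2 q hq) (hn.2 q hq)⟩

theorem IsSm.of_dvd {N : ℕ} {m n : ℤ} (hm : IsSm N m) (h : n ∣ m) : IsSm N n :=
  ⟨ne_zero_of_dvd_ne_zero hm.1 h, fun q hq h' => hm.2 q hq (h'.trans h)⟩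

theorem IsSm.neg {N : ℕ} {m : ℤ} (hm : IsSm N m) : IsSm N (-m) := hm.of_dvd (neg_dvd.2 dvd_rfl)

theorem IsSm.mono {N M : ℕ} (h : N ≤ M) {m : ℤ} (hm : IsSm N m) : IsSm M m :=
  ⟨hm.1, fun q hq h' => (hm.2 q hq h').trans_le h⟩

theorem IsSm.of_abs_lt {N : ℕ} {m : ℤ} (hm : m ≠ 0) (h : |m| < N) : IsSm N m :=
  ⟨hm, fun q _ h' => by
    have := Int.le_of_dvd (abs_pos.2 hm) ((dvd_abs _ _).2 h')
    exact_mod_cast this.trans_lt h⟩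

theorem IsSm.not_dvd {p : ℕ} (hp : p.Prime) {m : ℤ} (hm : IsSm p m) : ¬ (p : ℤ) ∣ m :=
  fun h => lt_irrefl _ (hm.2 p hp h)

/-- The subgroup generated by the classes of integers with all prime divisors less than `N`. -/
noncomputable def Sm (N : ℕ) : AddSubgroup RatWitt :=
  AddSubgroup.closure {x | ∃ n : ℤ, IsSm N n ∧ cls n = x}

theorem cls_mem_Sm {N : ℕ} {n : ℤ} (h : IsSm N n) : cls n ∈ Sm N :=
  AddSubgroup.subset_closure ⟨n, h, rfl⟩

theorem Sm_mono {N M : ℕ} (h : N ≤ M) : Sm N ≤ Sm M :=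
  AddSubgroup.closure_mono fun _ ⟨n, hn, hx⟩ => ⟨n, hn.mono h, hx⟩

theorem exists_multiset_of_mem_Sm {N : ℕ} {x : RatWitt} (h : x ∈ Sm N) :
    ∃ s : Multiset ℤ, (∀ n ∈ s, IsSm N n) ∧ x = mk (s.map fun n : ℤ => (n : ℚ)) := by
  induction h using AddSubgroup.closure_induction with
  | mem x hx =>
    obtain ⟨n, hn, rfl⟩ := hx
    exact ⟨{n}, by simpa using hn, by simp [cls]⟩
  | zero => exact ⟨0, by simp, by simp⟩
  | add x y _ _ hx hy =>
    obtain ⟨s, hs, rfl⟩ := hx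
    obtain ⟨t, ht, rfl⟩ := hy
    exact ⟨s + t, by simpa [or_imp, forall_and] using ⟨hs, ht⟩, by simp⟩
  | neg x _ hx =>
    obtain ⟨s, hs, rfl⟩ := hx
    refine ⟨s.map fun n => -n, by simpa using fun n hn => (hs n hn).neg, ?_⟩
    change scale (-1) (by norm_num) _ = _
    rw [scale_mk, Multiset.map_map, Multiset.map_map]
    simp

theorem scale_mem_Sm {N : ℕ} {c : ℤ} (hc : IsSm N c) {x : RatWitt} (hx : x ∈ Sm N) :
    scale c (by exact_mod_cast hc.1) x ∈ Sm N := by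
  obtain ⟨s, hs, rfl⟩ := exists_multiset_of_mem_Sm hx
  rw [mk_eq_sum, map_multiset_sum]
  refine AddSubgroup.multiset_sum_mem _ _ fun y hy => ?_
  simp only [Multiset.map_map, Multiset.mem_map] at hy
  obtain ⟨n, hn, rfl⟩ := hy
  simp only [Function.comp_apply, scale_cls]
  exact_mod_cast cls_mem_Sm (hc.mul (hs n hn))

theorem zmod_two_sum_sq : ∀ u v w : ZMod 2, u ≠ 0 → v ≠ 0 → ∃ x y, u * x ^ 2 + v * y ^ 2 = w := by
  decide

section Residue

variable (p : ℕ) [hp : Fact p.Prime]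

theorem cls_prime_mul_mul_sub_mem {r q : ℤ} (hr : r ≠ 0) (hq : q ≠ 0) (hr' : |r| < p)
    (hq' : |q| < p) :
    cls ((p * (r * q) : ℤ) : ℚ) - cls ((p * (r * q % p) : ℤ) : ℚ) ∈ Sm p := by
  have hp0 : (0 : ℤ) < p := by exact_mod_cast hp.out.pos
  have hrs := IsSm.of_abs_lt hr hr'
  have hqs := IsSm.of_abs_lt hq hq'
  have hrq := hrs.mul hqs
  obtain ⟨t, ht⟩ : ∃ t, t = r * q % p := ⟨_, rfl⟩
  obtain ⟨m, hm⟩ : ∃ m, m = r * q / p := ⟨_, rfl⟩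
  have hdiv : t + p * m = r * q := by rw [ht, hm]; exact Int.emod_add_mul_ediv _ _
  rw [← ht]
  have ht0 : 0 ≤ t := ht ▸ Int.emod_nonneg _ hp0.ne'
  have htp : t < p := ht ▸ Int.emod_lt_of_pos _ hp0
  have htne : t ≠ 0 := fun h =>
    hrq.not_dvd hp.out (by rw [← hdiv, h, zero_add]; exact dvd_mul_right _ _)
  have hts : IsSm p t := .of_abs_lt htne (by rwa [abs_of_nonneg ht0])
  by_cases hm0 : m = 0
  · rw [hm0, mul_zero, add_zero] at hdiv
    rw [hdiv, sub_self]
    exact zero_mem _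
  have hms : IsSm p m := by
    refine .of_abs_lt hm0 ?_
    have h1 : |r * q| ≤ (p - 1) * (p - 1) := by
      rw [abs_mul]
      exact mul_le_mul (by omega) (by omega) (abs_nonneg _) (by omega)
    have h2 := abs_le.1 h1
    rw [abs_lt]
    constructor <;> nlinarith
  have hpQ : (p : ℚ) ≠ 0 := by exact_mod_cast hp0.ne'
  have htQ : (t : ℚ) ≠ 0 := by exact_mod_cast htne
  have hmQ : (m : ℚ) ≠ 0 := by exact_mod_cast hm0
  have hrqQ : (r * q : ℚ) ≠ 0 := by exact_mod_cast hrq.1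
  have hdivQ : (t + p * m : ℚ) = r * q := by exact_mod_cast hdiv
  have key := cls_add_cls (a := p * t) (b := m * p ^ 2) (by positivity)
    (by positivity) (by
      rw [show (p * t + m * p ^ 2 : ℚ) = p * (t + p * m) by ring, hdivQ]
      exact mul_ne_zero hpQ hrqQ)
  rw [show (p * t + m * p ^ 2 : ℚ) = p * (t + p * m) by ring, hdivQ, cls_mul_sq _ hpQ,
    show (p * t * (m * p ^ 2) * (p * (r * q)) : ℚ) = m * t * (r * q) * (p ^ 2) ^ 2 by ring,
    cls_mul_sq _ (pow_ne_zero 2 hpQ)] at key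
  have h3 := sub_mem (cls_mem_Sm hms) (cls_mem_Sm ((hms.mul hts).mul hrq))
  push_cast at h3 ⊢
  have h4 : cls (p * (r * q)) - cls (p * t) = cls m - cls (m * t * (r * q)) := by
    rw [sub_eq_sub_iff_add_eq_add, ← key, add_comm]
  rwa [h4]

theorem cls_prime_mul_step {c a : ℤ} (hc : c ≠ 0) (hc' : |c| < p) (ha : IsSm p a)
    (h : cls ((p * a : ℤ) : ℚ) - cls ((p * (a % p) : ℤ) : ℚ) ∈ Sm p) :
    cls ((p * (c * a) : ℤ) : ℚ) - cls ((p * (c * a % p) : ℤ) : ℚ) ∈ Sm p := by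
  have hp0 : (0 : ℤ) < p := by exact_mod_cast hp.out.pos
  have h1 := scale_mem_Sm (.of_abs_lt hc hc') h
  have h2 := cls_prime_mul_mul_sub_mem p hc
    (fun h0 => ha.not_dvd hp.out (Int.dvd_of_emod_eq_zero h0)) hc'
    (by rw [abs_of_nonneg (Int.emod_nonneg _ hp0.ne')]; exact Int.emod_lt_of_pos _ hp0)
  rw [map_sub, scale_cls, scale_cls] at h1
  rw [Int.mul_emod, Int.emod_emod, ← Int.mul_emod] at h2
  have h3 := add_mem h1 h2
  push_cast at h3 ⊢
  rw [mul_left_comm (c : ℚ), mul_left_comm (c : ℚ), sub_add_sub_cancel] at h3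
  exact h3

theorem cls_prime_mul_sub_mem {n : ℤ} (hn : IsSm p n) :
    cls ((p * n : ℤ) : ℚ) - cls ((p * (n % p) : ℤ) : ℚ) ∈ Sm p := by
  have key : ∀ n : ℕ, IsSm p n →
      cls ((p * n : ℤ) : ℚ) - cls ((p * ((n : ℤ) % p) : ℤ) : ℚ) ∈ Sm p := fun n => by
    induction n using induction_on_primes with
    | zero => exact fun h => absurd rfl h.1
    | one =>
      intro _
      rw [Nat.cast_one, Int.emod_eq_of_lt zero_le_one (by exact_mod_cast hp.out.one_lt), sub_self]
      exact zero_mem _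
    | prime_mul q a hq ih =>
      intro h
      rw [Nat.cast_mul] at h ⊢
      have ha := h.of_dvd (dvd_mul_left _ _)
      refine cls_prime_mul_step p (by exact_mod_cast hq.ne_zero) ?_ ha (ih ha)
      rw [Nat.abs_cast]
      exact_mod_cast h.2 q hq (dvd_mul_right _ _)
  rcases Int.natAbs_eq n with h | h
  · rw [h] at hn ⊢
    exact key _ hn
  · rw [h] at hn
    have hn' : IsSm p (n.natAbs : ℤ) := by simpa using hn.neg
    have := cls_prime_mul_step p (c := -1) (by norm_num) (by simpa using hp.out.one_lt) hn'
      (key _ hn')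
    rw [h]
    simpa using this

/-- The classes `⟨p * u⟩`, `u` an element of `ZMod p`, modulo forms without residue at `p`. -/
noncomputable def resCls (u : ZMod p) : RatWitt ⧸ Sm p :=
  QuotientAddGroup.mk' (Sm p) (cls ((p * (u.val : ℤ) : ℤ) : ℚ))

variable {p}

theorem resCls_intCast {n : ℤ} (hn : IsSm p n) :
    resCls p (n : ZMod p) = QuotientAddGroup.mk' (Sm p) (cls ((p * n : ℤ) : ℚ)) := by
  rw [resCls, ZMod.val_intCast, QuotientAddGroup.mk'_eq_mk', ]
  exact ⟨_, cls_prime_mul_sub_mem p hn, by abel⟩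

theorem isSm_val {u : ZMod p} (hu : u ≠ 0) : IsSm p (u.val : ℤ) :=
  .of_abs_lt (by exact_mod_cast (ZMod.val_ne_zero u).2 hu)
    (by rw [Nat.abs_cast]; exact_mod_cast u.val_lt)

theorem resCls_zero : resCls p 0 = 0 := by
  simp [resCls, cls, mk_zero_singleton]

theorem resCls_mul_sq (u : ZMod p) {c : ZMod p} (hc : c ≠ 0) :
    resCls p (u * c ^ 2) = resCls p u := by
  by_cases hu : u = 0
  · simp [hu]
  have h := resCls_intCast (((isSm_val hu).mul ((isSm_val hc).mul (isSm_val hc))))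
  have h1 : (((u.val : ℤ) * ((c.val : ℤ) * (c.val : ℤ)) : ℤ) : ZMod p) = u * c ^ 2 := by
    simp [sq]
  rw [h1] at h
  rw [h, resCls]
  congr 1
  have hcQ : ((c.val : ℤ) : ℚ) ≠ 0 := by exact_mod_cast (isSm_val hc).1
  rw [← cls_mul_sq ((p * (u.val : ℤ) : ℤ) : ℚ) hcQ]
  push_cast
  congr 1
  ring

theorem resCls_neg (u : ZMod p) : resCls p (-u) = -resCls p u := by
  by_cases hu : u = 0
  · simp [hu, resCls_zero]
  have h := resCls_intCast (isSm_val hu).neg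
  have h1 : ((-(u.val : ℤ) : ℤ) : ZMod p) = -u := by simp
  rw [h1] at h
  rw [h, resCls, ← map_neg, neg_cls]
  push_cast
  rw [mul_neg]

theorem resCls_add {u v : ZMod p} (hu : u ≠ 0) (hv : v ≠ 0) (huv : u + v ≠ 0) :
    resCls p u + resCls p v = resCls p (u + v) + resCls p (u * v * (u + v)) := by
  obtain ⟨a, ha⟩ : ∃ a : ℤ, a = u.val := ⟨_, rfl⟩
  obtain ⟨b, hb⟩ : ∃ b : ℤ, b = v.val - p := ⟨_, rfl⟩
  have hau : (a : ZMod p) = u := by simp [ha]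
  have hbv : (b : ZMod p) = v := by simp [hb]
  have hu' := u.val_lt
  have hv' := v.val_lt
  have hv0 : v.val ≠ 0 := by simpa using hv
  have has : IsSm p a := ha ▸ isSm_val hu
  have hbs : IsSm p b := .of_abs_lt (by omega) (by rw [abs_lt]; omega)
  have hab : a + b ≠ 0 := fun h => huv (by rw [← hau, ← hbv, ← Int.cast_add, h, Int.cast_zero])
  have habs : IsSm p (a + b) := .of_abs_lt hab (by rw [abs_lt]; omega)
  have hprod := (has.mul hbs).mul habs
  have hpQ : (p : ℚ) ≠ 0 := by exact_mod_cast hp.out.ne_zero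
  have key := cls_add_cls (a := p * a) (b := p * b)
    (mul_ne_zero hpQ (by exact_mod_cast has.1)) (mul_ne_zero hpQ (by exact_mod_cast hbs.1))
    (by rw [← mul_add]; exact mul_ne_zero hpQ (by exact_mod_cast hab))
  rw [show (p * a * (p * b) * (p * a + p * b) : ℚ) = p * (a * b * (a + b)) * p ^ 2 by ring,
    cls_mul_sq _ hpQ, ← mul_add] at key
  have e := fun {n : ℤ} => @resCls_intCast p _ n
  have h := congrArg (QuotientAddGroup.mk' (Sm p)) key
  rw [map_add, map_add] at h
  have e1 := e has
  have e2 := e hbs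
  have e3 := e habs
  have e4 := e hprod
  push_cast [hau, hbv] at e1 e2 e3 e4
  rw [e1, e2, e3, e4, h]

theorem exists_sum_sq_eq (u v w : ZMod p) (hu : u ≠ 0) (hv : v ≠ 0) :
    ∃ x y : ZMod p, u * x ^ 2 + v * y ^ 2 = w := by
  rcases hp.out.eq_two_or_odd' with rfl | hodd
  · exact zmod_two_sum_sq u v w hu hv
  · obtain ⟨x, y, h⟩ := FiniteField.exists_root_sum_quadratic
      (f := Polynomial.C u * Polynomial.X ^ 2)
      (g := Polynomial.C v * Polynomial.X ^ 2 - Polynomial.C w)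
      (Polynomial.degree_C_mul_X_pow 2 hu) (by compute_degree!) (by
        rw [ZMod.card]; exact Nat.odd_iff.1 hodd)
    exact ⟨x, y, by simp at h; linear_combination h⟩

theorem exists_resCls_eq_add_add {u v w : ZMod p} (hu : u ≠ 0) (hv : v ≠ 0) (hw : w ≠ 0) :
    ∃ t ≠ 0, resCls p u + resCls p v + resCls p w = resCls p t := by
  obtain ⟨x, y, h⟩ := exists_sum_sq_eq u v (-w) hu hv
  by_cases hx : x = 0
  · have hy : y ≠ 0 := by
      rintro rfl
      simp [hx, eq_comm, hw] at h
    refine ⟨u, hu, ?_⟩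
    rw [hx, zero_pow two_ne_zero, mul_zero, zero_add] at h
    rw [← resCls_mul_sq v hy, h, resCls_neg]
    abel
  by_cases hy : y = 0
  · refine ⟨v, hv, ?_⟩
    rw [hy, zero_pow two_ne_zero, mul_zero, add_zero] at h
    rw [← resCls_mul_sq u hx, h, resCls_neg]
    abel
  have h1 : u * x ^ 2 ≠ 0 := mul_ne_zero hu (pow_ne_zero 2 hx)
  have h2 : v * y ^ 2 ≠ 0 := mul_ne_zero hv (pow_ne_zero 2 hy)
  refine ⟨u * x ^ 2 * (v * y ^ 2) * -w, mul_ne_zero (mul_ne_zero h1 h2) (neg_ne_zero.2 hw), ?_⟩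
  have := resCls_add h1 h2 (by rw [h]; exact neg_ne_zero.2 hw)
  rw [h, resCls_mul_sq u hx, resCls_mul_sq v hy, resCls_neg w] at this
  rw [this]
  abel

theorem mk_cls_eq_zero_or {n : ℤ} (hn : IsSm (p + 1) n) :
    QuotientAddGroup.mk' (Sm p) (cls n) = 0 ∨
      ∃ u ≠ 0, QuotientAddGroup.mk' (Sm p) (cls n) = resCls p u := by
  have hfin : FiniteMultiplicity (p : ℤ) n :=
    Int.finiteMultiplicity_iff.2 ⟨by simpa using hp.out.ne_one, hn.1⟩
  obtain ⟨m, hnm, hm⟩ := hfin.exists_eq_pow_mul_and_not_dvd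
  generalize multiplicity (p : ℤ) n = k at hnm
  have hms : IsSm p m := ⟨fun h => hm (h ▸ dvd_zero _), fun q hq h => by
    have h1 := hn.2 q hq (hnm ▸ h.mul_left _)
    refine lt_of_le_of_ne (Nat.lt_succ_iff.1 h1) ?_
    rintro rfl
    exact hm h⟩
  have hpQ : (p : ℚ) ≠ 0 := by exact_mod_cast hp.out.ne_zero
  rcases Nat.even_or_odd' k with ⟨j, rfl | rfl⟩
  · left
    rw [hnm, show (((p : ℤ) ^ (2 * j) * m : ℤ) : ℚ) = m * (p ^ j) ^ 2 by push_cast; ring,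
      cls_mul_sq _ (pow_ne_zero _ hpQ)]
    exact (QuotientAddGroup.eq_zero_iff _).2 (cls_mem_Sm hms)
  · right
    refine ⟨m, by rwa [Ne, ZMod.intCast_zmod_eq_zero_iff_dvd], ?_⟩
    rw [hnm, show (((p : ℤ) ^ (2 * j + 1) * m : ℤ) : ℚ) = (p * m : ℤ) * (p ^ j) ^ 2 by
      push_cast; ring, cls_mul_sq _ (pow_ne_zero _ hpQ), resCls_intCast hms]

theorem mk_eq_of_mem_Sm_succ {x : RatWitt} (hx : x ∈ Sm (p + 1)) :
    QuotientAddGroup.mk' (Sm p) x = 0 ∨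
      (∃ u ≠ 0, QuotientAddGroup.mk' (Sm p) x = resCls p u) ∨
      ∃ u ≠ 0, ∃ v ≠ 0, QuotientAddGroup.mk' (Sm p) x = resCls p u + resCls p v := by
  obtain ⟨s, hs, rfl⟩ := exists_multiset_of_mem_Sm hx
  clear hx
  induction s using Multiset.induction_on with
  | empty => simp
  | cons n s ih =>
    have ih := ih fun m hm => hs m (Multiset.mem_cons_of_mem hm)
    have h1 := mk_cls_eq_zero_or (hs n (Multiset.mem_cons_self n s))
    rw [Multiset.map_cons, ← Multiset.singleton_add, map_add, map_add]
    change _ ∨ _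
    rw [show mk {(n : ℚ)} = cls n from rfl]
    rcases h1 with h1 | ⟨t, ht, h1⟩
    · rwa [h1, zero_add]
    · rw [h1]
      rcases ih with h | ⟨u, hu, h⟩ | ⟨u, hu, v, hv, h⟩
      · exact .inr (.inl ⟨t, ht, by rw [h, add_zero]⟩)
      · exact .inr (.inr ⟨t, ht, u, hu, by rw [h]⟩)
      · obtain ⟨w, hw, h2⟩ := exists_resCls_eq_add_add ht hu hv
        exact .inr (.inl ⟨w, hw, by rw [h, ← add_assoc, h2]⟩)

end Residue

end RatWitt

theorem Matrix.exists_isCongr_diagonal {K : Type*} [Field K] [Invertible (2 : K)] {n : ℕ}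
    {A : Matrix (Fin n) (Fin n) K} (hA : A.transpose = A) :
    ∃ a : Fin n → K, A.IsCongr (Matrix.diagonal a) := by
  have hsymm : LinearMap.IsSymm (Matrix.toBilin' A) := by
    refine ⟨fun x y => ?_⟩
    rw [RingHom.id_apply, Matrix.toBilin'_apply', Matrix.toBilin'_apply', Matrix.dotProduct_mulVec,
      ← Matrix.mulVec_transpose, hA, dotProduct_comm]
  obtain ⟨v, hv⟩ := LinearMap.BilinForm.exists_orthogonal_basis hsymm
  let w := v.reindex (finCongr (Module.finrank_fin_fun K (n := n)))
  refine ⟨fun i => Matrix.toBilin' A (w i) (w i), (Pi.basisFun K (Fin n)).toMatrix w,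
    w.toMatrix (Pi.basisFun K (Fin n)), Module.Basis.toMatrix_mul_toMatrix_flip _ _,
    Module.Basis.toMatrix_mul_toMatrix_flip _ _, ?_⟩
  ext i j
  have h1 : ∀ i j, (((Pi.basisFun K (Fin n)).toMatrix w).transpose * A *
      (Pi.basisFun K (Fin n)).toMatrix w) i j = Matrix.toBilin' A (w i) (w j) := by
    intro i j
    rw [Matrix.toBilin'_apply', Matrix.mul_assoc]
    rfl
  rw [h1, Matrix.diagonal_apply]
  split_ifs with h
  · rw [h]
  · simp only [w, Module.Basis.reindex_apply]
    exact hv (by simpa using h)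

theorem Matrix.IsCongr.cancel {K ι κ : Type*} [Field K] [CharZero K] [Fintype ι] [Fintype κ]
    [DecidableEq ι] [DecidableEq κ] {A : Matrix ι ι K} {B : Matrix κ κ K} (hA : A.transpose = A)
    (hB : IsUnit B.det) {c : K}
    (h : (Matrix.fromBlocks A 0 0 (Matrix.diagonal fun _ : Unit => c)).IsCongr
      (Matrix.fromBlocks B 0 0 (Matrix.diagonal fun _ : Unit => c))) : A.IsCongr B := by
  obtain ⟨P, Q, hPQ, hQP, hP⟩ := h
  have hcard : Fintype.card ι = Fintype.card κ := by
    have := Matrix.square_of_invertible P Q hPQ hQP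
    simpa using this
  obtain ⟨F, v, l, k, rfl⟩ : ∃ F v l k,
      P = Matrix.fromBlocks F v l (k • (1 : Matrix Unit Unit K)) :=
    ⟨P.toBlocks₁₁, P.toBlocks₁₂, P.toBlocks₂₁, P (.inr ()) (.inr ()), by
      nth_rw 1 [← fromBlocks_toBlocks P]
      congr 1
      ext
      simp [toBlocks₂₂]⟩
  have hc1 : (Matrix.diagonal fun _ : Unit => c) = c • (1 : Matrix Unit Unit K) := by
    ext; simp
  rw [hc1, fromBlocks_transpose, fromBlocks_multiply, fromBlocks_multiply, fromBlocks_inj] at hP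
  obtain ⟨e11, e12, -, e22⟩ := hP
  simp only [Matrix.mul_zero, add_zero, zero_add, Matrix.mul_smul,
    Matrix.smul_mul, Matrix.mul_one, transpose_smul, transpose_one,
    smul_smul] at e11 e12 e22
  have e21 : v.transpose * A * F + (c * k) • l = 0 := by
    have := congrArg transpose e12
    simp only [transpose_add, transpose_mul, transpose_smul, transpose_transpose, transpose_zero,
      hA, ← Matrix.mul_assoc] at this
    rwa [mul_comm k c] at this
  obtain ⟨s, hs⟩ : ∃ s : K, s ^ 2 * (1 - k ^ 2) = 1 + 2 * s * k := by
    by_cases hk : k = 1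
    · exact ⟨-1 / 2, by subst hk; norm_num⟩
    · have : 1 - k ≠ 0 := sub_ne_zero.2 (Ne.symm hk)
      refine ⟨1 / (1 - k), ?_⟩
      field_simp
      ring
  have key : (F + s • (v * l)).transpose * A * (F + s • (v * l)) = B := by
    have h11 : F.transpose * A * F = B - c • (l.transpose * l) := by
      rw [← e11, add_sub_cancel_right]
    have h12 : F.transpose * A * v = -((k * c) • l.transpose) := eq_neg_of_add_eq_zero_left e12
    have h21 : v.transpose * A * F = -((c * k) • l) := eq_neg_of_add_eq_zero_left e21
    have h22 : v.transpose * A * v = (c - k * c * k) • (1 : Matrix Unit Unit K) := by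
      rw [sub_smul, ← e22]
      simp [mul_comm, mul_left_comm]
    calc (F + s • (v * l)).transpose * A * (F + s • (v * l))
        = F.transpose * A * F + s • (F.transpose * A * v * l)
          + s • (l.transpose * (v.transpose * A * F))
          + (s * s) • (l.transpose * (v.transpose * A * v) * l) := by
          simp only [transpose_add, transpose_smul, transpose_mul, Matrix.add_mul, Matrix.mul_add,
            Matrix.smul_mul, Matrix.mul_smul, smul_smul, Matrix.mul_assoc, smul_add]
          abel
      _ = B + (s ^ 2 * (1 - k ^ 2) - (1 + 2 * s * k)) • (c • (l.transpose * l)) := by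
          rw [h11, h12, h21, h22]
          simp only [Matrix.neg_mul, Matrix.mul_neg, Matrix.smul_mul, Matrix.mul_smul,
            Matrix.mul_one]
          module
      _ = B := by rw [hs, sub_self, zero_smul, add_zero]
  have hleft : (B⁻¹ * (F + s • (v * l)).transpose * A) * (F + s • (v * l)) = 1 := by
    rw [Matrix.mul_assoc, Matrix.mul_assoc, ← Matrix.mul_assoc _ A, key, nonsing_inv_mul _ hB]
  exact ⟨_, _, (Matrix.mul_eq_one_comm_of_card_eq ι κ K hcard).2 hleft, hleft, key⟩

theorem QuadraticMap.weightedSumSquares_eq_dotProduct {K ι : Type*} [CommRing K] [Fintype ι]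
    [DecidableEq ι] (a x : ι → K) :
    weightedSumSquares K a x = x ⬝ᵥ (Matrix.diagonal a).mulVec x := by
  simp only [weightedSumSquares_apply, dotProduct, Matrix.mulVec_diagonal, smul_eq_mul]
  exact Finset.sum_congr rfl fun i _ => by ring

theorem Matrix.dotProduct_transpose_mul_mul_mulVec {R ι κ : Type*} [CommRing R] [Fintype ι]
    [Fintype κ] (A : Matrix ι ι R) (P : Matrix ι κ R) (x y : κ → R) :
    x ⬝ᵥ (P.transpose * A * P).mulVec y = P.mulVec x ⬝ᵥ A.mulVec (P.mulVec y) := by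
  rw [← Matrix.mulVec_mulVec, ← Matrix.mulVec_mulVec, Matrix.dotProduct_mulVec x P.transpose,
    Matrix.vecMul_transpose]

theorem Matrix.IsCongr.equivalent_weightedSumSquares {K ι κ : Type*} [CommRing K]
    [Fintype ι] [Fintype κ] [DecidableEq ι] [DecidableEq κ] {a : ι → K} {b : κ → K}
    (h : (Matrix.diagonal a).IsCongr (Matrix.diagonal b)) :
    (QuadraticMap.weightedSumSquares K b).Equivalent (QuadraticMap.weightedSumSquares K a) := by
  obtain ⟨P, Q, hPQ, hQP, hP⟩ := h
  refine ⟨⟨Matrix.toLin'OfInv hQP hPQ, fun x => ?_⟩⟩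
  rw [QuadraticMap.weightedSumSquares_eq_dotProduct, QuadraticMap.weightedSumSquares_eq_dotProduct,
    ← hP, Matrix.dotProduct_transpose_mul_mul_mulVec]
  rfl

theorem Set.ncard_pos_eq_countP {K ι : Type*} [Zero K] [LinearOrder K] [Fintype ι]
    (a : ι → K) : {i | 0 < a i}.ncard = (Finset.univ.val.map a).countP (0 < ·) := by
  rw [Multiset.countP_map, Set.ncard_eq_toFinset_card']
  simp [Finset.card]

theorem Matrix.IsCongr.countP_pos_eq {K ι κ : Type*} [Field K] [LinearOrder K]
    [IsStrictOrderedRing K] [Fintype ι] [Fintype κ] [DecidableEq ι] [DecidableEq κ] {a : ι → K}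
    {b : κ → K} (h : (Matrix.diagonal a).IsCongr (Matrix.diagonal b)) :
    (Finset.univ.val.map a).countP (0 < ·) = (Finset.univ.val.map b).countP (0 < ·) := by
  rw [← Set.ncard_pos_eq_countP, ← Set.ncard_pos_eq_countP,
    ← QuadraticForm.sigPos_weightedSumSquares, ← QuadraticForm.sigPos_weightedSumSquares,
    h.equivalent_weightedSumSquares.sigPos_eq]

theorem Matrix.IsCongr.countP_neg_eq {K ι κ : Type*} [Field K] [LinearOrder K]
    [IsStrictOrderedRing K] [Fintype ι] [Fintype κ] [DecidableEq ι] [DecidableEq κ] {a : ι → K}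
    {b : κ → K} (h : (Matrix.diagonal a).IsCongr (Matrix.diagonal b)) :
    (Finset.univ.val.map a).countP (· < 0) = (Finset.univ.val.map b).countP (· < 0) := by
  have h' := h.smul (-1)
  rw [← Matrix.diagonal_smul, ← Matrix.diagonal_smul] at h'
  have := h'.countP_pos_eq
  rw [Multiset.countP_map, Multiset.countP_map] at this ⊢
  simpa using this

namespace Multiset.DiagIsometric

theorem countP_pos_eq {s t : Multiset ℚ} (h : s.DiagIsometric t) :
    s.countP (0 < ·) = t.countP (0 < ·) := by
  have := Matrix.IsCongr.countP_pos_eq h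
  rw [map_toList_get, map_toList_get, countP_filter, countP_filter] at this
  convert this using 2 <;> exact ⟨fun h => ⟨h, h.ne'⟩, And.left⟩

theorem countP_neg_eq {s t : Multiset ℚ} (h : s.DiagIsometric t) :
    s.countP (· < 0) = t.countP (· < 0) := by
  have := Matrix.IsCongr.countP_neg_eq h
  rw [map_toList_get, map_toList_get, countP_filter, countP_filter] at this
  convert this using 2 <;> exact ⟨fun h => ⟨h, h.ne⟩, And.left⟩

theorem cancel {s t : Multiset ℚ} {c : ℚ} (hc : c ≠ 0)
    (h : (s + {c}).DiagIsometric (t + {c})) : s.DiagIsometric t := by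
  have h1 : ({c} : Multiset ℚ).diagMatrix.IsCongr (Matrix.diagonal fun _ : Unit => c) :=
    diagMatrix_isCongr (fun _ => hc) (by simp)
  have h2 (u : Multiset ℚ) : (u + {c}).diagMatrix.IsCongr
      (Matrix.fromBlocks u.diagMatrix 0 0 (Matrix.diagonal fun _ : Unit => c)) :=
    (diagMatrix_add u {c}).trans ((Matrix.IsCongr.refl _).fromBlocks h1)
  refine Matrix.IsCongr.cancel (Matrix.diagonal_transpose _) ?_ (((h2 s).symm.trans h).trans (h2 t))
  rw [diagMatrix, Matrix.det_diagonal, isUnit_iff_ne_zero, Finset.prod_ne_zero_iff]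
  intro i _
  have := List.get_mem (filter (fun x => x ≠ 0) t).toList i
  rw [mem_toList, mem_filter] at this
  exact this.2

theorem cancel_hyp {s t : Multiset ℚ} {i : ℕ}
    (h : (s + i • RatWitt.hyp).DiagIsometric (t + i • RatWitt.hyp)) : s.DiagIsometric t := by
  induction i with
  | zero => simpa using h
  | succ i ih =>
    have e (u : Multiset ℚ) : u + (i + 1) • RatWitt.hyp = u + i • RatWitt.hyp + {-1} + {1} := by
      rw [succ_nsmul, add_assoc, add_assoc, add_comm {-1}, Multiset.singleton_add]
      rfl
    rw [e, e] at h
    exact ih ((h.cancel one_ne_zero).cancel (by norm_num))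

end Multiset.DiagIsometric

namespace RatWitt

/-- Classes of rational forms that contain a unimodular lattice. -/
def IsIntegral (x : RatWitt) : Prop :=
  ∃ (n : ℕ) (G : Matrix (Fin n) (Fin n) ℤ) (a : Fin n → ℚ), IsUnit G.det ∧ (∀ i, a i ≠ 0) ∧
    (G.map (Int.castRingHom ℚ)).IsCongr (Matrix.diagonal a) ∧ x = mk (Finset.univ.val.map a)

theorem IsIntegral.exists_isotropic_residue {p : ℕ} [hp : Fact p.Prime] {x : RatWitt}
    (hx : IsIntegral x) {s : Multiset ℤ} (hs : ∀ n ∈ s, IsSm p n) {k : ℕ} (hk : k ≠ 0)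
    (u : Fin k → ℤ) (hu : ∀ i, u i ≠ 0)
    (h : x = mk (s.map fun n : ℤ => (n : ℚ)) + ∑ i, cls ((p * u i : ℤ) : ℚ)) :
    ∃ z : Fin k → ℤ, (∃ i, ¬ (p : ℤ) ∣ z i) ∧ (p : ℤ) ∣ ∑ i, u i * z i ^ 2 := by
  classical
  obtain ⟨n, G, a, hG, ha, hGa, rfl⟩ := hx
  have hsum : ∑ i, cls ((p * u i : ℤ) : ℚ) =
      mk (Finset.univ.val.map fun i => ((p * u i : ℤ) : ℚ)) := by
    rw [mk_eq_sum, Multiset.map_map]; rfl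
  rw [hsum, ← map_add, mk_eq_mk] at h
  obtain ⟨i, j, h⟩ := h
  let H : Multiset ℤ := {1, -1}
  have hH (i : ℕ) : (i • H).map (fun n : ℤ => (n : ℚ)) = i • hyp := by
    rw [Multiset.map_nsmul]
    simp [H, hyp]
  have hHu : ∀ n ∈ H, n = 1 ∨ n = -1 := by simp [H]
  let e : Fin (i • H).toList.length → ℤ := (i • H).toList.get
  have he : ∀ l, e l = 1 ∨ e l = -1 := fun l =>
    hHu _ (Multiset.mem_of_mem_nsmul (Multiset.mem_toList.1 (List.get_mem _ l)))
  let t : Multiset ℤ := s + j • H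
  let f : Fin t.toList.length → ℤ := t.toList.get
  have hf : ∀ l, IsSm p (f l) := fun l => by
    have := Multiset.mem_toList.1 (List.get_mem t.toList l)
    rcases Multiset.mem_add.1 this with h | h
    · exact hs _ h
    · have h1 : IsSm p 1 := ⟨one_ne_zero, fun q hq h => by
        exact absurd (by exact_mod_cast h) hq.not_dvd_one⟩
      rcases hHu _ (Multiset.mem_of_mem_nsmul h) with h | h
      · exact (show f l = 1 from h) ▸ h1
      · exact (show f l = -1 from h) ▸ h1.neg
  have hcongr : ((Matrix.fromBlocks G 0 0 (Matrix.diagonal e)).map (Int.castRingHom ℚ)).IsCongr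
      (Matrix.diagonal fun l => ((Sum.elim (fun i => p * u i) f l : ℤ) : ℚ)) := by
    have e1 : ((Matrix.fromBlocks G 0 0 (Matrix.diagonal e)).map (Int.castRingHom ℚ)).IsCongr
        (Matrix.diagonal (Sum.elim a fun l => (e l : ℚ))) := by
      rw [Matrix.fromBlocks_map, ← Matrix.fromBlocks_diagonal]
      have := hGa.fromBlocks (Matrix.IsCongr.refl (Matrix.diagonal fun l => (e l : ℚ)))
      convert this using 2
      · ext; simp
      · ext; simp
      · rw [Matrix.diagonal_map (map_zero _)]
        rfl
    have e2 := Multiset.diagMatrix_isCongr (a := Sum.elim a fun l => (e l : ℚ))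
      (s := Finset.univ.val.map a + i • hyp)
      (by
        rintro (l | l)
        · exact ha l
        · rcases he l with h | h <;> simp [h])
      (by
        rw [← Finset.univ_disjSum_univ, Finset.val_disjSum, Multiset.disjSum, Multiset.map_add,
          Multiset.map_map, Multiset.map_map, ← hH]
        congr 1
        conv_rhs => rw [← Multiset.map_toList_get (i • H)]
        rw [Multiset.map_map]
        rfl)
    have e3 := Multiset.diagMatrix_isCongr
      (a := fun l => ((Sum.elim (fun i => p * u i) f l : ℤ) : ℚ))
      (s := s.map (fun n : ℤ => (n : ℚ)) +
        Finset.univ.val.map (fun i => ((p * u i : ℤ) : ℚ)) + j • hyp)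
      (by
        rintro (l | l)
        · have := hp.out.ne_zero
          simp [hu l, this]
        · simpa using (hf l).1)
      (by
        rw [← Finset.univ_disjSum_univ, Finset.val_disjSum, Multiset.disjSum, Multiset.map_add,
          Multiset.map_map, Multiset.map_map, ← hH, add_right_comm, ← Multiset.map_add, add_comm]
        congr 1
        conv_rhs => rw [← Multiset.map_toList_get (s + j • H)]
        rw [Multiset.map_map]
        rfl)
    exact (e1.trans e2.symm).trans (Matrix.IsCongr.trans h e3)
  have hdet : IsUnit (Matrix.fromBlocks G 0 0 (Matrix.diagonal e)).det := by
    rw [Matrix.det_fromBlocks_zero₂₁, Matrix.det_diagonal]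
    refine hG.mul ((IsUnit.prod_univ_iff).2 fun l => ?_)
    rcases he l with h | h <;> simp [h]
  obtain ⟨z, ⟨l, hl, hlz⟩, hz⟩ := _root_.exists_isotropic_residue p hdet (u := Sum.elim u 0) hcongr
    (Finset.univ.map ⟨Sum.inl, Sum.inl_injective⟩) (by
      have := Fin.pos_iff_nonempty.1 (Nat.pos_of_ne_zero hk)
      simp [Finset.univ_nonempty]) (by simp) (by
      rintro (l | l) hl
      · simp at hl
      · exact (hf l).not_dvd hp.out)
  refine ⟨fun i => z (.inl i), ?_, ?_⟩
  · obtain ⟨i, -, rfl⟩ := Finset.mem_map.1 hl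
    exact ⟨i, hlz⟩
  · simpa using hz

theorem IsIntegral.mem_Sm_of_mem_Sm_succ {p : ℕ} {x : RatWitt} (hx : IsIntegral x)
    (h : x ∈ Sm (p + 1)) (h2 : 2 ≤ p) : x ∈ Sm p := by
  by_cases hp : p.Prime
  swap
  · refine AddSubgroup.closure_mono ?_ h
    rintro _ ⟨n, hn, rfl⟩
    refine ⟨n, ⟨hn.1, fun q hq hqn => ?_⟩, rfl⟩
    have := hn.2 q hq hqn
    exact lt_of_le_of_ne (Nat.lt_succ_iff.1 this) (by rintro rfl; exact hp hq)
  have : Fact p.Prime := ⟨hp⟩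
  have hrep (k : ℕ) (hk : k ≠ 0) (u : Fin k → ZMod p) (hu : ∀ i, u i ≠ 0)
      (h : QuotientAddGroup.mk' (Sm p) x = ∑ i, resCls p (u i)) :
      ∃ z : Fin k → ZMod p, (∃ i, z i ≠ 0) ∧ ∑ i, u i * z i ^ 2 = 0 := by
    simp only [resCls] at h
    rw [← map_sum, QuotientAddGroup.mk'_eq_mk'] at h
    obtain ⟨y, hy, hxy⟩ := h
    obtain ⟨s, hs, hys⟩ := exists_multiset_of_mem_Sm ((Sm p).neg_mem hy)
    obtain ⟨z, ⟨i, hi⟩, hz⟩ := hx.exists_isotropic_residue hs hk (fun i => ((u i).val : ℤ))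
      (fun i => (isSm_val (hu i)).1) (by rw [← hys, ← hxy]; abel)
    refine ⟨fun i => z i, ⟨i, by rwa [Ne, ZMod.intCast_zmod_eq_zero_iff_dvd]⟩, ?_⟩
    rw [← ZMod.intCast_zmod_eq_zero_iff_dvd] at hz
    simpa using hz
  rw [← QuotientAddGroup.eq_zero_iff]
  change QuotientAddGroup.mk' (Sm p) x = 0
  rcases mk_eq_of_mem_Sm_succ h with h | ⟨u, hu, h⟩ | ⟨u, hu, v, hv, h⟩
  · exact h
  · obtain ⟨z, ⟨i, hi⟩, hz⟩ := hrep 1 one_ne_zero ![u] (by simpa using hu) (by simpa using h)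
    rw [Subsingleton.elim i 0] at hi
    simp [hu, hi] at hz
  · obtain ⟨z, hi, hz⟩ := hrep 2 two_ne_zero ![u, v] (by simp [Fin.forall_fin_two, hu, hv])
      (by simpa using h)
    rw [Fin.exists_fin_two] at hi
    simp only [Fin.sum_univ_two, Matrix.cons_val_zero, Matrix.cons_val_one] at hz
    have hz0 : z 0 ≠ 0 := fun h0 => by simp [h0, hv] at hz hi; exact hi hz
    have hz1 : z 1 ≠ 0 := fun h0 => by simp [h0, hu] at hz hi; exact hi hz
    rw [h, ← resCls_mul_sq u hz0, ← resCls_mul_sq v hz1, eq_neg_of_add_eq_zero_left hz, resCls_neg,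
      neg_add_cancel]

theorem exists_mem_Sm (x : RatWitt) : ∃ N, x ∈ Sm N := by
  obtain ⟨s, rfl⟩ := mk_surjective x
  induction s using Multiset.induction_on with
  | empty => exact ⟨0, by rw [map_zero]; exact zero_mem _⟩
  | cons a s ih =>
    obtain ⟨N, hN⟩ := ih
    rw [← Multiset.singleton_add, map_add]
    by_cases ha : a = 0
    · exact ⟨N, by rwa [ha, mk_zero_singleton, zero_add]⟩
    let n : ℤ := a.num * a.den
    have hn0 : n ≠ 0 := mul_ne_zero (Rat.num_ne_zero.2 ha) (by simp)
    have hn : IsSm (n.natAbs + 1) n := .of_abs_lt hn0 (by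
      rw [Int.abs_eq_natAbs]; push_cast; omega)
    have hcls : mk {a} = cls n := by
      have hd : (a.den : ℚ) ≠ 0 := by simp
      rw [show mk {a} = cls a from rfl, ← cls_mul_sq a hd]
      congr 1
      have := Rat.mul_den_eq_num a
      push_cast [n]
      rw [← this]
      ring
    refine ⟨max N (n.natAbs + 1), add_mem ?_ (Sm_mono (le_max_left _ _) hN)⟩
    rw [hcls]
    exact Sm_mono (le_max_right _ _) (cls_mem_Sm hn)

theorem IsIntegral.mem_Sm_two {x : RatWitt} (hx : IsIntegral x) : x ∈ Sm 2 := by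
  obtain ⟨N, hN⟩ := exists_mem_Sm x
  have key : ∀ k, x ∈ Sm (2 + k) → x ∈ Sm 2 := fun k => by
    induction k with
    | zero => exact id
    | succ k ih => exact fun h => ih (hx.mem_Sm_of_mem_Sm_succ h (by omega))
  exact key N (Sm_mono (by omega) hN)

theorem isSm_two {n : ℤ} (h : IsSm 2 n) : n = 1 ∨ n = -1 := by
  rw [← Int.natAbs_eq_natAbs_iff, Int.natAbs_one]
  by_contra hne
  obtain ⟨q, hq, hqn⟩ := Nat.exists_prime_and_dvd hne
  exact absurd (h.2 q hq (Int.natCast_dvd.2 hqn)) hq.two_le.not_gt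

end RatWitt

theorem Multiset.countP_singleton {α : Type*} (p : α → Prop) [DecidablePred p] (a : α) :
    ({a} : Multiset α).countP p = if p a then 1 else 0 := by
  rw [← Multiset.cons_zero, Multiset.countP_cons, Multiset.countP_zero, zero_add]

/-- An indefinite unimodular integral form represents zero nontrivially. -/
theorem exists_isotropic_of_isUnit_det {n : ℕ} {G : Matrix (Fin n) (Fin n) ℤ}
    (hsymm : G.transpose = G) (hG : IsUnit G.det) {x y : Fin n → ℤ} (hx : 0 < x ⬝ᵥ G.mulVec x)
    (hy : y ⬝ᵥ G.mulVec y < 0) : ∃ z ≠ 0, z ⬝ᵥ G.mulVec z = 0 := by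
  have : Invertible (2 : ℚ) := invertibleOfNonzero two_ne_zero
  have hsymm' : (G.map (Int.castRingHom ℚ)).transpose = G.map (Int.castRingHom ℚ) := by
    rw [← Matrix.transpose_map, hsymm]
  obtain ⟨a, hGa⟩ := Matrix.exists_isCongr_diagonal hsymm'
  have hcast (v : Fin n → ℤ) : ((v ⬝ᵥ G.mulVec v : ℤ) : ℚ) = (fun i => (v i : ℚ)) ⬝ᵥ
      (G.map (Int.castRingHom ℚ)).mulVec (fun i => (v i : ℚ)) := by
    simp [dotProduct, Matrix.mulVec]
  have hval (v : Fin n → ℤ) : ∃ w : Fin n → ℚ, ((v ⬝ᵥ G.mulVec v : ℤ) : ℚ) =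
      ∑ i, a i * w i ^ 2 := by
    obtain ⟨P, Q, hPQ, hQP, hP⟩ := hGa.symm
    refine ⟨P.mulVec fun i => (v i : ℚ), ?_⟩
    rw [hcast, ← hP, Matrix.dotProduct_transpose_mul_mul_mulVec,
      ← QuadraticMap.weightedSumSquares_eq_dotProduct, QuadraticMap.weightedSumSquares_apply]
    exact Finset.sum_congr rfl fun i _ => by rw [smul_eq_mul, sq]
  have hpos : ∃ i, 0 < a i := by
    obtain ⟨w, hw⟩ := hval x
    by_contra! hcon
    have : ∑ i, a i * w i ^ 2 ≤ 0 :=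
      Finset.sum_nonpos fun i _ => mul_nonpos_of_nonpos_of_nonneg (hcon i) (sq_nonneg _)
    rw [← hw] at this
    exact absurd hx (not_lt.2 (by exact_mod_cast this))
  have hneg : ∃ i, a i < 0 := by
    obtain ⟨w, hw⟩ := hval y
    by_contra! hcon
    have : 0 ≤ ∑ i, a i * w i ^ 2 :=
      Finset.sum_nonneg fun i _ => mul_nonneg (hcon i) (sq_nonneg _)
    rw [← hw] at this
    exact absurd hy (not_lt.2 (by exact_mod_cast this))
  have ha : ∀ i, a i ≠ 0 := by
    obtain ⟨P, Q, hPQ, hQP, hP⟩ := hGa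
    have hP' : IsUnit P.det := by
      rw [← Matrix.isUnit_iff_isUnit_det]
      exact ⟨⟨P, Q, hPQ, hQP⟩, rfl⟩
    have h1 := congrArg Matrix.det hP
    rw [Matrix.det_mul, Matrix.det_mul, Matrix.det_transpose, Matrix.det_diagonal,
      ← RingHom.mapMatrix_apply, ← RingHom.map_det] at h1
    have h2 := (hP'.mul (hG.map (Int.castRingHom ℚ))).mul hP'
    rw [h1, isUnit_iff_ne_zero, Finset.prod_ne_zero_iff] at h2
    exact fun i => h2 i (Finset.mem_univ i)
  obtain ⟨s, hs, hxs⟩ := RatWitt.exists_multiset_of_mem_Sm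
    (RatWitt.IsIntegral.mem_Sm_two ⟨n, G, a, hG, ha, hGa, rfl⟩)
  obtain ⟨i, j, h⟩ := RatWitt.mk_eq_mk.1 hxs
  obtain ⟨k, l, hkl⟩ : ∃ k l : ℕ, s.map (fun n : ℤ => (n : ℚ)) + j • RatWitt.hyp =
      k • {1} + l • {-1} := by
    have h1 : ∀ s : Multiset ℤ, (∀ n ∈ s, RatWitt.IsSm 2 n) →
        ∃ k l : ℕ, s.map (fun n : ℤ => (n : ℚ)) = k • {1} + l • {-1} := by
      intro s hs
      induction s using Multiset.induction_on with
      | empty => exact ⟨0, 0, by simp⟩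
      | cons b s ih =>
        obtain ⟨k, l, hkl⟩ := ih fun n hn => hs n (Multiset.mem_cons_of_mem hn)
        rcases RatWitt.isSm_two (hs b (Multiset.mem_cons_self b s)) with rfl | rfl
        · exact ⟨k + 1, l, by
            rw [Multiset.map_cons, hkl, ← Multiset.singleton_add, succ_nsmul]; push_cast; abel⟩
        · exact ⟨k, l + 1, by
            rw [Multiset.map_cons, hkl, ← Multiset.singleton_add, succ_nsmul]; push_cast; abel⟩
    obtain ⟨k, l, hkl⟩ := h1 s hs
    refine ⟨k + j, l + j, ?_⟩
    rw [hkl, show RatWitt.hyp = {1} + {-1} from rfl, nsmul_add, add_nsmul, add_nsmul,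
      add_add_add_comm]
  rw [hkl] at h
  have hk : i + 1 ≤ k := by
    have := h.countP_pos_eq
    rw [Multiset.countP_add, Multiset.countP_add, Multiset.countP_nsmul, Multiset.countP_nsmul,
      Multiset.countP_nsmul] at this
    have h1 : 0 < (Finset.univ.val.map a).countP (0 < ·) := by
      rw [Multiset.countP_pos]
      obtain ⟨i, hi⟩ := hpos
      exact ⟨a i, Multiset.mem_map_of_mem _ (Finset.mem_univ i), hi⟩
    rw [show RatWitt.hyp = {1} + {-1} from rfl] at this
    simp only [Multiset.countP_add, Multiset.countP_singleton] at this
    generalize Multiset.countP (0 < ·) (Finset.univ.val.map a) = c at this h1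
    norm_num at this
    omega
  have hl : i + 1 ≤ l := by
    have := h.countP_neg_eq
    rw [Multiset.countP_add, Multiset.countP_add, Multiset.countP_nsmul, Multiset.countP_nsmul,
      Multiset.countP_nsmul] at this
    have h1 : 0 < (Finset.univ.val.map a).countP (· < 0) := by
      rw [Multiset.countP_pos]
      obtain ⟨i, hi⟩ := hneg
      exact ⟨a i, Multiset.mem_map_of_mem _ (Finset.mem_univ i), hi⟩
    rw [show RatWitt.hyp = {1} + {-1} from rfl] at this
    simp only [Multiset.countP_add, Multiset.countP_singleton] at this
    generalize Multiset.countP (· < 0) (Finset.univ.val.map a) = c at this h1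
    norm_num at this
    omega
  obtain ⟨k, rfl⟩ := Nat.exists_eq_add_of_le hk
  obtain ⟨l, rfl⟩ := Nat.exists_eq_add_of_le hl
  have h' : (Finset.univ.val.map a).DiagIsometric (({1} + {-1}) + (k • {1} + l • {-1})) := by
    refine Multiset.DiagIsometric.cancel_hyp (i := i) ?_
    convert h using 1
    rw [show RatWitt.hyp = {1} + {-1} from rfl]
    simp only [add_nsmul, nsmul_add, one_nsmul]
    abel
  have hpair : (({1} + {-1} : Multiset ℚ)).diagMatrix.IsCongr (Matrix.diagonal ![(1 : ℚ), -1]) :=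
    Multiset.diagMatrix_isCongr (by simp [Fin.forall_fin_two]) (by simp [Fin.univ_val_map]; rfl)
  obtain ⟨P, Q, hPQ, hQP, hP⟩ :=
    ((hGa.trans (Multiset.diagMatrix_isCongr ha rfl).symm).trans h').trans
      ((Multiset.diagMatrix_add _ _).trans (hpair.fromBlocks (.refl _)))
  obtain ⟨v, hv0, hv⟩ : ∃ v : Fin n → ℚ, v ≠ 0 ∧
      v ⬝ᵥ (G.map (Int.castRingHom ℚ)).mulVec v = 0 := by
    refine ⟨P.mulVec (Sum.elim ![1, 1] 0), fun h0 => ?_, ?_⟩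
    · have := congrArg Q.mulVec h0
      rw [Matrix.mulVec_mulVec, hQP, Matrix.one_mulVec, Matrix.mulVec_zero] at this
      simpa using congrFun this (.inl 0)
    · rw [← Matrix.dotProduct_transpose_mul_mul_mulVec, hP, Matrix.fromBlocks_mulVec]
      simp [dotProduct]
  obtain ⟨b, hb⟩ := IsLocalization.exist_integer_multiples_of_finite (nonZeroDivisors ℤ) v
  choose z hz using hb
  have hb0 : ((b : ℤ) : ℚ) ≠ 0 := by exact_mod_cast nonZeroDivisors.coe_ne_zero b
  have hz' : (fun i => (z i : ℚ)) = ((b : ℤ) : ℚ) • v := by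
    ext i
    simpa [Algebra.smul_def] using hz i
  refine ⟨z, fun h0 => hv0 ?_, ?_⟩
  · rw [h0] at hz'
    refine (smul_eq_zero.1 (hz'.symm.trans ?_)).resolve_left hb0
    ext; simp
  · have := hcast z
    rw [hz', Matrix.mulVec_smul, smul_dotProduct, dotProduct_smul, hv, smul_zero, smul_zero] at this
    exact_mod_cast this

namespace Matrix

section CommRing

variable {R ι κ : Type*} [CommRing R] [Fintype ι] [Fintype κ] [DecidableEq ι] [DecidableEq κ]

theorem toBilin'_comm {A : Matrix ι ι R} (hA : A.transpose = A) (x y : ι → R) :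
    toBilin' A x y = toBilin' A y x := by
  rw [toBilin'_apply', toBilin'_apply', dotProduct_mulVec, ← mulVec_transpose, hA, dotProduct_comm]

theorem toBilin'_transpose_mul_mul (A : Matrix ι ι R) (P : Matrix ι κ R) (x y : κ → R) :
    toBilin' (P.transpose * A * P) x y = toBilin' A (P.mulVec x) (P.mulVec y) := by
  rw [toBilin'_apply', toBilin'_apply', dotProduct_transpose_mul_mul_mulVec]

theorem toBilin'_fromBlocks (A : Matrix ι ι R) (B : Matrix κ κ R) (x y : ι ⊕ κ → R) :
    toBilin' (fromBlocks A 0 0 B) x y =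
      toBilin' A (x ∘ Sum.inl) (y ∘ Sum.inl) + toBilin' B (x ∘ Sum.inr) (y ∘ Sum.inr) := by
  rw [toBilin'_apply', toBilin'_apply', toBilin'_apply', fromBlocks_mulVec]
  simp [dotProduct]

theorem IsCongr.transpose_eq {A : Matrix ι ι R} {B : Matrix κ κ R} (h : A.IsCongr B)
    (hA : A.transpose = A) : B.transpose = B := by
  obtain ⟨P, Q, -, -, rfl⟩ := h
  rw [transpose_mul, transpose_mul, transpose_transpose, hA, Matrix.mul_assoc]

theorem IsCongr.isUnit_det {A : Matrix ι ι R} {B : Matrix κ κ R} (h : A.IsCongr B)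
    (hA : IsUnit A.det) : IsUnit B.det := by
  obtain ⟨P, Q, hPQ, hQP, rfl⟩ := h
  refine isUnit_det_of_right_inverse (B := Q * A⁻¹ * Q.transpose) ?_
  calc P.transpose * A * P * (Q * A⁻¹ * Q.transpose)
      = P.transpose * (A * (P * Q) * A⁻¹) * Q.transpose := by simp only [Matrix.mul_assoc]
    _ = 1 := by
      rw [hPQ, Matrix.mul_one, mul_nonsing_inv _ hA, Matrix.mul_one, ← transpose_mul, hQP,
        transpose_one]

theorem IsCongr.of_card_eq [Nontrivial R] {A : Matrix ι ι R} {B : Matrix κ κ R}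
    (hcard : Fintype.card ι = Fintype.card κ) (hB : IsUnit B.det) {P : Matrix ι κ R}
    (h : P.transpose * A * P = B) : A.IsCongr B := by
  have hleft : (B⁻¹ * P.transpose * A) * P = 1 := by
    rw [Matrix.mul_assoc, Matrix.mul_assoc, ← Matrix.mul_assoc _ A, h, nonsing_inv_mul _ hB]
  exact ⟨_, _, (Matrix.mul_eq_one_comm_of_card_eq ι κ R hcard).2 hleft, hleft, h⟩

theorem IsCongr.card_eq [Nontrivial R] {A : Matrix ι ι R} {B : Matrix κ κ R} (h : A.IsCongr B) :
    Fintype.card ι = Fintype.card κ := by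
  obtain ⟨P, Q, hPQ, hQP, -⟩ := h
  exact square_of_invertible P Q hPQ hQP

theorem IsCongr.fromBlocks_assoc {μ : Type*} [Fintype μ] [DecidableEq μ] (A : Matrix ι ι R)
    (B : Matrix κ κ R) (C : Matrix μ μ R) :
    (Matrix.fromBlocks (Matrix.fromBlocks A 0 0 B) 0 0 C).IsCongr
      (Matrix.fromBlocks A 0 0 (Matrix.fromBlocks B 0 0 C)) := by
  convert IsCongr.submatrix _ (Equiv.sumAssoc ι κ μ).symm using 1
  ext (i | i | i) (j | j | j) <;> rfl

theorem IsCongr.fromBlocks_comm (A : Matrix ι ι R) (B : Matrix κ κ R) :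
    (Matrix.fromBlocks A 0 0 B).IsCongr (Matrix.fromBlocks B 0 0 A) := by
  convert IsCongr.submatrix _ (Equiv.sumComm κ ι) using 1
  ext (i | i) (j | j) <;> rfl

/-- A family of vectors with invertible Gram matrix splits off an orthogonal summand. -/
theorem exists_isCongr_fromBlocks [IsDomain R] [IsPrincipalIdealRing R] {A : Matrix ι ι R}
    (hA : A.transpose = A) {C : Matrix κ κ R} (hC : IsUnit C.det) (W : Matrix ι κ R)
    (hW : W.transpose * A * W = C) :
    ∃ (m : ℕ) (A' : Matrix (Fin m) (Fin m) R), A.IsCongr (fromBlocks C 0 0 A') := by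
  let N := LinearMap.ker (W.transpose * A).mulVecLin
  have hN : ∀ x, x ∈ N ↔ (W.transpose * A).mulVec x = 0 := fun x => Iff.rfl
  let b := Module.finBasis R N
  let e : ((κ → R) × N) ≃ₗ[R] (ι → R) :=
    { toFun z := W.mulVec z.1 + z.2
      map_add' x y := by
        simp only [Prod.fst_add, Prod.snd_add, mulVec_add, Submodule.coe_add]
        abel
      map_smul' c x := by
        simp only [Prod.smul_fst, Prod.smul_snd, mulVec_smul, Submodule.coe_smul, smul_add,
          RingHom.id_apply]
      invFun y := (C⁻¹.mulVec ((W.transpose * A).mulVec y),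
        ⟨y - W.mulVec (C⁻¹.mulVec ((W.transpose * A).mulVec y)), by
          rw [hN, mulVec_sub, mulVec_mulVec, hW, mulVec_mulVec _ C, mul_nonsing_inv _ hC,
            one_mulVec, sub_self]⟩)
      left_inv := by
        rintro ⟨c, x, hx⟩
        have : C⁻¹.mulVec ((W.transpose * A).mulVec (W.mulVec c + x)) = c := by
          rw [mulVec_add, (hN x).1 hx, add_zero, mulVec_mulVec c (W.transpose * A), hW,
            mulVec_mulVec, nonsing_inv_mul _ hC, one_mulVec]
        simp [this]
      right_inv y := by simp }
  let w := ((Pi.basisFun R κ).prod b).map e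
  refine ⟨_, of fun i j => toBilin' A (b i).1 (b j).1, (Pi.basisFun R ι).toMatrix w,
    w.toMatrix (Pi.basisFun R ι), Module.Basis.toMatrix_mul_toMatrix_flip _ _,
    Module.Basis.toMatrix_mul_toMatrix_flip _ _, ?_⟩
  have hw1 : ∀ i, w (.inl i) = W.mulVec (Pi.single i 1) := fun i => by simp [w, e]
  have hw2 : ∀ i, w (.inr i) = b i := fun i => by simp [w, e]
  have h1 : ∀ i j, (((Pi.basisFun R ι).toMatrix w).transpose * A *
      (Pi.basisFun R ι).toMatrix w) i j = toBilin' A (w i) (w j) := by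
    intro i j
    rw [toBilin'_apply', Matrix.mul_assoc]
    rfl
  have h2 : ∀ i j, toBilin' A (w (.inl i)) (w (.inr j)) = 0 := fun i j => by
    have := (hN _).1 (b j).2
    rw [hw1, hw2, toBilin'_apply', ← vecMul_transpose, ← dotProduct_mulVec, mulVec_mulVec, this,
      dotProduct_zero]
  ext (i | i) (j | j)
  · rw [h1, hw1, hw1, ← toBilin'_transpose_mul_mul, hW, toBilin'_single, fromBlocks_apply₁₁]
  · rw [h1, h2]; rfl
  · rw [h1, toBilin'_comm hA, h2]; rfl
  · rw [h1, hw2, hw2]; rfl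

end CommRing

/-- A symmetric unimodular integral matrix whose quadratic form is indefinite. -/
structure IsIndefUnimodular {ι : Type*} [Fintype ι] [DecidableEq ι] (A : Matrix ι ι ℤ) :
    Prop where
  symm : A.transpose = A
  isUnit_det : IsUnit A.det
  exists_pos : ∃ x, 0 < toBilin' A x x
  exists_neg : ∃ x, toBilin' A x x < 0

variable {ι κ : Type*} [Fintype ι] [Fintype κ] [DecidableEq ι] [DecidableEq κ]

theorem IsIndefUnimodular.of_isCongr {A : Matrix ι ι ℤ} {B : Matrix κ κ ℤ}
    (hA : A.IsIndefUnimodular) (h : A.IsCongr B) : B.IsIndefUnimodular := by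
  refine ⟨h.transpose_eq hA.symm, h.isUnit_det hA.isUnit_det, ?_, ?_⟩
  · obtain ⟨P, Q, -, -, rfl⟩ := h.symm
    obtain ⟨x, hx⟩ := hA.exists_pos
    exact ⟨_, by rwa [toBilin'_transpose_mul_mul] at hx⟩
  · obtain ⟨P, Q, -, -, rfl⟩ := h.symm
    obtain ⟨x, hx⟩ := hA.exists_neg
    exact ⟨_, by rwa [toBilin'_transpose_mul_mul] at hx⟩

theorem IsIndefUnimodular.exists_isotropic {A : Matrix ι ι ℤ} (hA : A.IsIndefUnimodular) :
    ∃ z ≠ 0, toBilin' A z z = 0 := by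
  have h := IsCongr.submatrix A (Fintype.equivFin ι).symm
  have hA' := hA.of_isCongr h
  obtain ⟨x, hx⟩ := hA'.exists_pos
  obtain ⟨y, hy⟩ := hA'.exists_neg
  rw [toBilin'_apply'] at hx hy
  obtain ⟨z, hz, hz0⟩ := exists_isotropic_of_isUnit_det hA'.symm hA'.isUnit_det hx hy
  obtain ⟨P, Q, hPQ, hQP, hP⟩ := h
  rw [← hP, ← toBilin'_apply', toBilin'_transpose_mul_mul] at hz0
  refine ⟨_, fun h0 => hz ?_, hz0⟩
  rw [← one_mulVec z, ← hQP, ← mulVec_mulVec, h0, mulVec_zero]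

theorem IsIndefUnimodular.exists_pair {A : Matrix ι ι ℤ} (hA : A.IsIndefUnimodular) :
    ∃ e f, toBilin' A e e = 0 ∧ toBilin' A e f = 1 := by
  obtain ⟨z, hz, hz0⟩ := hA.exists_isotropic
  let I : Ideal ℤ := Ideal.span (Set.range z)
  obtain ⟨g, hg⟩ := (IsPrincipalIdealRing.principal I).principal
  have hI : ∀ i, z i ∈ I := fun i => Ideal.subset_span ⟨i, rfl⟩
  have hdvd : ∀ i, g ∣ z i := fun i => by
    have h := hI i
    rw [hg] at h
    exact Ideal.mem_span_singleton.1 h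
  choose e he using hdvd
  have hgI : g ∈ I := by
    rw [hg]
    exact Ideal.mem_span_singleton_self g
  obtain ⟨c, hc⟩ := Ideal.mem_span_range_iff_exists_fun.1 hgI
  have hze : z = g • e := funext he
  have hg0 : g ≠ 0 := by
    rintro rfl
    exact hz (by rw [hze, zero_smul])
  have hce : c ⬝ᵥ e = 1 := by
    refine mul_left_cancel₀ hg0 ?_
    rw [mul_one, dotProduct, Finset.mul_sum]
    exact (Finset.sum_congr rfl fun i _ => by rw [he i]; ring).trans hc
  refine ⟨e, A⁻¹.mulVec c, ?_, ?_⟩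
  · rw [hze] at hz0
    rw [map_smul, map_smul, LinearMap.smul_apply, smul_eq_mul, smul_eq_mul] at hz0
    exact (mul_eq_zero.1 ((mul_eq_zero.1 hz0).resolve_left hg0)).resolve_left hg0
  · rw [toBilin'_apply', mulVec_mulVec, mul_nonsing_inv _ hA.isUnit_det, one_mulVec,
      dotProduct_comm, hce]

end Matrix

namespace Matrix

theorem of_mul_mul_transpose_apply {R ι κ : Type*} [CommRing R] [Fintype ι] [DecidableEq ι]
    (A : Matrix ι ι R) (w : κ → ι → R) (i j : κ) :
    ((of w).transpose.transpose * A * (of w).transpose) i j = toBilin' A (w i) (w j) := by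
  rw [toBilin'_apply', Matrix.mul_assoc]
  rfl

theorem transpose_eq_of_fromBlocks {R ι κ : Type*} [Zero R] {A : Matrix ι ι R} {B : Matrix κ κ R}
    (h : (fromBlocks A 0 0 B).transpose = fromBlocks A 0 0 B) : B.transpose = B := by
  rw [fromBlocks_transpose, fromBlocks_inj] at h
  exact h.2.2.2

theorem isUnit_det_of_fromBlocks {R ι κ : Type*} [CommRing R] [Fintype ι] [Fintype κ]
    [DecidableEq ι] [DecidableEq κ] {A : Matrix ι ι R} {B : Matrix κ κ R}
    (h : IsUnit (fromBlocks A 0 0 B).det) : IsUnit B.det := by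
  rw [det_fromBlocks_zero₂₁] at h
  exact isUnit_of_mul_isUnit_right h

theorem exists_toBilin'_ne_zero {ι : Type*} [Fintype ι] [DecidableEq ι] [Nonempty ι]
    {A : Matrix ι ι ℤ} (hA : A.transpose = A) (hdet : IsUnit A.det) :
    ∃ x, toBilin' A x x ≠ 0 := by
  by_contra! h
  refine hdet.ne_zero ?_
  have : A = 0 := by
    ext i j
    have h1 := h (Pi.single i 1 + Pi.single j 1)
    simp only [map_add, LinearMap.add_apply, h] at h1
    rw [toBilin'_comm hA (Pi.single j 1), toBilin'_single] at h1
    rw [zero_apply]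
    lia
  rw [this, det_zero]

namespace IsIndefUnimodular

variable {ι : Type*} [Fintype ι] [DecidableEq ι] {A : Matrix ι ι ℤ}

theorem exists_pair_of_odd (hA : A.IsIndefUnimodular) (hodd : ∃ x, Odd (toBilin' A x x)) :
    ∃ e f, toBilin' A e e = 0 ∧ toBilin' A e f = 1 ∧ toBilin' A f f = 1 := by
  obtain ⟨e, f, he, hef, k, hk⟩ :
      ∃ e f, toBilin' A e e = 0 ∧ toBilin' A e f = 1 ∧ Odd (toBilin' A f f) := by
    obtain ⟨e, f, he, hef⟩ := hA.exists_pair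
    rcases Int.even_or_odd (toBilin' A f f) with hf | hf
    · obtain ⟨t, ht⟩ := hodd
      refine ⟨e, t + (1 - toBilin' A e t) • f, he, ?_, ?_⟩
      · rw [map_add, map_smul, hef, smul_eq_mul]
        ring
      · simp only [map_add, map_smul, LinearMap.add_apply, LinearMap.smul_apply, smul_eq_mul,
          toBilin'_comm hA.symm f t]
        obtain ⟨i, hi⟩ := hf
        obtain ⟨j, hj⟩ := ht
        rw [hi, hj]
        exact ⟨j + (1 - toBilin' A e t) * toBilin' A t f + (1 - toBilin' A e t) ^ 2 * i, by ring⟩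
    · exact ⟨e, f, he, hef, hf⟩
  refine ⟨e, f - k • e, he, ?_, ?_⟩
  · rw [map_sub, map_smul, he, hef, smul_zero, sub_zero]
  · simp only [map_sub, map_smul, LinearMap.sub_apply, LinearMap.smul_apply, smul_eq_mul,
      toBilin'_comm hA.symm f e, he, hef, hk]
    ring

theorem exists_isCongr_one_neg_one (hA : A.IsIndefUnimodular)
    (hodd : ∃ x, Odd (toBilin' A x x)) :
    ∃ (m : ℕ) (A' : Matrix (Fin m) (Fin m) ℤ), A.IsCongr
      (fromBlocks (fromBlocks (diagonal fun _ : Unit => (1 : ℤ)) 0 0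
        (diagonal fun _ : Unit => -1)) 0 0 A') := by
  obtain ⟨e, f, he, hef, hf⟩ := hA.exists_pair_of_odd hodd
  refine exists_isCongr_fromBlocks hA.symm ?_
    (of (Sum.elim (fun _ : Unit => f) (fun _ : Unit => f - e))).transpose ?_
  · simp [det_fromBlocks_zero₂₁]
  · ext (i | i) (j | j) <;> rw [of_mul_mul_transpose_apply] <;>
      simp [he, hef, hf, toBilin'_comm hA.symm f e]

end IsIndefUnimodular

theorem isIndefUnimodular_fromBlocks_diagonal {κ : Type*} [Fintype κ] [DecidableEq κ]
    {B : Matrix κ κ ℤ} {c : ℤ} (hc : IsUnit c) (hB : B.transpose = B) (hdet : IsUnit B.det)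
    {x : κ → ℤ} (hx : toBilin' B x x * c < 0) :
    (fromBlocks (diagonal fun _ : Unit => c) 0 0 B).IsIndefUnimodular := by
  have h1 : ∀ (u : Unit → ℤ) (y : κ → ℤ), toBilin' (fromBlocks (diagonal fun _ : Unit => c) 0 0 B)
      (Sum.elim u y) (Sum.elim u y) = u () * u () * c + toBilin' B y y := fun u y => by
    rw [toBilin'_fromBlocks, toBilin'_apply']
    simp [mulVec_diagonal, dotProduct]
    ring
  have hl := h1 1 0
  have hr := h1 0 x
  simp only [Pi.one_apply, one_mul, map_zero, add_zero, Pi.zero_apply, zero_mul, zero_add] at hl hr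
  refine ⟨by simp [fromBlocks_transpose, hB], ?_, ?_, ?_⟩
  · rw [det_fromBlocks_zero₂₁]
    simpa using hc.mul hdet
  all_goals
    rcases Int.isUnit_iff.1 hc with rfl | rfl
  · exact ⟨_, one_pos.trans_eq hl.symm⟩
  · exact ⟨_, lt_of_lt_of_eq (by lia) hr.symm⟩
  · exact ⟨_, lt_of_eq_of_lt hr (by lia)⟩
  · exact ⟨_, hl.trans_lt (by simp)⟩

/-- An odd indefinite unimodular form over `ℤ` is diagonalizable. -/
theorem IsIndefUnimodular.exists_isCongr_diagonal_of_odd {ι : Type} [Fintype ι] [DecidableEq ι]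
    {A : Matrix ι ι ℤ} (hA : A.IsIndefUnimodular) (hodd : ∃ x, Odd (toBilin' A x x)) :
    ∃ a : ι → ℤ, (∀ i, IsUnit (a i)) ∧ A.IsCongr (diagonal a) := by
  obtain ⟨n, hn⟩ : ∃ n, Fintype.card ι = n := ⟨_, rfl⟩
  induction n using Nat.strong_induction_on generalizing ι with
  | _ n ih =>
  suffices h : ∃ (κ : Type) (_ : Fintype κ) (_ : DecidableEq κ) (a : κ → ℤ),
      (∀ i, IsUnit (a i)) ∧ A.IsCongr (diagonal a) by
    obtain ⟨κ, _, _, a, ha, h⟩ := h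
    let e := Fintype.equivOfCardEq h.card_eq
    refine ⟨a ∘ e, fun i => ha _, ?_⟩
    rw [← submatrix_diagonal_equiv]
    exact h.trans (.submatrix _ e)
  have key : ∀ {m : ℕ} {A' : Matrix (Fin m) (Fin m) ℤ} {c : ℤ}, IsUnit c →
      A.IsCongr (fromBlocks (diagonal fun _ : Unit => -c) 0 0
        (fromBlocks (diagonal fun _ : Unit => c) 0 0 A')) →
      (∃ x, toBilin' A' x x * c < 0) → ∃ (κ : Type) (_ : Fintype κ) (_ : DecidableEq κ) (a : κ → ℤ),
      (∀ i, IsUnit (a i)) ∧ A.IsCongr (diagonal a) := by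
    rintro m A' c hc h ⟨x, hx⟩
    have hB := isIndefUnimodular_fromBlocks_diagonal hc
      (transpose_eq_of_fromBlocks (transpose_eq_of_fromBlocks (h.transpose_eq hA.symm)))
      (isUnit_det_of_fromBlocks (isUnit_det_of_fromBlocks (h.isUnit_det hA.isUnit_det))) hx
    have hcard := h.card_eq
    rw [Fintype.card_sum, Fintype.card_unit] at hcard
    obtain ⟨a, ha, h'⟩ := ih _ (by lia) hB ⟨Pi.single (.inl ()) 1, by
      rw [toBilin'_single]
      rcases Int.isUnit_iff.1 hc with rfl | rfl <;> simp⟩ rfl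
    refine ⟨_, inferInstance, inferInstance, Sum.elim (fun _ : Unit => -c) a, ?_, h.trans ?_⟩
    · rintro (i | i)
      exacts [hc.neg, ha i]
    · rw [← fromBlocks_diagonal]
      exact (IsCongr.refl _).fromBlocks h'
  obtain ⟨m, A', h⟩ := hA.exists_isCongr_one_neg_one hodd
  rcases m.eq_zero_or_pos with rfl | hm
  · refine ⟨_, inferInstance, inferInstance,
      Sum.elim (Sum.elim (fun _ : Unit => 1) (fun _ : Unit => -1)) (0 : Fin 0 → ℤ),
      ?_, ?_⟩
    · rintro ((i | i) | i)
      · simp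
      · simp
      · exact i.elim0
    · rw [← fromBlocks_diagonal, ← fromBlocks_diagonal]
      rwa [Subsingleton.elim A' (diagonal 0)] at h
  · have : Nonempty (Fin m) := ⟨⟨0, hm⟩⟩
    obtain ⟨x, hx⟩ := exists_toBilin'_ne_zero
      (transpose_eq_of_fromBlocks (h.transpose_eq hA.symm))
      (isUnit_det_of_fromBlocks (h.isUnit_det hA.isUnit_det))
    rcases hx.lt_or_gt with hx | hx
    · refine key isUnit_one ((h.trans ((IsCongr.fromBlocks_comm _ _).fromBlocks (.refl _))).trans
        (.fromBlocks_assoc _ _ _)) ⟨x, by lia⟩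
    · refine key (A' := A') isUnit_one.neg ?_ ⟨x, by lia⟩
      rw [neg_neg]
      exact h.trans (.fromBlocks_assoc _ _ _)

end Matrix

namespace Matrix

/-- The orthogonal sum of `⟨1⟩ ⊕ ⟨-1⟩` and `F`. -/
def diagonalPlaneSum {κ : Type*} (F : Matrix κ κ ℤ) : Matrix (Fin 2 ⊕ κ) (Fin 2 ⊕ κ) ℤ :=
  fromBlocks (diagonal ![1, -1]) 0 0 F

/-- The orthogonal sum of a hyperbolic plane and `F`. -/
def hyperbolicPlaneSum {κ : Type*} (F : Matrix κ κ ℤ) : Matrix (Fin 2 ⊕ κ) (Fin 2 ⊕ κ) ℤ :=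
  fromBlocks !![0, 1; 1, 0] 0 0 F

section

variable {ι κ : Type*} [Fintype ι] [Fintype κ] [DecidableEq ι] [DecidableEq κ]

theorem even_toBilin'_self {A : Matrix ι ι ℤ} (hA : A.transpose = A) (h : ∀ i, Even (A i i))
    (x : ι → ℤ) : Even (toBilin' A x x) := by
  rw [← Finset.univ_sum_single x]
  refine Finset.sum_induction _ (fun y => Even (toBilin' A y y)) (fun y z hy hz => ?_) (by simp)
    fun i _ => ?_
  · simp only [map_add, LinearMap.add_apply, toBilin'_comm hA z y]
    obtain ⟨a, ha⟩ := hy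
    obtain ⟨b, hb⟩ := hz
    exact ⟨a + b + toBilin' A y z, by rw [ha, hb]; ring⟩
  · rw [toBilin'_apply']
    simpa using ((h i).mul_left (x i)).mul_left (x i)

theorem exists_eq_two_smul {A : Matrix ι ι ℤ} (hA : IsUnit A.det) {v : ι → ℤ}
    (hv : ∀ y, 2 ∣ toBilin' A y v) : ∃ k : ι → ℤ, v = (2 : ℤ) • k := by
  have h : ∀ i, 2 ∣ A.mulVec v i := fun i => by
    simpa [toBilin'_apply'] using hv (Pi.single i 1)
  choose c hc using h
  refine ⟨A⁻¹.mulVec c, ?_⟩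
  rw [← mulVec_smul, ← (funext hc : A.mulVec v = (2 : ℤ) • c), mulVec_mulVec,
    nonsing_inv_mul _ hA, one_mulVec]

theorem IsIndefUnimodular.exists_isCongr_of_even {A : Matrix ι ι ℤ} (hA : A.IsIndefUnimodular)
    (heven : ∀ x, Even (toBilin' A x x)) :
    ∃ (m : ℕ) (A' : Matrix (Fin m) (Fin m) ℤ),
      A.IsCongr (hyperbolicPlaneSum A') := by
  obtain ⟨e, f, he, hef⟩ := hA.exists_pair
  obtain ⟨k, hk⟩ := heven f
  refine exists_isCongr_fromBlocks hA.symm (by simp) (of ![e, f - k • e]).transpose ?_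
  have h1 : toBilin' A e (f - k • e) = 1 := by
    rw [map_sub, map_smul, he, hef, smul_zero, sub_zero]
  have h2 : toBilin' A (f - k • e) (f - k • e) = 0 := by
    simp only [map_sub, map_smul, LinearMap.sub_apply, LinearMap.smul_apply, smul_eq_mul,
      toBilin'_comm hA.symm f e, he, hef, hk]
    ring
  generalize f - k • e = g at h1 h2 ⊢
  ext i j
  rw [of_mul_mul_transpose_apply]
  fin_cases i <;> fin_cases j <;> simp [he, h1, h2, toBilin'_comm hA.symm _ e]

/-- The inclusion of the lattice `{(a, b, x) | 4 ∣ a - b, 2 ∣ x}` into `ℤ² ⊕ ℤ^κ`, under which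
the form `⟨1⟩ ⊕ ⟨-1⟩ ⊕ F` pulls back to four times the sum of a hyperbolic plane and `F`. -/
def hyperbolicInclusion (κ : Type*) [DecidableEq κ] : Matrix (Fin 2 ⊕ κ) (Fin 2 ⊕ κ) ℤ :=
  fromBlocks !![1, 2; 1, -2] 0 0 (diagonal fun _ => 2)

theorem hyperbolicInclusion_congr (F : Matrix κ κ ℤ) :
    (hyperbolicInclusion κ).transpose * diagonalPlaneSum F *
      hyperbolicInclusion κ = (4 : ℤ) • hyperbolicPlaneSum F := by
  have h1 : !![1, 2; 1, -2].transpose * diagonal ![1, -1] * !![1, 2; 1, -2] =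
      (4 : ℤ) • !![0, 1; 1, 0] := by decide
  have h2 : (diagonal fun _ : κ => (2 : ℤ)).transpose * F * (diagonal fun _ => 2) =
      (4 : ℤ) • F := by
    ext i j
    simp
    ring
  rw [hyperbolicInclusion, diagonalPlaneSum, hyperbolicPlaneSum, fromBlocks_transpose,
    fromBlocks_multiply, fromBlocks_multiply, fromBlocks_smul]
  simp only [transpose_zero, Matrix.mul_zero, Matrix.zero_mul, add_zero, zero_add, smul_zero, h1,
    h2]

theorem exists_hyperbolicInclusion_mulVec {y : Fin 2 ⊕ κ → ℤ}
    (h4 : 4 ∣ y (.inl 0) - y (.inl 1)) (h2 : ∀ j, 2 ∣ y (.inr j)) :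
    ∃ z, (hyperbolicInclusion κ).mulVec z = y := by
  obtain ⟨b, hb⟩ := h4
  choose x hx using h2
  refine ⟨Sum.elim ![y (.inl 1) + 2 * b, b] x, ?_⟩
  rw [hyperbolicInclusion, fromBlocks_mulVec]
  ext (i | j)
  · fin_cases i
    · simp
      lia
    · simp
      lia
  · simp [hx]

theorem toBilin'_diagonalPlaneSum (F : Matrix κ κ ℤ) (y z : Fin 2 ⊕ κ → ℤ) :
    toBilin' (diagonalPlaneSum F) y z =
      y (.inl 0) * z (.inl 0) - y (.inl 1) * z (.inl 1) +
        toBilin' F (y ∘ Sum.inr) (z ∘ Sum.inr) := by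
  rw [diagonalPlaneSum, toBilin'_fromBlocks, toBilin'_apply' (diagonal _)]
  simp [mulVec_diagonal, dotProduct, Fin.sum_univ_two, sub_eq_add_neg]

theorem two_dvd_toBilin'_diagonalPlaneSum {F : Matrix κ κ ℤ}
    (hF : ∀ x, Even (toBilin' F x x)) (y : Fin 2 ⊕ κ → ℤ) :
    2 ∣ toBilin' (diagonalPlaneSum F) y y -
      (y (.inl 0) - y (.inl 1)) := by
  obtain ⟨c, hc⟩ := hF (y ∘ Sum.inr)
  obtain ⟨d, hd⟩ := Int.even_mul_pred_self (y (.inl 0))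
  obtain ⟨d', hd'⟩ := Int.even_mul_pred_self (y (.inl 1))
  rw [toBilin'_diagonalPlaneSum, hc]
  exact ⟨c + d - d', by linear_combination hd - hd'⟩

/-- A congruence between the odd forms attached to `F₁` and `F₂` can be chosen to respect the
sublattices of `hyperbolicInclusion`. -/
theorem IsCongr.exists_four_dvd {F₁ : Matrix ι ι ℤ} {F₂ : Matrix κ κ ℤ}
    (hdet : IsUnit F₁.det)
    (he₁ : ∀ x, Even (toBilin' F₁ x x)) (he₂ : ∀ x, Even (toBilin' F₂ x x))
    (h : (diagonalPlaneSum F₁).IsCongr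
      (diagonalPlaneSum F₂)) :
    ∃ P : Matrix (Fin 2 ⊕ ι) (Fin 2 ⊕ κ) ℤ,
      P.transpose * diagonalPlaneSum F₁ * P =
        diagonalPlaneSum F₂ ∧
      4 ∣ P.mulVec (Sum.elim (1 : Fin 2 → ℤ) 0) (.inl 0) -
        P.mulVec (Sum.elim (1 : Fin 2 → ℤ) 0) (.inl 1) ∧
      ∀ j, 2 ∣ P.mulVec (Sum.elim (1 : Fin 2 → ℤ) 0) (.inr j) := by
  obtain ⟨P, Q, hPQ, -, hP⟩ := h
  have hchar : ∀ y, 2 ∣ toBilin' (diagonalPlaneSum F₁) y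
      (P.mulVec (Sum.elim (1 : Fin 2 → ℤ) 0) - Sum.elim (1 : Fin 2 → ℤ) 0) := by
    intro y
    have h1 := two_dvd_toBilin'_diagonalPlaneSum he₁ y
    have h2 := two_dvd_toBilin'_diagonalPlaneSum he₂ (Q.mulVec y)
    have hy : P.mulVec (Q.mulVec y) = y := by rw [mulVec_mulVec, hPQ, one_mulVec]
    have h3 := toBilin'_diagonalPlaneSum F₂ (Q.mulVec y) (Sum.elim (1 : Fin 2 → ℤ) 0)
    have h4 := toBilin'_diagonalPlaneSum F₁ y (Sum.elim (1 : Fin 2 → ℤ) 0)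
    rw [← hP, toBilin'_transpose_mul_mul, hy] at h2 h3
    simp only [Sum.elim_inl, Pi.one_apply, mul_one, Sum.elim_comp_inr, map_zero, add_zero] at h3 h4
    rw [map_sub, h3, h4]
    lia
  obtain ⟨k, hk⟩ := exists_eq_two_smul (by
    rw [diagonalPlaneSum, det_fromBlocks_zero₂₁, det_diagonal, Fin.prod_univ_two]
    simpa using hdet) hchar
  have hu : ∀ i, P.mulVec (Sum.elim (1 : Fin 2 → ℤ) 0) i =
      Sum.elim (1 : Fin 2 → ℤ) 0 i + 2 * k i := fun i => by
    simpa [sub_eq_iff_eq_add'] using congrFun hk i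
  rcases Int.even_or_odd (k (.inl 0) - k (.inl 1)) with hk' | hk'
  · refine ⟨P, hP, ?_, fun j => ?_⟩
    · rw [hu, hu]
      obtain ⟨c, hc⟩ := hk'
      simp only [Sum.elim_inl, Pi.one_apply]
      lia
    · rw [hu]
      simp
  · let N : Matrix (Fin 2 ⊕ ι) (Fin 2 ⊕ ι) ℤ :=
      Matrix.fromBlocks (Matrix.diagonal ![1, -1]) 0 0 1
    have hN : N.transpose * diagonalPlaneSum F₁ * N = diagonalPlaneSum F₁ := by
      have : (Matrix.diagonal ![1, -1]).transpose * Matrix.diagonal ![1, -1] *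
        Matrix.diagonal ![1, -1] = (Matrix.diagonal ![1, -1] : Matrix _ _ ℤ) := by decide
      simp only [N]
      rw [diagonalPlaneSum, fromBlocks_transpose, fromBlocks_multiply, fromBlocks_multiply]
      simp only [transpose_zero, transpose_one, Matrix.mul_zero, Matrix.zero_mul, Matrix.mul_one,
        Matrix.one_mul, add_zero, zero_add, this]
    refine ⟨N * P, ?_, ?_, fun j => ?_⟩
    · calc _ = P.transpose * (N.transpose * diagonalPlaneSum F₁ * N) * P := by
            rw [transpose_mul]
            simp only [Matrix.mul_assoc]
        _ = _ := by rw [hN, hP]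
    · rw [← mulVec_mulVec, fromBlocks_mulVec]
      obtain ⟨c, hc⟩ := hk'
      simp [hu]
      lia
    · rw [← mulVec_mulVec, fromBlocks_mulVec]
      simp [hu]

/-- Even unimodular forms containing a hyperbolic plane are determined by the odd forms obtained
by replacing this plane with `⟨1⟩ ⊕ ⟨-1⟩`. -/
theorem IsCongr.hyperbolic_of_diagonal {F₁ : Matrix ι ι ℤ} {F₂ : Matrix κ κ ℤ}
    (hdet₁ : IsUnit F₁.det) (hdet₂ : IsUnit F₂.det)
    (he₁ : ∀ x, Even (toBilin' F₁ x x)) (he₂ : ∀ x, Even (toBilin' F₂ x x))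
    (h : (diagonalPlaneSum F₁).IsCongr
      (diagonalPlaneSum F₂)) :
    (hyperbolicPlaneSum F₁).IsCongr
      (hyperbolicPlaneSum F₂) := by
  obtain ⟨P, hP, hP4, hP2⟩ := h.exists_four_dvd hdet₁ he₁ he₂
  have hdouble : ∀ t, Even (toBilin' (diagonalPlaneSum F₂) t t) →
      ∃ z, (hyperbolicInclusion ι).mulVec z = P.mulVec ((2 : ℤ) • t) := by
    intro t ht
    rw [← hP, toBilin'_transpose_mul_mul] at ht
    have := two_dvd_toBilin'_diagonalPlaneSum he₁ (P.mulVec t)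
    rw [mulVec_smul]
    refine exists_hyperbolicInclusion_mulVec ?_ fun j => ⟨_, rfl⟩
    obtain ⟨c, hc⟩ := ht
    simp only [Pi.smul_apply, smul_eq_mul]
    lia
  have hcol : ∀ j, ∃ z, (hyperbolicInclusion ι).mulVec z =
      P.mulVec ((hyperbolicInclusion κ).mulVec (Pi.single j 1)) := by
    rintro (j | j)
    · fin_cases j
      · have : (hyperbolicInclusion κ).mulVec (Pi.single (.inl 0) 1) =
            Sum.elim (1 : Fin 2 → ℤ) 0 := by
          ext (i | i)
          · fin_cases i <;> simp [hyperbolicInclusion]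
          · simp [hyperbolicInclusion]
        simp only [Fin.zero_eta]
        rw [this]
        exact exists_hyperbolicInclusion_mulVec hP4 hP2
      · have : (hyperbolicInclusion κ).mulVec (Pi.single (.inl 1) 1) =
            (2 : ℤ) • Sum.elim ![1, -1] 0 := by
          ext (i | i)
          · fin_cases i <;> simp [hyperbolicInclusion]
          · simp [hyperbolicInclusion]
        simp only [Fin.mk_one]
        rw [this]
        exact hdouble _ (by rw [toBilin'_diagonalPlaneSum]; simp)
    · have : (hyperbolicInclusion κ).mulVec (Pi.single (.inr j) 1) =
          (2 : ℤ) • Pi.single (.inr j) 1 := by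
        ext (i | i)
        · simp [hyperbolicInclusion]
        · simp [hyperbolicInclusion, diagonal_apply, Pi.single_apply]
      rw [this]
      refine hdouble _ ?_
      rw [toBilin'_diagonalPlaneSum]
      simpa using he₂ _
  choose R hR using hcol
  have hR' : hyperbolicInclusion ι * (of R).transpose = P * hyperbolicInclusion κ := by
    ext i j
    have h := congrFun (hR j) i
    rw [mulVec_mulVec, mulVec_single_one] at h
    exact h
  refine IsCongr.of_card_eq (P := (of R).transpose) h.card_eq ?_ ?_
  · rw [hyperbolicPlaneSum, det_fromBlocks_zero₂₁]
    simpa using hdet₂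
  · refine smul_right_injective _ (four_ne_zero (α := ℤ)) ?_
    change (4 : ℤ) • _ = (4 : ℤ) • _
    rw [← hyperbolicInclusion_congr F₂, ← hP]
    calc _ = (of R).transpose.transpose *
          ((4 : ℤ) • hyperbolicPlaneSum F₁) * (of R).transpose := by
          rw [Matrix.mul_smul, Matrix.smul_mul]
      _ = (hyperbolicInclusion ι * (of R).transpose).transpose *
          diagonalPlaneSum F₁ *
          (hyperbolicInclusion ι * (of R).transpose) := by
        rw [← hyperbolicInclusion_congr F₁, transpose_mul]
        simp only [Matrix.mul_assoc]
      _ = _ := by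
        rw [hR', transpose_mul]
        simp only [Matrix.mul_assoc]

end

end Matrix

namespace Matrix

theorem toBilin'_map {R S ι : Type*} [CommRing R] [CommRing S] [Fintype ι] [DecidableEq ι]
    (f : R →+* S) (A : Matrix ι ι R) (x y : ι → R) :
    toBilin' (A.map f) (f ∘ x) (f ∘ y) = f (toBilin' A x y) := by
  rw [toBilin'_apply', toBilin'_apply', RingHom.map_dotProduct]
  congr 1
  ext i
  exact (RingHom.map_mulVec f A y i).symm

theorem exists_toBilin'_eq_mul {ι : Type*} [Fintype ι] [DecidableEq ι] (A : Matrix ι ι ℤ)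
    (x : ι → ℚ) : ∃ (z : ι → ℤ) (c : ℚ), 0 < c ∧
      (toBilin' A z z : ℚ) = c * toBilin' (A.map (Int.castRingHom ℚ)) x x := by
  obtain ⟨b, hb⟩ := IsLocalization.exist_integer_multiples_of_finite (nonZeroDivisors ℤ) x
  choose z hz using hb
  have hz' : Int.castRingHom ℚ ∘ z = ((b : ℤ) : ℚ) • x := by
    ext i
    simpa using hz i
  refine ⟨z, (b : ℤ) ^ 2, by positivity [nonZeroDivisors.coe_ne_zero b], ?_⟩
  have h := toBilin'_map (Int.castRingHom ℚ) A z z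
  rw [hz', map_smul, map_smul, LinearMap.smul_apply, smul_eq_mul, smul_eq_mul, eq_intCast] at h
  rw [← h]
  ring

theorem IsHermitian.isCongr_diagonal {ι : Type*} [Fintype ι] [DecidableEq ι] {A : Matrix ι ι ℝ}
    (hA : A.IsHermitian) : A.IsCongr (diagonal hA.eigenvalues) := by
  have h := hA.conjStarAlgAut_star_eigenvectorUnitary
  rw [Unitary.conjStarAlgAut_star_apply] at h
  refine ⟨hA.eigenvectorUnitary, star (hA.eigenvectorUnitary : Matrix ι ι ℝ), by simp, by simp, ?_⟩
  rw [star_eq_conjTranspose, conjTranspose_eq_transpose_of_trivial] at h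
  exact h

theorem isIndefUnimodular_of_eigenvalues {n : ℕ} {G : Matrix (Fin n) (Fin n) ℤ}
    (hG : G.transpose = G) (hdet : IsUnit G.det) (hH : (G.map (Int.cast : ℤ → ℝ)).IsHermitian)
    (hneg : 0 < (Finset.univ.filter fun i => hH.eigenvalues i < 0).card)
    (hpos : 0 < (Finset.univ.filter fun i => 0 < hH.eigenvalues i).card) :
    G.IsIndefUnimodular := by
  have : Invertible (2 : ℚ) := invertibleOfNonzero two_ne_zero
  obtain ⟨d, P, Q, hPQ, hQP, hd⟩ := exists_isCongr_diagonal (A := G.map (Int.castRingHom ℚ))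
    (by rw [← transpose_map, hG])
  have hcongr : (diagonal hH.eigenvalues).IsCongr (diagonal fun i => (d i : ℝ)) := by
    have h := IsCongr.map (⟨P, Q, hPQ, hQP, hd⟩ : IsCongr _ _) (Rat.castHom ℝ)
    have h1 : (G.map (Int.castRingHom ℚ)).map (Rat.castHom ℝ) = G.map (Int.cast : ℤ → ℝ) := by
      ext i j
      simp
    rw [h1, diagonal_map (map_zero _)] at h
    exact hH.isCongr_diagonal.symm.trans h
  have hval : ∀ i, ∃ (z : Fin n → ℤ) (c : ℚ), 0 < c ∧ (toBilin' G z z : ℚ) = c * d i := by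
    intro i
    obtain ⟨z, c, hc, h⟩ := exists_toBilin'_eq_mul G (P.mulVec (Pi.single i 1))
    refine ⟨z, c, hc, h.trans ?_⟩
    rw [← toBilin'_transpose_mul_mul, hd, toBilin'_single, diagonal_apply_eq]
  refine ⟨hG, hdet, ?_, ?_⟩
  · have h := hcongr.countP_pos_eq
    rw [Multiset.countP_map] at h
    obtain ⟨x, hx, hx0⟩ := Multiset.countP_pos.1 (hpos.trans_eq h)
    obtain ⟨i, -, rfl⟩ := Multiset.mem_map.1 hx
    obtain ⟨z, c, hc, hz⟩ := hval i
    refine ⟨z, (Int.cast_pos (R := ℚ)).1 ?_⟩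
    rw [hz]
    exact mul_pos hc (Rat.cast_pos.1 hx0)
  · have h := hcongr.countP_neg_eq
    rw [Multiset.countP_map] at h
    obtain ⟨x, hx, hx0⟩ := Multiset.countP_pos.1 (hneg.trans_eq h)
    obtain ⟨i, -, rfl⟩ := Multiset.mem_map.1 hx
    obtain ⟨z, c, hc, hz⟩ := hval i
    refine ⟨z, (Int.cast_lt_zero (R := ℚ)).1 ?_⟩
    rw [hz]
    exact mul_neg_of_pos_of_neg hc (Rat.cast_lt_zero.1 hx0)

theorem hyperbolicPlaneSum_isCongr_diagonalPlaneSum {κ : Type*} [Fintype κ] [DecidableEq κ]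
    (F : Matrix κ κ ℤ) : ((hyperbolicPlaneSum F).map (Int.castRingHom ℝ)).IsCongr
      ((diagonalPlaneSum F).map (Int.castRingHom ℝ)) := by
  rw [hyperbolicPlaneSum, diagonalPlaneSum, fromBlocks_map, fromBlocks_map]
  simp only [Matrix.map_zero _ (map_zero (Int.castRingHom ℝ))]
  refine IsCongr.fromBlocks ?_ (.refl _)
  refine IsCongr.of_isUnit_det (P := !![1, 1; 1 / 2, -1 / 2]) ?_ ?_
  · rw [det_fin_two_of]
    norm_num
  · ext i j
    fin_cases i <;> fin_cases j <;> simp [mul_apply, Fin.sum_univ_two] <;> norm_num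

theorem isIndefUnimodular_diagonalPlaneSum {κ : Type*} [Fintype κ] [DecidableEq κ]
    {F : Matrix κ κ ℤ} (hF : F.transpose = F) (hdet : IsUnit F.det) :
    (diagonalPlaneSum F).IsIndefUnimodular := by
  refine ⟨?_, ?_, ⟨Pi.single (.inl 0) 1, ?_⟩, ⟨Pi.single (.inl 1) 1, ?_⟩⟩
  · rw [diagonalPlaneSum, fromBlocks_transpose, hF, diagonal_transpose, transpose_zero,
      transpose_zero]
  · rw [diagonalPlaneSum, det_fromBlocks_zero₂₁, det_diagonal, Fin.prod_univ_two]
    simpa using hdet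
  · simp [diagonalPlaneSum]
  · simp [diagonalPlaneSum]

theorem _root_.Multiset.eq_replicate_add_replicate_of_isUnit {s : Multiset ℤ}
    (hs : ∀ a ∈ s, IsUnit a) :
    s = Multiset.replicate (s.countP (0 < ·)) 1 + Multiset.replicate (s.countP (· < 0)) (-1) := by
  induction s using Multiset.induction_on with
  | empty => simp
  | cons a s ih =>
    have ih := ih fun b hb => hs b (Multiset.mem_cons_of_mem hb)
    rcases Int.isUnit_iff.1 (hs a (Multiset.mem_cons_self a s)) with rfl | rfl
    · rw [Multiset.countP_cons_of_pos _ one_pos, Multiset.countP_cons_of_neg _ (by simp),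
        Multiset.replicate_succ, Multiset.cons_add, ← ih]
    · rw [Multiset.countP_cons_of_neg _ (by simp), Multiset.countP_cons_of_pos _ (by simp),
        Multiset.replicate_succ, Multiset.add_cons, ← ih]

/-- An indefinite even unimodular form splits off a hyperbolic plane; the complement `F` is such
that `⟨1⟩ ⊕ ⟨-1⟩ ⊕ F` is diagonalizable with entries determined by the signature. -/
theorem exists_isCongr_hyperbolicPlaneSum {n : ℕ} {G : Matrix (Fin n) (Fin n) ℤ}
    (hG : G.transpose = G) (heven : ∀ i, Even (G i i)) (hdet : |G.det| = 1)
    (hH : (G.map (Int.cast : ℤ → ℝ)).IsHermitian) {r s : ℕ} (hr : 1 ≤ r) (hs : 1 ≤ s)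
    (hr' : (Finset.univ.filter fun i => hH.eigenvalues i < 0).card = r)
    (hs' : (Finset.univ.filter fun i => 0 < hH.eigenvalues i).card = s) :
    ∃ (m : ℕ) (F : Matrix (Fin m) (Fin m) ℤ) (a : Fin 2 ⊕ Fin m → ℤ),
      IsUnit F.det ∧ (∀ x, Even (toBilin' F x x)) ∧ G.IsCongr (hyperbolicPlaneSum F) ∧
      (diagonalPlaneSum F).IsCongr (diagonal a) ∧
      Finset.univ.val.map a = Multiset.replicate s 1 + Multiset.replicate r (-1) := by
  have hI := isIndefUnimodular_of_eigenvalues hG (Int.isUnit_iff_abs_eq.2 hdet) hH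
    (by lia) (by lia)
  have heven' := even_toBilin'_self hG heven
  obtain ⟨m, F, hF⟩ := hI.exists_isCongr_of_even heven'
  have hdetF := isUnit_det_of_fromBlocks (hF.isUnit_det hI.isUnit_det)
  have hevenF : ∀ x, Even (toBilin' F x x) := by
    intro x
    obtain ⟨P, Q, -, -, h⟩ := hF
    have h' := heven' (P.mulVec (Sum.elim 0 x))
    rw [← toBilin'_transpose_mul_mul, h, hyperbolicPlaneSum, toBilin'_fromBlocks] at h'
    simpa using h'
  obtain ⟨a, ha, hFa⟩ := (isIndefUnimodular_diagonalPlaneSum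
    (transpose_eq_of_fromBlocks (hF.transpose_eq hG)) hdetF).exists_isCongr_diagonal_of_odd
    ⟨Pi.single (.inl 0) 1, by simp [diagonalPlaneSum]⟩
  have hreal : (diagonal hH.eigenvalues).IsCongr (diagonal fun i => (a i : ℝ)) := by
    have h := ((hF.map (Int.castRingHom ℝ)).trans
      (hyperbolicPlaneSum_isCongr_diagonalPlaneSum F)).trans (hFa.map (Int.castRingHom ℝ))
    rw [diagonal_map (map_zero _)] at h
    exact hH.isCongr_diagonal.symm.trans h
  refine ⟨m, F, a, hdetF, hevenF, hF, hFa, ?_⟩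
  have hp := hreal.countP_pos_eq
  have hn := hreal.countP_neg_eq
  rw [Multiset.countP_map, Multiset.countP_map] at hp hn
  have hunit : ∀ x ∈ Finset.univ.val.map a, IsUnit x := by
    intro x hx
    obtain ⟨i, -, rfl⟩ := Multiset.mem_map.1 hx
    exact ha i
  rw [Multiset.eq_replicate_add_replicate_of_isUnit hunit, Multiset.countP_map,
    Multiset.countP_map, ← hr', ← hs']
  simp only [Int.cast_pos, Int.cast_lt_zero] at hp hn
  rw [← hp, ← hn]
  rfl

end Matrix

/-- Two even unimodular integer Gram matrices of the same indefinite
signature `(r, s)` (with `r ≥ 1` and `s ≥ 1`) are integrally congruent: there is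
`P ∈ GL(n, ℤ)` with `Pᵀ G₁ P = G₂`. -/
theorem indefinite_even_unimodular_integrally_congruent
    (n : ℕ) (G₁ G₂ : Matrix (Fin n) (Fin n) ℤ)
    (hsym₁ : G₁.transpose = G₁) (hsym₂ : G₂.transpose = G₂)
    (heven₁ : ∀ i, Even (G₁ i i)) (heven₂ : ∀ i, Even (G₂ i i))
    (hdet₁ : |G₁.det| = 1) (hdet₂ : |G₂.det| = 1)
    (hH₁ : (G₁.map (Int.cast : ℤ → ℝ)).IsHermitian)
    (hH₂ : (G₂.map (Int.cast : ℤ → ℝ)).IsHermitian)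
    (r s : ℕ) (hr : 1 ≤ r) (hs : 1 ≤ s)
    (hr₁ : (Finset.univ.filter fun i => hH₁.eigenvalues i < 0).card = r)
    (hs₁ : (Finset.univ.filter fun i => 0 < hH₁.eigenvalues i).card = s)
    (hr₂ : (Finset.univ.filter fun i => hH₂.eigenvalues i < 0).card = r)
    (hs₂ : (Finset.univ.filter fun i => 0 < hH₂.eigenvalues i).card = s) :
    ∃ P : Matrix (Fin n) (Fin n) ℤ, IsUnit P.det ∧ P.transpose * G₁ * P = G₂ := by
  obtain ⟨m₁, F₁, a₁, hF₁, he₁, h₁, hd₁, ha₁⟩ :=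
    Matrix.exists_isCongr_hyperbolicPlaneSum hsym₁ heven₁ hdet₁ hH₁ hr hs hr₁ hs₁
  obtain ⟨m₂, F₂, a₂, hF₂, he₂, h₂, hd₂, ha₂⟩ :=
    Matrix.exists_isCongr_hyperbolicPlaneSum hsym₂ heven₂ hdet₂ hH₂ hr hs hr₂ hs₂
  have h : (Matrix.diagonalPlaneSum F₁).IsCongr (Matrix.diagonalPlaneSum F₂) :=
    (hd₁.trans (.diagonal (ha₁.trans ha₂.symm))).trans hd₂.symm
  obtain ⟨P, Q, hPQ, -, hP⟩ :=
    (h₁.trans (h.hyperbolic_of_diagonal hF₁ hF₂ he₁ he₂)).trans h₂.symm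
  exact ⟨P, Matrix.isUnit_det_of_right_inverse hPQ, hP⟩
end
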